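/- arXiv:2605.09759 — 5 statements merged into one kernel-verified Lean document; each statement's English description precedes it below -/
import Mathlib

section
/- Let n ≥ 1 be a natural number and let m > 0 be real. Then there exists a constant C = C(n,m) > 0 such that for every a ∈ (0,1] and every r ∈ (0,1), (1−r)^m · (n/a) · r^{n/a − n} ≤ C · a^{m−1}. -/
open Set

/-- The elementary bound `t ^ m ≤ m ^ m * exp t` for `t ≥ 0` and `m > 0`. -/
theorem rpow_le_rpow_self_mul_exp {m t : ℝ} (hm : 0 < m) (ht : 0 ≤ t) :
    t ^ m ≤ m ^ m * Real.exp t := by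
  have h : t ≤ m * Real.exp (t / m) := by
    have h1 : t / m ≤ Real.exp (t / m) := by linarith [Real.add_one_le_exp (t / m)]
    rwa [div_le_iff₀' hm] at h1
  calc t ^ m ≤ (m * Real.exp (t / m)) ^ m := Real.rpow_le_rpow ht h hm.le
    _ = m ^ m * Real.exp t := by
      rw [Real.mul_rpow hm.le (Real.exp_pos _).le, ← Real.exp_mul, div_mul_cancel₀ _ hm.ne']

/-- The bound `r ^ s ≤ exp (-(1 - r) * s)` for `r > 0` and `s ≥ 0`. -/
theorem rpow_le_exp_neg_one_sub_mul {r s : ℝ} (hr : 0 < r) (hs : 0 ≤ s) :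
    r ^ s ≤ Real.exp (-(1 - r) * s) := by
  rw [Real.rpow_def_of_pos hr, Real.exp_le_exp]
  exact mul_le_mul_of_nonneg_right (by linarith [Real.log_le_sub_one_of_pos hr]) hs

/-- For `n ≥ 1` and `m > 0` there is `C = C(n,m) > 0` such that for every
`a ∈ (0,1]` and every `r ∈ (0,1)` one has `(1-r)^m · (n/a) · r^{n/a-n} ≤ C · a^{m-1}`. -/
theorem statement_1 (n : ℕ) (hn : 1 ≤ n) (m : ℝ) (hm : 0 < m) :
    ∃ C : ℝ, 0 < C ∧ ∀ a ∈ Set.Ioc (0 : ℝ) 1, ∀ r ∈ Set.Ioo (0 : ℝ) 1,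
      (1 - r) ^ m * ((n : ℝ) / a) * r ^ ((n : ℝ) / a - (n : ℝ)) ≤ C * a ^ (m - 1) := by
  have hn1 : (1 : ℝ) ≤ n := by exact_mod_cast hn
  have hn0 : (0 : ℝ) < n := by linarith
  refine ⟨n * m ^ m * Real.exp n, by positivity, ?_⟩
  rintro a ⟨ha, ha1⟩ r ⟨hr, hr1⟩
  set t := (1 - r) / a with ht
  have ht0 : 0 ≤ t := div_nonneg (by linarith) ha.le
  have hta : 1 - r = t * a := by rw [ht, div_mul_cancel₀ _ ha.ne']
  have hs : 0 ≤ (n : ℝ) / a - n := by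
    rw [sub_nonneg, le_div_iff₀ ha]
    nlinarith
  have hpow : r ^ ((n : ℝ) / a - n) ≤ Real.exp (n - t) := by
    refine (rpow_le_exp_neg_one_sub_mul hr hs).trans (Real.exp_le_exp.mpr ?_)
    have h : -(1 - r) * ((n : ℝ) / a - n) = n * (1 - r) - n * t := by
      rw [ht]
      ring
    rw [h]
    nlinarith
  have key : t ^ m * r ^ ((n : ℝ) / a - n) ≤ m ^ m * Real.exp n := by
    calc t ^ m * r ^ ((n : ℝ) / a - n)
        ≤ m ^ m * Real.exp t * Real.exp (n - t) := by
          gcongr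
          exact rpow_le_rpow_self_mul_exp hm ht0
      _ = m ^ m * Real.exp n := by
          rw [mul_assoc, ← Real.exp_add, add_sub_cancel]
  have hfac : 0 ≤ (n : ℝ) * (a ^ m / a) := by positivity
  calc (1 - r) ^ m * ((n : ℝ) / a) * r ^ ((n : ℝ) / a - n)
      = n * (a ^ m / a) * (t ^ m * r ^ ((n : ℝ) / a - n)) := by
        rw [hta, Real.mul_rpow ht0 ha.le]
        ring
    _ ≤ n * (a ^ m / a) * (m ^ m * Real.exp n) := mul_le_mul_of_nonneg_left key hfac
    _ = n * m ^ m * Real.exp n * a ^ (m - 1) := by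
        rw [Real.rpow_sub_one ha.ne']
        ring
end

section
/- Let n ≥ 1 be a natural number and let t > 0 be real. Then there exists a constant C = C(n,t) > 0 such that for every a ∈ (0,1], ∫₀¹ (1−r)^t · (n/a) · r^{n/a − 1} dr ≤ C · a^t. -/
open Set MeasureTheory

/-- For `x ∈ (0,1)` and `N ≥ 1` one has `x ^ (N - 1) ≤ e * exp (-N (1 - x))`. -/
theorem rpow_sub_one_le_exp_mul {N x : ℝ} (hN : 1 ≤ N) (hx : x ∈ Ioo (0 : ℝ) 1) :
    x ^ (N - 1) ≤ Real.exp 1 * Real.exp (-(N * (1 - x))) := by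
  rw [Real.rpow_def_of_pos hx.1, ← Real.exp_add, Real.exp_le_exp]
  have hlog : Real.log x ≤ x - 1 := Real.log_le_sub_one_of_pos hx.1
  nlinarith [mul_le_mul_of_nonneg_right hlog (sub_nonneg.2 hN), hx.1]

theorem integrableOn_rpow_mul_exp_neg_mul {t N : ℝ} (ht : -1 < t) (hN : 0 < N) :
    IntegrableOn (fun s : ℝ => s ^ t * Real.exp (-(N * s))) (Ioi 0) := by
  simpa [neg_mul] using integrableOn_rpow_mul_exp_neg_mul_rpow ht one_pos hN

/-- A weighted beta integral is dominated by the corresponding gamma integral. -/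
theorem integral_one_sub_rpow_mul_rpow_le {t N : ℝ} (ht : 0 < t) (hN : 1 ≤ N) :
    ∫ r in Ioo (0 : ℝ) 1, (1 - r) ^ t * N * r ^ (N - 1) ≤
      Real.exp 1 * Real.Gamma (t + 1) * (1 / N) ^ t := by
  have hN0 : 0 < N := by linarith
  set g : ℝ → ℝ := fun s => s ^ t * Real.exp (-(N * s)) with hg
  have hg_cont : Continuous g :=
    (Real.continuous_rpow_const ht.le).mul (by fun_prop)
  calc
    ∫ r in Ioo (0 : ℝ) 1, (1 - r) ^ t * N * r ^ (N - 1)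
        ≤ ∫ r in Ioo (0 : ℝ) 1, N * Real.exp 1 * g (1 - r) := by
      refine integral_mono_of_nonneg ?_ ?_ ?_
      · filter_upwards [ae_restrict_mem measurableSet_Ioo] with r hr
        have h1 : 0 ≤ 1 - r := by linarith [hr.2]
        have h0 : 0 ≤ r := hr.1.le
        simp only [Pi.zero_apply]
        positivity
      · exact ((by fun_prop : Continuous fun r : ℝ => N * Real.exp 1 * g (1 - r)).integrableOn_Icc
          (a := 0) (b := 1)).mono_set Ioo_subset_Icc_self
      · filter_upwards [ae_restrict_mem measurableSet_Ioo] with r hr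
        have h1 : 0 ≤ 1 - r := by linarith [hr.2]
        calc (1 - r) ^ t * N * r ^ (N - 1)
            ≤ (1 - r) ^ t * N * (Real.exp 1 * Real.exp (-(N * (1 - r)))) := by
              gcongr
              exact rpow_sub_one_le_exp_mul hN hr
          _ = N * Real.exp 1 * g (1 - r) := by simp only [hg]; ring
    _ = N * Real.exp 1 * ∫ s in Ioc (0 : ℝ) 1, g s := by
      rw [integral_const_mul, ← integral_Ioc_eq_integral_Ioo,
        ← intervalIntegral.integral_of_le zero_le_one,
        ← intervalIntegral.integral_of_le zero_le_one,
        intervalIntegral.integral_comp_sub_left g 1, sub_self, sub_zero]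
    _ ≤ N * Real.exp 1 * ∫ s in Ioi (0 : ℝ), g s := by
      refine mul_le_mul_of_nonneg_left ?_ (by positivity)
      refine setIntegral_mono_set (integrableOn_rpow_mul_exp_neg_mul (by linarith) hN0) ?_
        Ioc_subset_Ioi_self.eventuallyLE
      filter_upwards [ae_restrict_mem measurableSet_Ioi] with s hs
      have hs0 : 0 < s := hs
      simp only [hg, Pi.zero_apply]
      positivity
    _ = Real.exp 1 * Real.Gamma (t + 1) * (1 / N) ^ t := by
      have h := Real.integral_rpow_mul_exp_neg_mul_Ioi (a := t + 1) (by linarith) hN0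
      rw [add_sub_cancel_right] at h
      rw [h, Real.rpow_add_one (by positivity)]
      field_simp

/-- For `n ≥ 1` and `t > 0` there is `C = C(n,t) > 0` such that for every
`a ∈ (0,1]` one has `∫₀¹ (1-r)^t · (n/a) · r^{n/a-1} dr ≤ C · a^t`. -/
theorem statement_2 (n : ℕ) (hn : 1 ≤ n) (t : ℝ) (ht : 0 < t) :
    ∃ C : ℝ, 0 < C ∧ ∀ a ∈ Set.Ioc (0 : ℝ) 1,
      (∫ r in Set.Ioo (0 : ℝ) 1, (1 - r) ^ t * ((n : ℝ) / a) * r ^ ((n : ℝ) / a - 1))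
        ≤ C * a ^ t := by
  have hΓ : 0 < Real.Gamma (t + 1) := Real.Gamma_pos_of_pos (by linarith)
  refine ⟨Real.exp 1 * Real.Gamma (t + 1), by positivity, fun a ⟨ha0, ha1⟩ => ?_⟩
  have hn1 : (1 : ℝ) ≤ n := by exact_mod_cast hn
  refine (integral_one_sub_rpow_mul_rpow_le ht
    ((one_le_div ha0).2 (ha1.trans hn1))).trans ?_
  gcongr
  rw [one_div_div]
  exact div_le_self ha0.le hn1
end

section
/- Let n ≥ 2, let 1 ≤ q < ∞, let 0 < s < 1, and let α : ∂B → [0,∞) be bounded measurable. Then there exists a constant C > 0, depending only on n, q, s and ‖α‖_{L^∞(∂B)}, such that for every measurable g : ∂B → ℝ with finite Slobodeckij norm ‖g‖_{W^{s,q}(∂B)} and every a ∈ (0,1]: ( ∫_B |P[g](x) − g(x/|x|)|^q μ_a(x) dx )^{1/q} ≤ C · a^s · ‖g‖_{W^{s,q}(∂B)}. -/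
open MeasureTheory Metric ENNReal

noncomputable section

/-- Euclidean space `ℝⁿ`. -/
abbrev E (n : ℕ) : Type := EuclideanSpace ℝ (Fin n)

/-- The surface measure `σ` on the unit sphere `∂B`: the `(n-1)`-dimensional Hausdorff
measure restricted to the sphere. -/
def sphMeas (n : ℕ) : Measure (E n) :=
  (μH[(n : ℝ) - 1]).restrict (Metric.sphere (0 : E n) 1)

/-- The concentrating bulk weight `μ_a(x) = α(x/|x|) · (n/a)·|x|^{n/a-n}`. -/
def muW (n : ℕ) (α : E n → ℝ) (a : ℝ) (x : E n) : ℝ :=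
  α (‖x‖⁻¹ • x) * (((n : ℝ) / a) * ‖x‖ ^ ((n : ℝ) / a - (n : ℝ)))

/-- The Poisson extension `P[g](x) = ∫_{∂B} (1/σ(∂B)) (1-|x|²)/|x-η|ⁿ g(η) dσ(η)`. -/
def poissonExt (n : ℕ) (g : E n → ℝ) (x : E n) : ℝ :=
  ∫ η, ((sphMeas n Set.univ).toReal)⁻¹ * ((1 - ‖x‖ ^ 2) / ‖x - η‖ ^ n) * g η ∂(sphMeas n)

/-- The `q`-th power of the Slobodeckij norm `‖g‖_{W^{s,q}(∂B)}`, valued in `[0,∞]`: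
`∫_{∂B} |g|^q dσ + ∬_{∂B×∂B} |g(ξ)-g(η)|^q / |ξ-η|^{(n-1)+sq} dσ dσ`. -/
def slobodeckijQ (n : ℕ) (s q : ℝ) (g : E n → ℝ) : ℝ≥0∞ :=
  (∫⁻ ξ, ENNReal.ofReal (|g ξ| ^ q) ∂(sphMeas n)) +
    ∫⁻ ξ, ∫⁻ η,
      ENNReal.ofReal (|g ξ - g η| ^ q / ‖ξ - η‖ ^ ((n : ℝ) - 1 + s * q))
        ∂(sphMeas n) ∂(sphMeas n)

/-- Normalization `x ↦ x / ‖x‖` is `2`-Lipschitz outside the open unit ball. -/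
lemma lipschitzOnWith_inv_norm_smul {F : Type*} [NormedAddCommGroup F] [NormedSpace ℝ F] :
    LipschitzOnWith 2 (fun x : F => ‖x‖⁻¹ • x) {x | 1 ≤ ‖x‖} := by
  refine LipschitzOnWith.of_dist_le_mul fun x hx y hy => ?_
  simp only [Set.mem_ofPred_eq] at hx hy
  rw [dist_eq_norm, dist_eq_norm]
  have hx0 : 0 < ‖x‖ := by linarith
  have hy0 : 0 < ‖y‖ := by linarith
  have h1 : ‖x‖⁻¹ • x - ‖y‖⁻¹ • y = ‖x‖⁻¹ • (x - y) + (‖x‖⁻¹ - ‖y‖⁻¹) • y := by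
    rw [smul_sub, sub_smul]; abel
  have h2 : (‖x‖⁻¹ - ‖y‖⁻¹) = ‖x‖⁻¹ * (‖y‖ - ‖x‖) * ‖y‖⁻¹ := by
    field_simp
  have h3 : ‖x‖⁻¹ ≤ 1 := inv_le_one_of_one_le₀ hx
  have h4 : |‖y‖ - ‖x‖| ≤ ‖x - y‖ := by
    rw [← norm_sub_rev]; exact abs_norm_sub_norm_le y x
  calc ‖‖x‖⁻¹ • x - ‖y‖⁻¹ • y‖
      ≤ ‖‖x‖⁻¹ • (x - y)‖ + ‖(‖x‖⁻¹ - ‖y‖⁻¹) • y‖ := by rw [h1]; exact norm_add_le _ _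
    _ = ‖x‖⁻¹ * ‖x - y‖ + ‖x‖⁻¹ * |‖y‖ - ‖x‖| := by
        rw [norm_smul, norm_smul, h2, norm_mul, norm_mul, norm_inv, norm_inv, norm_norm,
          norm_norm, Real.norm_eq_abs]
        field_simp
    _ ≤ 1 * ‖x - y‖ + 1 * ‖x - y‖ := by gcongr
    _ = ((2 : NNReal) : ℝ) * ‖x - y‖ := by push_cast; ring

lemma hausdorffMeasure_sphere_lt_top {n : ℕ} (hn : 2 ≤ n) :
    μH[(n : ℝ) - 1] (sphere (0 : E n) 1) < ⊤ := by
  refine (isCompact_sphere _ _).measure_lt_top_of_nhdsWithin fun v hv => ?_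
  have hv1 : ‖v‖ = 1 := by simpa using hv
  obtain ⟨m, rfl⟩ : ∃ m, n = m + 1 := ⟨n - 1, by omega⟩
  have : Fact (Module.finrank ℝ (E (m + 1)) = m + 1) := ⟨by simp⟩
  have hv0 : v ≠ 0 := by rintro rfl; simp at hv1
  set F := (Submodule.span ℝ {v})ᗮ with hF
  have hdim : Module.finrank ℝ F = m := Submodule.finrank_orthogonal_span_singleton hv0
  set G : F → E (m + 1) := fun w => ‖v + (w : E (m + 1))‖⁻¹ • (v + (w : E (m + 1))) with hG
  have horth : ∀ w : F, inner ℝ v (w : E (m + 1)) = 0 := fun w =>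
    Submodule.mem_orthogonal_singleton_iff_inner_right.1 w.2
  have hGlip : LipschitzOnWith (2 * 1) G Set.univ := by
    refine lipschitzOnWith_inv_norm_smul.comp (t := {x : E (m + 1) | 1 ≤ ‖x‖})
      (f := fun w : F => v + (w : E (m + 1))) ?_ ?_
    · refine LipschitzOnWith.of_dist_le_mul fun x _ y _ => ?_
      simp [Subtype.dist_eq]
    · intro w _
      have h := norm_add_sq_eq_norm_sq_add_norm_sq_of_inner_eq_zero v (w : E (m + 1)) (horth w)
      rw [hv1] at h
      simp only [Set.mem_ofPred_eq]
      nlinarith [norm_nonneg (v + (w : E (m + 1))), norm_nonneg (w : E (m + 1))]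
  have hfin : μH[((m + 1 : ℕ) : ℝ) - 1] (G '' closedBall 0 3) < ⊤ := by
    have h1 := (hGlip.mono (Set.subset_univ (closedBall 0 3))).hausdorffMeasure_image_le
      (d := (m : ℝ)) (by positivity)
    have h2 : ((m + 1 : ℕ) : ℝ) - 1 = m := by push_cast; ring
    rw [h2]
    refine h1.trans_lt (ENNReal.mul_lt_top ?_ ?_)
    · exact ENNReal.rpow_lt_top_of_nonneg (by positivity) (by simp)
    · have h3 : μH[(Module.finrank ℝ F : ℝ)] (closedBall (0 : F) 3) < ⊤ :=
        (isCompact_closedBall (0 : F) 3).measure_lt_top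
      rwa [congrArg (Nat.cast (R := ℝ)) hdim] at h3
  refine ⟨G '' closedBall 0 3, ?_, hfin⟩
  have hopen : {x : E (m + 1) | 1 / 2 < inner ℝ v x} ∈ nhds v := by
    refine IsOpen.mem_nhds (isOpen_lt continuous_const (by fun_prop)) ?_
    simp [hv1]; norm_num
  filter_upwards [self_mem_nhdsWithin, mem_nhdsWithin_of_mem_nhds hopen] with x hx hx2
  have hx1 : ‖x‖ = 1 := by simpa using hx
  set c : ℝ := inner ℝ v x with hc
  have hc0 : 0 < c := by linarith
  have hmem : c⁻¹ • x - v ∈ F := by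
    rw [hF, Submodule.mem_orthogonal_singleton_iff_inner_right, inner_sub_right,
      inner_smul_right, ← hc, real_inner_self_eq_norm_sq, hv1]
    field_simp; norm_num
  refine ⟨⟨_, hmem⟩, ?_, ?_⟩
  · simp only [mem_closedBall, dist_zero_right, Submodule.coe_norm]
    calc ‖c⁻¹ • x - v‖ ≤ ‖c⁻¹ • x‖ + ‖v‖ := norm_sub_le _ _
      _ = c⁻¹ + 1 := by rw [norm_smul, hx1, hv1, norm_inv, Real.norm_of_nonneg hc0.le, mul_one]
      _ ≤ 3 := by
        have : c⁻¹ ≤ (1 / 2)⁻¹ := inv_anti₀ (by norm_num) hx2.le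
        norm_num at this; linarith
  · simp only [hG]
    rw [add_sub_cancel, norm_smul, hx1, norm_inv, Real.norm_of_nonneg hc0.le, mul_one, inv_inv,
      smul_smul, mul_inv_cancel₀ hc0.ne', one_smul]

lemma isFiniteMeasure_sphMeas {n : ℕ} (hn : 2 ≤ n) : IsFiniteMeasure (sphMeas n) :=
  ⟨by simpa [sphMeas] using hausdorffMeasure_sphere_lt_top hn⟩

lemma ae_sphMeas (n : ℕ) : ∀ᵐ η ∂(sphMeas n), ‖η‖ = 1 := by
  filter_upwards [ae_restrict_mem (isClosed_sphere (x := (0 : E n)) (ε := 1)).measurableSet]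
    with η hη
  simpa using hη

lemma measurePreserving_sphMeas {n : ℕ} (T : E n ≃ₗᵢ[ℝ] E n) :
    MeasurePreserving T (sphMeas n) (sphMeas n) := by
  have h := (T.toIsometryEquiv.measurePreserving_hausdorffMeasure ((n : ℝ) - 1)).restrict_preimage
    (isClosed_sphere (x := (0 : E n)) (ε := 1)).measurableSet
  have h2 : T.toIsometryEquiv ⁻¹' sphere (0 : E n) 1 = sphere 0 1 := by
    ext x; simp
  rw [h2] at h
  exact h

lemma measurableEmbedding_linearIsometryEquiv {n : ℕ} (T : E n ≃ₗᵢ[ℝ] E n) :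
    MeasurableEmbedding T := T.toHomeomorph.measurableEmbedding

open scoped Pointwise in
lemma toSphere_closedBall_le {n : ℕ} (hn : 2 ≤ n) :
    ∃ K : ℝ, 0 < K ∧ ∀ (ξ : sphere (0 : E n) 1) (ρ : ℝ), 0 < ρ → ρ ≤ 1 →
      (volume : Measure (E n)).toSphere (closedBall ξ ρ) ≤ ENNReal.ofReal (K * ρ ^ (n - 1)) := by
  have hω : 0 < (volume : Measure (E n)).real (ball 0 1) :=
    ENNReal.toReal_pos (measure_ball_pos _ _ one_pos).ne' measure_ball_lt_top.ne
  set ω := (volume : Measure (E n)).real (ball 0 1) with hωdef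
  refine ⟨n * (2 ^ n * ω), by positivity, fun ξ ρ hρ hρ1 => ?_⟩
  have hξ : ‖(ξ : E n)‖ = 1 := by simp
  rw [Measure.toSphere_apply' _ measurableSet_closedBall]
  set T : Set (E n) := Set.Ioo (0 : ℝ) 1 • ((↑) '' closedBall ξ ρ) with hT
  have hTball : T ⊆ ball 0 1 := by
    rintro _ ⟨t, ht, _, ⟨η, hη, rfl⟩, rfl⟩
    simp [norm_smul, abs_of_pos ht.1, ht.2]
  have hTfin : volume T < ⊤ := (measure_mono hTball).trans_lt measure_ball_lt_top
  have hsub : T ⊆ (1 - ρ) • T ∪ closedBall (ξ : E n) (2 * ρ) := by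
    rintro _ ⟨t, ht, _, ⟨η, hη, rfl⟩, rfl⟩
    have hη1 : ‖(η : E n)‖ = 1 := by simp
    rcases lt_or_ge t (1 - ρ) with h | h
    · left
      have h0 : 0 < 1 - ρ := ht.1.trans h
      refine ⟨(t / (1 - ρ)) • (η : E n), ⟨t / (1 - ρ), ⟨by have := ht.1; positivity, ?_⟩, η,
        ⟨η, hη, rfl⟩, rfl⟩, ?_⟩
      · rw [div_lt_one h0]; exact h
      · simp only [smul_smul]
        congr 1
        field_simp
    · right
      rw [mem_closedBall, dist_eq_norm]
      have h2 : t • (η : E n) - ξ = (t - 1) • (η : E n) + ((η : E n) - ξ) := by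
        rw [sub_smul]; simp
      have h3 : ‖(η : E n) - ξ‖ ≤ ρ := by
        have := mem_closedBall.1 hη
        rwa [Subtype.dist_eq, dist_eq_norm] at this
      calc ‖t • (η : E n) - ξ‖ ≤ ‖(t - 1) • (η : E n)‖ + ‖(η : E n) - ξ‖ := by
            rw [h2]; exact norm_add_le _ _
        _ ≤ ρ + ρ := by
            rw [norm_smul, hη1, mul_one, Real.norm_eq_abs, abs_of_neg (by linarith [ht.2])]
            linarith
        _ = 2 * ρ := by ring
  have h1 : volume T ≤ ENNReal.ofReal ((1 - ρ) ^ n) * volume T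
      + ENNReal.ofReal ((2 * ρ) ^ n) * volume (ball (0 : E n) 1) := by
    refine (measure_mono hsub).trans ((measure_union_le _ _).trans (add_le_add ?_ ?_))
    · rw [Measure.addHaar_smul_of_nonneg _ (by linarith)]
      simp
    · rw [Measure.addHaar_closedBall _ _ (by positivity)]
      simp
  have h2 : (volume : Measure (E n)).real T ≤ (1 - ρ) ^ n * (volume : Measure (E n)).real T
      + (2 * ρ) ^ n * ω := by
    have h3 := ENNReal.toReal_mono (by finiteness) h1
    rw [ENNReal.toReal_add (by finiteness) (by finiteness), ENNReal.toReal_mul, ENNReal.toReal_mul,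
      ENNReal.toReal_ofReal (pow_nonneg (by linarith) _),
      ENNReal.toReal_ofReal (by positivity)] at h3
    exact h3
  have h3 : (1 - ρ) ^ n ≤ 1 - ρ := by
    calc (1 - ρ) ^ n ≤ (1 - ρ) ^ 1 :=
          pow_le_pow_of_le_one (by linarith) (by linarith) (by omega)
      _ = 1 - ρ := pow_one _
  have hV : 0 ≤ (volume : Measure (E n)).real T := measureReal_nonneg
  have h4 : ρ * (volume : Measure (E n)).real T ≤ ρ * (2 ^ n * ω * ρ ^ (n - 1)) := by
    have h5 : (2 * ρ) ^ n * ω = ρ * (2 ^ n * ω * ρ ^ (n - 1)) := by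
      obtain ⟨m, rfl⟩ : ∃ m, n = m + 1 := ⟨n - 1, by omega⟩
      simp only [Nat.add_sub_cancel]; ring
    rw [← h5]
    nlinarith
  have h5 := le_of_mul_le_mul_left h4 hρ
  have h6 : volume T = ENNReal.ofReal ((volume : Measure (E n)).real T) :=
    (ENNReal.ofReal_toReal hTfin.ne).symm
  rw [h6, finrank_euclideanSpace_fin, ← ENNReal.ofReal_natCast, ← ENNReal.ofReal_mul (by positivity)]
  refine ENNReal.ofReal_le_ofReal ?_
  calc (n : ℝ) * (volume : Measure (E n)).real T ≤ n * (2 ^ n * ω * ρ ^ (n - 1)) := by gcongr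
    _ = _ := by ring

lemma toSphere_le_sphMeas {n : ℕ} (hn : 2 ≤ n) :
    ∃ K : ℝ, 0 < K ∧ (volume : Measure (E n)).toSphere.map (↑) ≤ ENNReal.ofReal K • sphMeas n := by
  obtain ⟨K, hK, hball⟩ := toSphere_closedBall_le hn
  refine ⟨K, hK, ?_⟩
  have hme : MeasurableEmbedding ((↑) : sphere (0 : E n) 1 → E n) :=
    MeasurableEmbedding.subtype_coe (isClosed_sphere.measurableSet)
  set τ : Measure (E n) := (volume : Measure (E n)).toSphere.map (↑) with hτ
  have hK0 : ENNReal.ofReal K ≠ 0 := by simpa using hK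
  have hn1 : ((n - 1 : ℕ) : ℝ) = (n : ℝ) - 1 := by rw [Nat.cast_sub (by omega)]; simp
  have hd : 0 < (n : ℝ) - 1 := by
    have : (2 : ℝ) ≤ n := by exact_mod_cast hn
    linarith
  have key : ∀ s : Set (E n), ∀ ρ : ℝ, 0 < ρ → ρ ≤ 1 → ediam s ≤ ENNReal.ofReal ρ →
      τ s ≤ ENNReal.ofReal K * ENNReal.ofReal ρ ^ ((n : ℝ) - 1) := by
    intro s ρ hρ hρ1 hs
    rw [hτ, hme.map_apply]
    rcases Set.eq_empty_or_nonempty (((↑) : sphere (0 : E n) 1 → E n) ⁻¹' s) with h | ⟨ξ, hξ⟩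
    · simp [h]
    · have hsub : (((↑) : sphere (0 : E n) 1 → E n) ⁻¹' s) ⊆ closedBall ξ ρ := by
        intro η hη
        have h1 := (edist_le_ediam_of_mem (s := s) (x := (η : E n)) (y := ξ) hη hξ).trans hs
        rw [edist_dist, ENNReal.ofReal_le_ofReal_iff hρ.le] at h1
        exact h1
      refine (measure_mono hsub).trans ((hball ξ ρ hρ hρ1).trans (le_of_eq ?_))
      rw [ENNReal.ofReal_mul hK.le, ENNReal.ofReal_rpow_of_pos hρ, ← hn1, Real.rpow_natCast]
  have h1 : (ENNReal.ofReal K)⁻¹ • τ ≤ μH[(n : ℝ) - 1] := by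
    refine Measure.le_hausdorffMeasure _ _ 1 one_pos fun s hs => ?_
    rw [Measure.smul_apply, smul_eq_mul, ENNReal.inv_mul_le_iff hK0 ENNReal.ofReal_ne_top]
    rcases eq_or_ne (ediam s) 0 with h0 | h0
    · have hlim : Filter.Tendsto
          (fun ρ : ℝ => ENNReal.ofReal K * ENNReal.ofReal ρ ^ ((n : ℝ) - 1))
          (nhdsWithin 0 (Set.Ioi 0)) (nhds (ENNReal.ofReal K * ENNReal.ofReal 0 ^ ((n : ℝ) - 1))) := by
        refine Filter.Tendsto.mono_left ?_ nhdsWithin_le_nhds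
        refine ENNReal.Tendsto.const_mul ?_ (Or.inr ENNReal.ofReal_ne_top)
        exact ((ENNReal.continuous_rpow_const.comp ENNReal.continuous_ofReal).tendsto 0)
      rw [h0, ← ENNReal.ofReal_zero]
      refine ge_of_tendsto hlim ?_
      filter_upwards [Ioc_mem_nhdsGT (one_pos : (0 : ℝ) < 1)] with ρ hρ
      exact key s ρ hρ.1 hρ.2 (by simp [h0])
    · have hfin : ediam s ≠ ⊤ := (hs.trans_lt one_lt_top).ne
      have h2 := key s (ediam s).toReal (ENNReal.toReal_pos h0 hfin)
        (by simpa using ENNReal.toReal_mono one_ne_top hs)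
        (by rw [ENNReal.ofReal_toReal hfin])
      rwa [ENNReal.ofReal_toReal hfin] at h2
  have h2 : τ = τ.restrict (sphere (0 : E n) 1) := by
    refine (Measure.restrict_eq_self_of_ae_mem ?_).symm
    rw [hτ, hme.ae_map_iff]
    exact Filter.Eventually.of_forall fun x => x.2
  have h3 : τ ≤ ENNReal.ofReal K • μH[(n : ℝ) - 1] := by
    intro s
    have := h1 s
    rw [Measure.smul_apply, smul_eq_mul, ENNReal.inv_mul_le_iff hK0 ENNReal.ofReal_ne_top] at this
    exact this
  rw [h2, sphMeas, ← Measure.restrict_smul]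
  exact Measure.restrict_mono_measure h3 _

lemma sphMeas_univ_ne_zero {n : ℕ} (hn : 2 ≤ n) : sphMeas n Set.univ ≠ 0 := by
  obtain ⟨K, hK, h⟩ := toSphere_le_sphMeas hn
  intro h0
  have h1 := h Set.univ
  rw [Measure.smul_apply, h0, smul_zero, Measure.map_apply measurable_subtype_coe .univ,
    Set.preimage_univ, Measure.toSphere_apply_univ, finrank_euclideanSpace_fin] at h1
  have h2 : (volume : Measure (E n)) (ball 0 1) ≠ 0 := (measure_ball_pos _ _ one_pos).ne'
  have h3 : n ≠ 0 := by omega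
  simp [h3, h2] at h1

/-- Integration over the unit ball in polar coordinates, dominated by the surface measure. -/
lemma setLIntegral_ball_le {n : ℕ} (hn : 2 ≤ n) :
    ∃ K : ℝ, 0 < K ∧ ∀ (f : E n → ℝ≥0∞) (H : ℝ → ℝ≥0∞) (J : E n → ℝ≥0∞), Measurable H →
      Measurable J →
      (∀ r : ℝ, 0 < r → r < 1 → ∀ ξ : E n, ‖ξ‖ = 1 → f (r • ξ) ≤ H r * J ξ) →
      ∫⁻ x in ball (0 : E n) 1, f x ≤
        ENNReal.ofReal K * ((∫⁻ ξ, J ξ ∂(sphMeas n)) *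
          ∫⁻ r in Set.Ioo (0 : ℝ) 1, ENNReal.ofReal (r ^ (n - 1)) * H r) := by
  obtain ⟨K, hK, h⟩ := toSphere_le_sphMeas hn
  refine ⟨K, hK, fun f H J hH hJ hf => ?_⟩
  have : Nonempty (Fin n) := ⟨⟨0, by omega⟩⟩
  set F : E n → ℝ≥0∞ := (ball (0 : E n) 1).indicator f
  set H' : ℝ → ℝ≥0∞ := (Set.Iio (1 : ℝ)).indicator H
  have hH' : Measurable H' := hH.indicator measurableSet_Iio
  calc ∫⁻ x in ball (0 : E n) 1, f x = ∫⁻ x, F x := (lintegral_indicator measurableSet_ball f).symm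
    _ = ∫⁻ x : ({(0)}ᶜ : Set (E n)), F x ∂((volume : Measure (E n)).comap Subtype.val) := by
        rw [lintegral_subtype_comap (measurableSet_singleton _).compl F, restrict_compl_singleton]
    _ = ∫⁻ p, F ((p.2 : ℝ) • (p.1 : E n))
          ∂((volume : Measure (E n)).toSphere.prod (.volumeIoiPow (Module.finrank ℝ (E n) - 1))) := by
        rw [← (volume : Measure (E n)).measurePreserving_homeomorphUnitSphereProd.lintegral_comp_emb
          (Homeomorph.measurableEmbedding _)]
        refine lintegral_congr fun x => ?_
        congr 1
        have hx : ‖(x : E n)‖ ≠ 0 := norm_ne_zero_iff.2 x.2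
        simp [smul_smul, hx]
    _ ≤ ∫⁻ p, J (p.1 : E n) * H' (p.2 : ℝ)
          ∂((volume : Measure (E n)).toSphere.prod (.volumeIoiPow (Module.finrank ℝ (E n) - 1))) := by
        refine lintegral_mono fun p => ?_
        have h1 : ‖(p.1 : E n)‖ = 1 := by simp
        have h2 : 0 < (p.2 : ℝ) := p.2.2
        by_cases h3 : (p.2 : ℝ) < 1
        · have h4 : (p.2 : ℝ) • (p.1 : E n) ∈ ball (0 : E n) 1 := by
            simp [norm_smul, abs_of_pos h2, h3]
          simp only [F, H', Set.indicator_of_mem h4, Set.indicator_of_mem (Set.mem_Iio.2 h3)]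
          rw [mul_comm]
          exact hf _ h2 h3 _ h1
        · have h4 : (p.2 : ℝ) • (p.1 : E n) ∉ ball (0 : E n) 1 := by
            simpa [norm_smul, abs_of_pos h2] using h3
          simp [F, Set.indicator_of_notMem h4]
    _ = (∫⁻ ξ, J (ξ : E n) ∂(volume : Measure (E n)).toSphere) *
          ∫⁻ r, H' (r : ℝ) ∂(.volumeIoiPow (Module.finrank ℝ (E n) - 1)) :=
        lintegral_prod_mul (hJ.comp measurable_subtype_coe).aemeasurable
          (hH'.comp measurable_subtype_coe).aemeasurable
    _ ≤ (ENNReal.ofReal K * ∫⁻ ξ, J ξ ∂(sphMeas n)) *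
          ∫⁻ r in Set.Ioo (0 : ℝ) 1, ENNReal.ofReal (r ^ (n - 1)) * H r := by
        gcongr
        · rw [← lintegral_map hJ measurable_subtype_coe, ← smul_eq_mul, ← lintegral_smul_measure]
          exact lintegral_mono' h le_rfl
        · rw [finrank_euclideanSpace_fin, Measure.volumeIoiPow,
            lintegral_withDensity_eq_lintegral_mul _ (f := fun r : Set.Ioi (0 : ℝ) =>
              ENNReal.ofReal ((r : ℝ) ^ (n - 1))) (by fun_prop)
              (g := fun r : Set.Ioi (0 : ℝ) => H' r) (hH'.comp measurable_subtype_coe)]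
          simp only [Pi.mul_apply]
          rw [lintegral_subtype_comap measurableSet_Ioi
            (fun r : ℝ => ENNReal.ofReal (r ^ (n - 1)) * H' r)]
          have h1 : (fun r : ℝ => ENNReal.ofReal (r ^ (n - 1)) * H' r) =
              (Set.Iio (1 : ℝ)).indicator (fun r : ℝ => ENNReal.ofReal (r ^ (n - 1)) * H r) := by
            ext r; by_cases hr : r < 1 <;> simp [H', hr]
          rw [h1, setLIntegral_indicator measurableSet_Iio, Set.inter_comm, Set.Ioi_inter_Iio]
    _ = _ := by rw [mul_assoc]

/-- Differentiation under the integral sign for a finite measure carried by a compact set. -/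
lemma hasDerivAt_integral_of_isCompact {X : Type*} [TopologicalSpace X]
    [TopologicalSpace.PseudoMetrizableSpace X] [MeasurableSpace X] [OpensMeasurableSpace X]
    {K : Set X} (hK : IsCompact K) (hKm : MeasurableSet K) {μ : Measure X} [IsFiniteMeasure μ]
    (hμ : ∀ᵐ x ∂μ, x ∈ K) {k k' : ℝ → X → ℝ} {U : Set ℝ} (hU : IsOpen U)
    (hk : ∀ r ∈ U, ContinuousOn (k r) K)
    (hk' : ContinuousOn (Function.uncurry k') (U ×ˢ K))
    (hd : ∀ r ∈ U, ∀ x ∈ K, HasDerivAt (fun r => k r x) (k' r x) r) {r : ℝ} (hr : r ∈ U) :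
    HasDerivAt (fun r => ∫ x, k r x ∂μ) (∫ x, k' r x ∂μ) r := by
  have hμK : μ.restrict K = μ := Measure.restrict_eq_self_of_ae_mem hμ
  have hmeas : ∀ h : X → ℝ, ContinuousOn h K → AEStronglyMeasurable h μ := fun h hh => by
    rw [← hμK]; exact hh.aestronglyMeasurable_of_isCompact hK hKm
  obtain ⟨ε, hε, hεU⟩ := Metric.nhds_basis_closedBall.mem_iff.1 (hU.mem_nhds hr)
  have hcomp : IsCompact (closedBall r ε ×ˢ K) := (isCompact_closedBall r ε).prod hK
  obtain ⟨C, hC⟩ := hcomp.exists_bound_of_continuousOn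
    (hk'.mono (Set.prod_mono hεU subset_rfl))
  have hkr' : ContinuousOn (k' r) K :=
    hk'.comp (f := fun x => (r, x)) (by fun_prop) fun x hx => ⟨hr, hx⟩
  have hint : Integrable (k r) μ := by
    obtain ⟨C', hC'⟩ := hK.exists_bound_of_continuousOn (hk r hr)
    refine Integrable.of_bound (hmeas _ (hk r hr)) C' ?_
    filter_upwards [hμ] with x hx using hC' x hx
  refine (hasDerivAt_integral_of_dominated_loc_of_deriv_le (bound := fun _ => C)
    (closedBall_mem_nhds r hε) ?_ hint (hmeas _ hkr') ?_ (integrable_const C) ?_).2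
  · filter_upwards [hU.mem_nhds hr] with y hy using hmeas _ (hk y hy)
  · filter_upwards [hμ] with x hx y hy using hC (y, x) ⟨hy, hx⟩
  · filter_upwards [hμ] with x hx y hy using hd y (hεU hy) x hx

lemma ae_mem_sphere (n : ℕ) : ∀ᵐ η ∂(sphMeas n), η ∈ sphere (0 : E n) 1 := by
  filter_upwards [ae_sphMeas n] with η hη
  simpa using hη

lemma integrable_sphMeas {n : ℕ} (hn : 2 ≤ n) {h : E n → ℝ}
    (hh : ContinuousOn h (sphere (0 : E n) 1)) : Integrable h (sphMeas n) := by
  have := isFiniteMeasure_sphMeas hn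
  have h1 := hh.integrableOn_compact (μ := sphMeas n) (isCompact_sphere 0 1)
  rwa [IntegrableOn, Measure.restrict_eq_self_of_ae_mem (ae_mem_sphere n)] at h1

lemma abs_apply_le_norm {n : ℕ} (x : E n) (i : Fin n) : |x i| ≤ ‖x‖ :=
  PiLp.norm_apply_le x i

lemma apply_mem_Icc {n : ℕ} {x : E n} (hx : x ∈ sphere (0 : E n) 1) (i : Fin n) :
    x i ∈ Set.Icc (-1 : ℝ) 1 := by
  have h1 : ‖x‖ = 1 := by simpa using hx
  exact abs_le.1 (h1 ▸ abs_apply_le_norm x i)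

/-- Invariance of the surface measure under rotations in a coordinate plane, in
infinitesimal form. -/
lemma integral_sphMeas_rotation {n : ℕ} (hn : 2 ≤ n) {i j : Fin n} (hij : j ≠ i) {φ φ' : ℝ → ℝ}
    (hφ : ∀ t ∈ Set.Icc (-1 : ℝ) 1, HasDerivAt φ (φ' t) t)
    (hφ' : ContinuousOn φ' (Set.Icc (-1) 1)) :
    ∫ η, (η i * φ (η i) - η j ^ 2 * φ' (η i)) ∂(sphMeas n) = 0 := by
  have := isFiniteMeasure_sphMeas hn
  set p : ℝ → E n → ℝ := fun τ η =>
    η i - 2 * (Real.sin τ * η i - Real.cos τ * η j) * Real.sin τ with hp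
  set q : ℝ → E n → ℝ := fun τ η =>
    η j + 2 * (Real.sin τ * η i - Real.cos τ * η j) * Real.cos τ with hq
  set p' : ℝ → E n → ℝ := fun τ η =>
    -2 * ((Real.cos τ * η i + Real.sin τ * η j) * Real.sin τ
      + (Real.sin τ * η i - Real.cos τ * η j) * Real.cos τ) with hp'
  set q' : ℝ → E n → ℝ := fun τ η =>
    2 * ((Real.cos τ * η i + Real.sin τ * η j) * Real.cos τ
      - (Real.sin τ * η i - Real.cos τ * η j) * Real.sin τ) with hq'
  have hT : ∀ τ : ℝ, ∃ T : E n ≃ₗᵢ[ℝ] E n, ∀ η, T η i = p τ η ∧ T η j = q τ η := by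
    intro τ
    set v : E n := EuclideanSpace.single i (Real.sin τ) - EuclideanSpace.single j (Real.cos τ)
      with hv
    refine ⟨(Submodule.span ℝ {v})ᗮ.reflection, fun η => ?_⟩
    have hinner : inner ℝ v η = Real.sin τ * η i - Real.cos τ * η j := by
      rw [hv, inner_sub_left, EuclideanSpace.inner_single_left, EuclideanSpace.inner_single_left]
      simp
    have hvi : v i = Real.sin τ := by simp [hv, hij.symm]
    have hvj : v j = -Real.cos τ := by simp [hv, hij]
    have hnorm : ‖v‖ ^ 2 = 1 := by
      rw [← real_inner_self_eq_norm_sq]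
      nth_rewrite 1 [hv]
      rw [inner_sub_left, EuclideanSpace.inner_single_left, EuclideanSpace.inner_single_left,
        hvi, hvj]
      simp only [conj_trivial]
      nlinarith [Real.sin_sq_add_cos_sq τ]
    rw [Submodule.reflection_orthogonal_apply, Submodule.reflection_singleton_apply, hinner]
    constructor
    · simp [hnorm, hvi, hp]; ring
    · simp [hnorm, hvj, hq]; ring
  have hφc : ContinuousOn φ (Set.Icc (-1) 1) := fun t ht => (hφ t ht).continuousAt.continuousWithinAt
  have hpI : ∀ τ, ∀ η ∈ sphere (0 : E n) 1, p τ η ∈ Set.Icc (-1 : ℝ) 1 := by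
    intro τ η hη
    obtain ⟨T, hT⟩ := hT τ
    rw [← (hT η).1]
    exact apply_mem_Icc (by simpa using hη) i
  have hconst : ∀ τ, ∫ η, q τ η * φ (p τ η) ∂(sphMeas n) = ∫ η, η j * φ (η i) ∂(sphMeas n) := by
    intro τ
    obtain ⟨T, hT⟩ := hT τ
    rw [← (measurePreserving_sphMeas T).integral_comp (measurableEmbedding_linearIsometryEquiv T)
      (fun η => η j * φ (η i))]
    simp only [(hT _).1, (hT _).2]
  have hpc : Continuous (Function.uncurry p) := by
    simp only [hp, Function.uncurry_def]; fun_prop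
  have hqc : Continuous (Function.uncurry q) := by
    simp only [hq, Function.uncurry_def]; fun_prop
  have hpc' : Continuous (Function.uncurry p') := by
    simp only [hp', Function.uncurry_def]; fun_prop
  have hqc' : Continuous (Function.uncurry q') := by
    simp only [hq', Function.uncurry_def]; fun_prop
  have hmaps : Set.MapsTo (Function.uncurry p) (Set.univ ×ˢ sphere (0 : E n) 1)
      (Set.Icc (-1 : ℝ) 1) := fun x hx => hpI x.1 x.2 hx.2
  have hder : HasDerivAt (fun τ => ∫ η, q τ η * φ (p τ η) ∂(sphMeas n))
      (∫ η, (q' 0 η * φ (p 0 η) + q 0 η * (φ' (p 0 η) * p' 0 η)) ∂(sphMeas n)) 0 := by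
    refine hasDerivAt_integral_of_isCompact (k' := fun τ η => q' τ η * φ (p τ η) +
      q τ η * (φ' (p τ η) * p' τ η)) (isCompact_sphere (0 : E n) 1)
      isClosed_sphere.measurableSet (ae_mem_sphere n) isOpen_univ ?_ ?_ ?_ (Set.mem_univ 0)
    · intro τ _
      refine ContinuousOn.mul ?_ (hφc.comp ?_ fun η hη => hpI τ η hη)
      · exact (hqc.comp (Continuous.prodMk_right τ)).continuousOn
      · exact (hpc.comp (Continuous.prodMk_right τ)).continuousOn
    · exact (hqc'.continuousOn.mul (hφc.comp hpc.continuousOn hmaps)).add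
        (hqc.continuousOn.mul ((hφ'.comp hpc.continuousOn hmaps).mul hpc'.continuousOn))
    · intro τ _ η hη
      have hs := Real.hasDerivAt_sin τ
      have hc := Real.hasDerivAt_cos τ
      have hu : HasDerivAt (fun τ => Real.sin τ * η i - Real.cos τ * η j)
          (Real.cos τ * η i + Real.sin τ * η j) τ := by
        exact ((hs.mul_const (η i)).sub (hc.mul_const (η j))).congr_deriv (by ring)
      have h1 : HasDerivAt (fun τ => p τ η) (p' τ η) τ := by
        exact (((hu.const_mul 2).mul hs).const_sub (η i)).congr_deriv (by simp only [hp']; ring)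
      have h2 : HasDerivAt (fun τ => q τ η) (q' τ η) τ := by
        exact (((hu.const_mul 2).mul hc).const_add (η j)).congr_deriv (by simp only [hq']; ring)
      exact h2.mul ((hφ _ (hpI τ η hη)).comp τ h1)
  have h0 : (∫ η, (q' 0 η * φ (p 0 η) + q 0 η * (φ' (p 0 η) * p' 0 η)) ∂(sphMeas n)) = 0 := by
    refine hder.unique ?_
    simp only [hconst]
    exact hasDerivAt_const _ _
  have h2 : (∫ η, (q' 0 η * φ (p 0 η) + q 0 η * (φ' (p 0 η) * p' 0 η)) ∂(sphMeas n)) =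
      2 * ∫ η, (η i * φ (η i) - η j ^ 2 * φ' (η i)) ∂(sphMeas n) := by
    rw [← integral_const_mul]
    refine integral_congr_ae (Filter.Eventually.of_forall fun η => ?_)
    simp [hp, hq, hp', hq']
    ring
  linarith [h0.symm.trans h2]

/-- The divergence theorem on the sphere for the field `φ(η i) ∇(η i)`. -/
lemma integral_sphMeas_divergence {n : ℕ} (hn : 2 ≤ n) (i : Fin n) {φ φ' : ℝ → ℝ}
    (hφ : ∀ t ∈ Set.Icc (-1 : ℝ) 1, HasDerivAt φ (φ' t) t)
    (hφ' : ContinuousOn φ' (Set.Icc (-1) 1)) :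
    ∫ η, ((1 - η i ^ 2) * φ' (η i) - ((n : ℝ) - 1) * η i * φ (η i)) ∂(sphMeas n) = 0 := by
  have hφc : ContinuousOn φ (Set.Icc (-1) 1) := fun t ht => (hφ t ht).continuousAt.continuousWithinAt
  have hc : ∀ j : Fin n, ContinuousOn (fun η : E n => η j) (sphere (0 : E n) 1) :=
    fun j => by fun_prop
  have hm : Set.MapsTo (fun η : E n => η i) (sphere (0 : E n) 1) (Set.Icc (-1 : ℝ) 1) :=
    fun η hη => apply_mem_Icc hη i
  have hint : ∀ j : Fin n, Integrable (fun η : E n => η i * φ (η i) - η j ^ 2 * φ' (η i))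
      (sphMeas n) := fun j => integrable_sphMeas hn
    (((hc i).mul (hφc.comp (hc i) hm)).sub (((hc j).pow 2).mul (hφ'.comp (hc i) hm)))
  have h1 : ∑ j ∈ Finset.univ.erase i,
      ∫ η, (η i * φ (η i) - η j ^ 2 * φ' (η i)) ∂(sphMeas n) = 0 :=
    Finset.sum_eq_zero fun j hj => integral_sphMeas_rotation hn (Finset.ne_of_mem_erase hj) hφ hφ'
  rw [← integral_finsetSum _ fun j _ => hint j] at h1
  rw [← neg_eq_zero, ← integral_neg, ← h1]
  refine integral_congr_ae ?_
  filter_upwards [ae_sphMeas n] with η hη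
  have h2 : ∑ j ∈ Finset.univ.erase i, η j ^ 2 = 1 - η i ^ 2 := by
    have h3 := EuclideanSpace.real_norm_sq_eq η
    rw [hη, ← Finset.add_sum_erase _ _ (Finset.mem_univ i)] at h3
    linarith
  rw [Finset.sum_sub_distrib, ← Finset.sum_mul _ (fun j => η j ^ 2), h2, Finset.sum_const,
    Finset.card_erase_of_mem (Finset.mem_univ i), Finset.card_univ, Fintype.card_fin, nsmul_eq_mul,
    Nat.cast_sub (by omega)]
  push_cast
  ring

lemma one_sub_two_mul_add_sq_pos {r t : ℝ} (hr : r ∈ Set.Ioo (-1 : ℝ) 1)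
    (ht : t ∈ Set.Icc (-1 : ℝ) 1) : 0 < 1 - 2 * r * t + r ^ 2 := by
  obtain ⟨h1, h2⟩ := hr
  obtain ⟨h3, h4⟩ := ht
  rcases le_or_gt 0 r with h | h
  · nlinarith
  · nlinarith

/-- The zonal Poisson integrals `∫ (1 - r²) (1 - 2 r η_i + r²)^{-n/2} dσ(η)` do not depend
on the radius `r`. -/
lemma integral_zonal_poisson {n : ℕ} (hn : 2 ≤ n) (i : Fin n) {r : ℝ} (hr : 0 ≤ r) (hr1 : r < 1) :
    ∫ η, (1 - r ^ 2) * (1 - 2 * r * η i + r ^ 2) ^ (-(n : ℝ) / 2) ∂(sphMeas n)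
      = (sphMeas n Set.univ).toReal := by
  have := isFiniteMeasure_sphMeas hn
  obtain ⟨m, rfl⟩ : ∃ m, n = m + 2 := ⟨n - 2, by omega⟩
  set w : ℝ := -((m + 2 : ℕ) : ℝ) / 2 with hw
  have hwm : (m : ℝ) = -2 * w - 2 := by rw [hw]; push_cast; ring
  set D : ℝ → E (m + 2) → ℝ := fun r η => 1 - 2 * r * η i + r ^ 2 with hD
  set U : Set ℝ := Set.Ioo (-1) 1 with hU
  set S : Set (E (m + 2)) := sphere 0 1 with hS
  have hDpos : ∀ r ∈ U, ∀ η ∈ S, 0 < D r η := fun r hr η hη =>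
    one_sub_two_mul_add_sq_pos hr (apply_mem_Icc hη i)
  have hDc : Continuous (Function.uncurry D) := by
    simp only [hD, Function.uncurry_def]; fun_prop
  have hDw : ∀ e : ℝ, ContinuousOn (fun p : ℝ × E (m + 2) => D p.1 p.2 ^ e) (U ×ˢ S) := fun e =>
    hDc.continuousOn.rpow_const fun p hp => Or.inl (hDpos p.1 hp.1 p.2 hp.2).ne'
  have hslice : ∀ {h : ℝ × E (m + 2) → ℝ}, ContinuousOn h (U ×ˢ S) → ∀ r ∈ U,
      ContinuousOn (fun η => h (r, η)) S := fun {h} hh r hr =>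
    hh.comp (f := fun η => (r, η)) (by fun_prop) fun η hη => ⟨hr, hη⟩
  have hDr : ∀ r η, HasDerivAt (fun r => D r η) (2 * r - 2 * η i) r := by
    intro r η
    refine HasDerivAt.congr_deriv (((((hasDerivAt_id r).const_mul 2).mul_const (η i)).const_sub
      1).add ((hasDerivAt_id r).pow 2)) ?_
    simp; ring
  have hDwr : ∀ (e : ℝ), ∀ r ∈ U, ∀ η ∈ S, HasDerivAt (fun r => D r η ^ e)
      (e * (2 * r - 2 * η i) * D r η ^ (e - 1)) r := fun e r hr η hη =>
    ((hDr r η).rpow_const (Or.inl (hDpos r hr η hη).ne')).congr_deriv (by ring)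
  set f : ℝ → E (m + 2) → ℝ := fun r η => (1 - r ^ 2) * D r η ^ w with hf
  set f' : ℝ → E (m + 2) → ℝ := fun r η => -2 * r * D r η ^ w +
    (1 - r ^ 2) * (w * (2 * r - 2 * η i) * D r η ^ (w - 1)) with hf'
  set f'' : ℝ → E (m + 2) → ℝ := fun r η => -2 * D r η ^ w
    - 4 * r * (w * (2 * r - 2 * η i) * D r η ^ (w - 1))
    + (1 - r ^ 2) * (2 * w * D r η ^ (w - 1) +
      w * (2 * r - 2 * η i) * ((w - 1) * (2 * r - 2 * η i) * D r η ^ (w - 1 - 1))) with hf''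
  have hsq : ∀ r : ℝ, HasDerivAt (fun r : ℝ => 1 - r ^ 2) (-2 * r) r := fun r =>
    (((hasDerivAt_id r).pow 2).const_sub 1).congr_deriv (by simp)
  have hfd : ∀ r ∈ U, ∀ η ∈ S, HasDerivAt (fun r => f r η) (f' r η) r := fun r hr η hη =>
    (hsq r).mul (hDwr w r hr η hη)
  have hfd' : ∀ r ∈ U, ∀ η ∈ S, HasDerivAt (fun r => f' r η) (f'' r η) r := by
    intro r hr η hη
    have h1 : HasDerivAt (fun r : ℝ => -2 * r) (-2) r :=
      ((hasDerivAt_id r).const_mul (-2)).congr_deriv (by simp)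
    have h2 : HasDerivAt (fun r : ℝ => w * (2 * r - 2 * η i)) (2 * w) r :=
      ((((hasDerivAt_id r).const_mul 2).sub_const (2 * η i)).const_mul w).congr_deriv
        (by simp; ring)
    refine ((h1.mul (hDwr w r hr η hη)).add ((hsq r).mul (h2.mul
      (hDwr (w - 1) r hr η hη)))).congr_deriv ?_
    simp only [hf'', Pi.mul_apply]
    ring
  have hcoord : Continuous (fun p : ℝ × E (m + 2) => p.2 i) := by fun_prop
  have hfc : ContinuousOn (Function.uncurry f) (U ×ˢ S) :=
    ContinuousOn.mul (by fun_prop) (hDw w)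
  have hfc' : ContinuousOn (Function.uncurry f') (U ×ˢ S) := by
    refine ContinuousOn.add (ContinuousOn.mul (by fun_prop) (hDw w))
      (ContinuousOn.mul (by fun_prop) (ContinuousOn.mul (by fun_prop) (hDw (w - 1))))
  have hfc'' : ContinuousOn (Function.uncurry f'') (U ×ˢ S) := by
    refine ContinuousOn.add (ContinuousOn.sub (ContinuousOn.mul (by fun_prop) (hDw w))
      (ContinuousOn.mul (by fun_prop) (ContinuousOn.mul (by fun_prop) (hDw (w - 1)))))
      (ContinuousOn.mul (by fun_prop) (ContinuousOn.add (ContinuousOn.mul (by fun_prop) (hDw (w - 1)))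
        (ContinuousOn.mul (by fun_prop) (ContinuousOn.mul (by fun_prop) (hDw (w - 1 - 1))))))
  have hSc : IsCompact S := isCompact_sphere _ _
  have hSm : MeasurableSet S := isClosed_sphere.measurableSet
  have hF : ∀ r ∈ U, HasDerivAt (fun r => ∫ η, f r η ∂(sphMeas (m + 2)))
      (∫ η, f' r η ∂(sphMeas (m + 2))) r := fun r hr =>
    hasDerivAt_integral_of_isCompact hSc hSm (ae_mem_sphere _) isOpen_Ioo
      (hslice hfc) hfc' hfd hr
  have hF' : ∀ r ∈ U, HasDerivAt (fun r => ∫ η, f' r η ∂(sphMeas (m + 2)))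
      (∫ η, f'' r η ∂(sphMeas (m + 2))) r := fun r hr =>
    hasDerivAt_integral_of_isCompact hSc hSm (ae_mem_sphere _) isOpen_Ioo
      (hslice hfc') hfc'' hfd' hr
  have hode : ∀ r ∈ U, (m + 1) * (∫ η, f' r η ∂(sphMeas (m + 2))) +
      r * ∫ η, f'' r η ∂(sphMeas (m + 2)) = 0 := by
    intro r hr
    have hpos : ∀ t ∈ Set.Icc (-1 : ℝ) 1, 0 < 1 - 2 * r * t + r ^ 2 := fun t ht =>
      one_sub_two_mul_add_sq_pos hr ht
    have hdiv := integral_sphMeas_divergence (n := m + 2) (by omega) i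
      (φ := fun t => 2 * w * (1 - r ^ 2) * (1 - 2 * r * t + r ^ 2) ^ (w - 1))
      (φ' := fun t => 2 * w * (1 - r ^ 2) *
        ((w - 1) * (-2 * r) * (1 - 2 * r * t + r ^ 2) ^ (w - 1 - 1))) ?_ ?_
    · have hi1 : Integrable (f' r) (sphMeas (m + 2)) := integrable_sphMeas hn (hslice hfc' r hr)
      have hi2 : Integrable (f'' r) (sphMeas (m + 2)) := integrable_sphMeas hn (hslice hfc'' r hr)
      rw [← hdiv, ← integral_const_mul, ← integral_const_mul,
        ← integral_add (hi1.const_mul _) (hi2.const_mul _)]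
      refine integral_congr_ae ?_
      filter_upwards [ae_mem_sphere (m + 2)] with η hη
      have h0 := hDpos r hr η hη
      have e1 : D r η ^ (w - 1) = D r η ^ (w - 1 - 1) * D r η := by
        rw [← Real.rpow_add_one h0.ne']; ring_nf
      have e2 : D r η ^ w = D r η ^ (w - 1 - 1) * D r η * D r η := by
        rw [← e1, ← Real.rpow_add_one h0.ne']; ring_nf
      have e3 : 1 - 2 * r * η i + r ^ 2 = D r η := rfl
      simp only [hf', hf'', e3]
      rw [e1, e2]
      push_cast
      rw [hwm]
      generalize D r η ^ (w - 1 - 1) = Z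
      simp only [hD]
      ring
    · intro t ht
      have h1 : HasDerivAt (fun t : ℝ => 1 - 2 * r * t + r ^ 2) (-2 * r) t :=
        ((((hasDerivAt_id t).const_mul (2 * r)).const_sub 1).add_const (r ^ 2)).congr_deriv
          (by simp)
      exact ((h1.rpow_const (p := w - 1) (Or.inl (hpos t ht).ne')).const_mul _).congr_deriv
        (by ring)
    · refine ContinuousOn.mul (by fun_prop) (ContinuousOn.mul (by fun_prop) ?_)
      exact ContinuousOn.rpow_const (by fun_prop) fun t ht => Or.inl (hpos t ht).ne'
  have hU0 : (0 : ℝ) ∈ U := by simp [hU]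
  have hIcoU : ∀ x, 0 ≤ x → x < 1 → x ∈ U := fun x h1 h2 => ⟨by linarith, h2⟩
  have hF'0 : ∀ r, 0 ≤ r → r < 1 → ∫ η, f' r η ∂(sphMeas (m + 2)) = 0 := by
    intro r hr hr1
    rcases hr.eq_or_lt with rfl | hr0
    · have h := hode 0 hU0
      rw [zero_mul, add_zero] at h
      exact (mul_eq_zero.1 h).resolve_left (by positivity)
    · have hG : ∀ x ∈ Set.Icc 0 r, x ^ (m + 1) * (∫ η, f' x η ∂(sphMeas (m + 2))) =
          0 ^ (m + 1) * (∫ η, f' 0 η ∂(sphMeas (m + 2))) := by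
        have hGd : ∀ x ∈ U, HasDerivAt
            (fun x => x ^ (m + 1) * (∫ η, f' x η ∂(sphMeas (m + 2)))) 0 x := by
          intro x hx
          refine ((hasDerivAt_pow (m + 1) x).mul (hF' x hx)).congr_deriv ?_
          have h := hode x hx
          simp only [Nat.add_sub_cancel]
          push_cast
          calc _ = x ^ m * ((m + 1) * (∫ η, f' x η ∂(sphMeas (m + 2))) +
                  x * ∫ η, f'' x η ∂(sphMeas (m + 2))) := by ring
            _ = 0 := by rw [h, mul_zero]
        exact constant_of_has_deriv_right_zero
          (fun x hx => (hGd x (hIcoU x hx.1 (hx.2.trans_lt hr1))).continuousAt.continuousWithinAt)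
          (fun x hx => (hGd x (hIcoU x hx.1 (hx.2.trans hr1))).hasDerivWithinAt)
      have h := hG r ⟨hr, le_rfl⟩
      rw [zero_pow (by omega), zero_mul] at h
      exact (mul_eq_zero.1 h).resolve_left (by positivity)
  have hconst := constant_of_has_deriv_right_zero
    (f := fun r => ∫ η, f r η ∂(sphMeas (m + 2))) (a := 0) (b := r)
    (fun x hx => (hF x (hIcoU x hx.1 (hx.2.trans_lt hr1))).continuousAt.continuousWithinAt)
    (fun x hx => by
      have h := hF x (hIcoU x hx.1 (hx.2.trans hr1))
      rw [hF'0 x hx.1 (hx.2.trans hr1)] at h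
      exact h.hasDerivWithinAt) r ⟨hr, le_rfl⟩
  refine hconst.trans ?_
  simp [hf, hD, measureReal_def]

/-- The unnormalized Poisson kernel `(1 - |x|²) / |x - η|ⁿ`. -/
def poissonKer (n : ℕ) (x η : E n) : ℝ := (1 - ‖x‖ ^ 2) / ‖x - η‖ ^ n

lemma integral_poissonKer {n : ℕ} (hn : 2 ≤ n) {x : E n} (hx : ‖x‖ < 1) :
    ∫ η, poissonKer n x η ∂(sphMeas n) = (sphMeas n Set.univ).toReal := by
  set i : Fin n := ⟨0, by omega⟩
  set y : E n := EuclideanSpace.single i ‖x‖ with hy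
  have hyx : ‖y‖ = ‖x‖ := by simp [hy]
  set T := (Submodule.span ℝ {x - y})ᗮ.reflection with hT
  have hTx : T x = y := Submodule.reflection_sub hyx.symm
  rw [← integral_zonal_poisson hn i (norm_nonneg x) hx]
  have h1 : ∀ η, poissonKer n x η = poissonKer n y (T η) := by
    intro η
    rw [poissonKer, poissonKer, hyx, ← hTx, ← map_sub, T.norm_map]
  simp_rw [h1]
  rw [(measurePreserving_sphMeas T).integral_comp (measurableEmbedding_linearIsometryEquiv T)
      (fun η => poissonKer n y η)]
  refine integral_congr_ae ?_
  filter_upwards [ae_sphMeas n] with η hη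
  have h2 : ‖y - η‖ ^ 2 = 1 - 2 * ‖x‖ * η i + ‖x‖ ^ 2 := by
    rw [norm_sub_sq_real, hyx, hη, hy, EuclideanSpace.inner_single_left]
    simp; ring
  have h3 : ‖y - η‖ ^ n = (1 - 2 * ‖x‖ * η i + ‖x‖ ^ 2) ^ ((n : ℝ) / 2) := by
    rw [← h2, ← Real.rpow_natCast, ← Real.rpow_natCast, ← Real.rpow_mul (norm_nonneg _)]
    congr 1; push_cast; ring
  have h4 : 0 ≤ 1 - 2 * ‖x‖ * η i + ‖x‖ ^ 2 := h2 ▸ sq_nonneg _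
  rw [poissonKer, hyx, h3, neg_div, Real.rpow_neg h4, div_eq_mul_inv]

lemma poissonKer_nonneg {n : ℕ} {x : E n} (hx : ‖x‖ < 1) (η : E n) : 0 ≤ poissonKer n x η := by
  have := norm_nonneg x
  rw [poissonKer]
  have : 0 ≤ 1 - ‖x‖ ^ 2 := by nlinarith
  positivity

lemma one_sub_norm_le_norm_sub {n : ℕ} (x : E n) {η : E n} (hη : ‖η‖ = 1) :
    1 - ‖x‖ ≤ ‖x - η‖ := by
  have h := norm_sub_norm_le η x
  rw [hη, norm_sub_rev] at h
  exact h

lemma continuousOn_poissonKer {n : ℕ} {x : E n} (hx : ‖x‖ < 1) :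
    ContinuousOn (poissonKer n x) (sphere 0 1) := by
  unfold poissonKer
  refine ContinuousOn.div (by fun_prop) (by fun_prop) fun η hη => ?_
  have h1 := one_sub_norm_le_norm_sub x (η := η) (by simpa using hη)
  have : 0 < ‖x - η‖ := by linarith
  positivity

lemma sphMeas_closedBall_le {n : ℕ} (hn : 2 ≤ n) {ξ : E n} (hξ : ‖ξ‖ = 1) {ρ : ℝ} (hρ : 0 < ρ) :
    sphMeas n (closedBall ξ ρ) ≤
      ENNReal.ofReal (2 ^ n * (sphMeas n Set.univ).toReal * ρ ^ (n - 1)) := by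
  have := isFiniteMeasure_sphMeas hn
  set A := (sphMeas n Set.univ).toReal with hA
  have hA0 : 0 ≤ A := ENNReal.toReal_nonneg
  have h2n : (1 : ℝ) ≤ 2 ^ n := one_le_pow₀ (by norm_num)
  refine ENNReal.le_ofReal_iff_toReal_le (measure_ne_top _ _) (by positivity) |>.2 ?_
  rcases le_or_gt 1 ρ with h1 | h1
  · have h2 : (sphMeas n (closedBall ξ ρ)).toReal ≤ A :=
      ENNReal.toReal_mono (measure_ne_top _ _) (measure_mono (Set.subset_univ _))
    have h3 : (1 : ℝ) ≤ ρ ^ (n - 1) := one_le_pow₀ h1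
    calc _ ≤ A := h2
      _ = 1 * A * 1 := by ring
      _ ≤ _ := by gcongr
  · set x : E n := (1 - ρ) • ξ with hx
    have hxn : ‖x‖ = 1 - ρ := by
      rw [hx, norm_smul, hξ, Real.norm_of_nonneg (by linarith), mul_one]
    have hx1 : ‖x‖ < 1 := by linarith
    have hint := integrable_sphMeas hn (continuousOn_poissonKer hx1)
    have hmk := mul_meas_ge_le_integral_of_nonneg
      (Filter.Eventually.of_forall fun η => poissonKer_nonneg hx1 η) hint (ρ / (2 * ρ) ^ n)
    rw [integral_poissonKer hn hx1] at hmk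
    have hsub : (sphMeas n (closedBall ξ ρ)).toReal ≤
        (sphMeas n).real {η | ρ / (2 * ρ) ^ n ≤ poissonKer n x η} := by
      refine ENNReal.toReal_mono (measure_ne_top _ _) (measure_mono_ae ?_)
      filter_upwards [ae_sphMeas n] with η hη hηb
      have hηb' : ‖η - ξ‖ ≤ ρ := mem_closedBall_iff_norm.1 hηb
      have h2 := one_sub_norm_le_norm_sub x hη
      have h3 : ‖x - η‖ ≤ 2 * ρ := by
        have : x - η = -(η - ξ) - ρ • ξ := by rw [hx]; module
        rw [this]
        refine (norm_sub_le _ _).trans ?_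
        rw [norm_neg, norm_smul, hξ, Real.norm_of_nonneg hρ.le]
        linarith
      have h4 : 0 < ‖x - η‖ := by linarith
      change _ ≤ poissonKer n x η
      rw [poissonKer]
      have h5 : ρ ≤ 1 - ‖x‖ ^ 2 := by rw [hxn]; nlinarith
      have h6 : 0 ≤ 1 - ‖x‖ ^ 2 := by linarith
      gcongr
    have hc : 0 < ρ / (2 * ρ) ^ n := by positivity
    have h6 : ρ / (2 * ρ) ^ n * (2 ^ n * A * ρ ^ (n - 1)) = A := by
      obtain ⟨m, rfl⟩ : ∃ m, n = m + 1 := ⟨n - 1, by omega⟩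
      rw [Nat.add_sub_cancel]
      field_simp
      ring
    refine le_of_mul_le_mul_left ?_ hc
    rw [h6]
    refine le_trans ?_ hmk
    gcongr

lemma setLIntegral_Ioo_rpow {c s : ℝ} (hc : 0 < c) (hs : s < 1) :
    ∫⁻ t in Set.Ioo 0 c, ENNReal.ofReal (t ^ (-s)) = ENNReal.ofReal (c ^ (1 - s) / (1 - s)) := by
  have hii := intervalIntegral.intervalIntegrable_rpow' (a := 0) (b := c) (r := -s) (by linarith)
  rw [intervalIntegrable_iff_integrableOn_Ioo_of_le hc.le] at hii
  rw [← ofReal_integral_eq_lintegral_ofReal hii]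
  · rw [← integral_Ioc_eq_integral_Ioo, ← intervalIntegral.integral_of_le hc.le,
      integral_rpow (Or.inl (by linarith))]
    rw [Real.zero_rpow (by linarith)]
    congr 1
    ring_nf
  · filter_upwards [ae_restrict_mem measurableSet_Ioo] with t ht
    exact Real.rpow_nonneg ht.1.le _

lemma lintegral_norm_sub_rpow_le {n : ℕ} (hn : 2 ≤ n) {s : ℝ} (hs : s ∈ Set.Ioo (0 : ℝ) 1) :
    ∃ K : ℝ, 0 ≤ K ∧ ∀ (ξ : E n) (r : ℝ), ‖ξ‖ = 1 → 0 < r → r < 1 →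
      ∫⁻ η, ENNReal.ofReal (‖r • ξ - η‖ ^ (s - n)) ∂(sphMeas n) ≤
        ENNReal.ofReal (K * (1 - r) ^ (s - 1)) := by
  obtain ⟨hs0, hs1⟩ := hs
  set A := (sphMeas n Set.univ).toReal with hA
  have hA0 : 0 ≤ A := ENNReal.toReal_nonneg
  have hnr : (2 : ℝ) ≤ n := by exact_mod_cast hn
  refine ⟨(n - s) * (2 ^ n * A * 2 ^ (n - 1)) / (1 - s), ?_, fun ξ r hξ hr0 hr1 => ?_⟩
  · have : 0 < 1 - s := by linarith
    have : 0 < n - s := by linarith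
    positivity
  have hxn : ‖r • ξ‖ = r := by rw [norm_smul, hξ, Real.norm_of_nonneg hr0.le, mul_one]
  have hh : 0 < 1 - r := by linarith
  have hD : ∀ η, ‖η‖ = 1 → 1 - r ≤ ‖r • ξ - η‖ := fun η hη => by
    have := one_sub_norm_le_norm_sub (r • ξ) hη
    rwa [hxn] at this
  have hlc := lintegral_rpow_eq_lintegral_meas_lt_mul (sphMeas n)
    (f := fun η => ‖r • ξ - η‖⁻¹) (Filter.Eventually.of_forall fun η => by positivity)
    (by fun_prop) (p := n - s) (by linarith)
  have hl : ∫⁻ η, ENNReal.ofReal (‖r • ξ - η‖ ^ (s - n)) ∂(sphMeas n) =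
      ∫⁻ η, ENNReal.ofReal (‖r • ξ - η‖⁻¹ ^ ((n : ℝ) - s)) ∂(sphMeas n) := by
    refine lintegral_congr fun η => ?_
    rw [Real.inv_rpow (norm_nonneg _), ← Real.rpow_neg (norm_nonneg _), neg_sub]
  rw [hl, hlc]
  have key : ∀ t ∈ Set.Ioi (0 : ℝ), sphMeas n {η | t < ‖r • ξ - η‖⁻¹} *
      ENNReal.ofReal (t ^ ((n : ℝ) - s - 1)) ≤ (Set.Ioo 0 (1 - r)⁻¹).indicator
        (fun t => ENNReal.ofReal (2 ^ n * A * 2 ^ (n - 1)) * ENNReal.ofReal (t ^ (-s))) t := by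
    intro t ht
    have ht0 : 0 < t := ht
    by_cases htr : t < (1 - r)⁻¹
    · rw [Set.indicator_of_mem (Set.mem_Ioo.2 ⟨ht0, htr⟩)]
      have h1 : sphMeas n {η | t < ‖r • ξ - η‖⁻¹} ≤ sphMeas n (closedBall ξ (2 / t)) := by
        refine measure_mono_ae ?_
        filter_upwards [ae_sphMeas n] with η hη hηt
        have h2 : t < ‖r • ξ - η‖⁻¹ := hηt
        have h3 := hD η hη
        have h4 : ‖r • ξ - η‖ < t⁻¹ := (lt_inv_comm₀ ht0 (by linarith)).1 h2
        change η ∈ closedBall ξ (2 / t)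
        rw [mem_closedBall, dist_eq_norm]
        have h5 : η - ξ = -(r • ξ - η) - (1 - r) • ξ := by module
        have h6 : ‖η - ξ‖ ≤ ‖r • ξ - η‖ + (1 - r) := by
          rw [h5]
          refine (norm_sub_le _ _).trans ?_
          rw [norm_neg, norm_smul, hξ, Real.norm_of_nonneg hh.le, mul_one]
        rw [div_eq_mul_inv]
        linarith
      calc _ ≤ ENNReal.ofReal (2 ^ n * A * (2 / t) ^ (n - 1)) *
              ENNReal.ofReal (t ^ ((n : ℝ) - s - 1)) := by
            gcongr
            exact h1.trans (sphMeas_closedBall_le hn hξ (by positivity))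
        _ = _ := by
            rw [← ENNReal.ofReal_mul (by positivity), ← ENNReal.ofReal_mul (by positivity)]
            congr 1
            have h7 : t ^ ((n : ℝ) - s - 1) = t ^ (n - 1) * t ^ (-s) := by
              rw [← Real.rpow_natCast t (n - 1), ← Real.rpow_add ht0]
              congr 1
              rw [Nat.cast_sub (by omega)]
              push_cast; ring
            rw [h7, div_pow]
            field_simp
    · rw [Set.indicator_of_notMem (fun h => htr h.2)]
      have : sphMeas n {η | t < ‖r • ξ - η‖⁻¹} = 0 := by
        refine measure_eq_zero_iff_ae_notMem.2 ?_
        filter_upwards [ae_sphMeas n] with η hη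
        have h3 := hD η hη
        change ¬ (t < ‖r • ξ - η‖⁻¹)
        have : ‖r • ξ - η‖⁻¹ ≤ (1 - r)⁻¹ := by gcongr
        linarith
      rw [this, zero_mul]
  have hns : 0 ≤ (n : ℝ) - s := by linarith
  calc _ ≤ ENNReal.ofReal (n - s) * ∫⁻ t in Set.Ioi (0 : ℝ), (Set.Ioo 0 (1 - r)⁻¹).indicator
        (fun t => ENNReal.ofReal (2 ^ n * A * 2 ^ (n - 1)) * ENNReal.ofReal (t ^ (-s))) t := by
        gcongr 1
        exact setLIntegral_mono' measurableSet_Ioi key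
    _ ≤ ENNReal.ofReal (n - s) * ∫⁻ t, (Set.Ioo 0 (1 - r)⁻¹).indicator
        (fun t => ENNReal.ofReal (2 ^ n * A * 2 ^ (n - 1)) * ENNReal.ofReal (t ^ (-s))) t := by
        gcongr
        exact Measure.restrict_le_self
    _ = _ := by
        rw [lintegral_indicator measurableSet_Ioo, lintegral_const_mul _ (by fun_prop),
          setLIntegral_Ioo_rpow (by positivity) hs1, ← ENNReal.ofReal_mul (by positivity),
          ← ENNReal.ofReal_mul hns]
        congr 1
        rw [Real.inv_rpow hh.le, ← Real.rpow_neg hh.le, neg_sub]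
        ring

lemma holder_weight_bound {N s q b c h D d Δ : ℝ} (hs : s ∈ Set.Ioo (0 : ℝ) 1)
    (hN : 1 ≤ N) (hq : 1 ≤ q) (hb : 0 ≤ b) (hc : 0 ≤ c) (hh : 0 < h) (hhD : h ≤ D) (hd : 0 < d)
    (hdD : d ≤ 2 * D) (hΔ : 0 ≤ Δ) :
    (c * h ^ s) ^ (q - 1) * (b * h * D ^ (-N) * D ^ (s - s * q) * Δ) ≤
      c ^ (q - 1) * b * 2 ^ (N - 1 + s * q) * h ^ (s * q) * (Δ / d ^ (N - 1 + s * q)) := by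
  obtain ⟨hs0, hs1⟩ := hs
  have hD : 0 < D := hh.trans_le hhD
  set e := N - 1 + s * q with he
  have he0 : 0 ≤ e := by nlinarith
  have h1 : D ^ (-N) * D ^ (s - s * q) = D ^ (-e) * D ^ (s - 1) := by
    rw [← Real.rpow_add hD, ← Real.rpow_add hD]; congr 1; rw [he]; ring
  have h2 : D ^ (s - 1) ≤ h ^ (s - 1) := Real.rpow_le_rpow_of_nonpos hh hhD (by linarith)
  have h3 : D ^ (-e) ≤ 2 ^ e * (d ^ e)⁻¹ := by
    have : d ^ e ≤ 2 ^ e * D ^ e := by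
      rw [← Real.mul_rpow (by norm_num) hD.le]
      gcongr
    have hde : 0 < d ^ e := by positivity
    have hDe : 0 < D ^ e := by positivity
    rw [Real.rpow_neg hD.le, ← div_eq_mul_inv, le_div_iff₀ hde, ← div_eq_inv_mul, div_le_iff₀ hDe]
    exact this
  have h4 : (c * h ^ s) ^ (q - 1) = c ^ (q - 1) * h ^ (s * q - s) := by
    rw [Real.mul_rpow hc (by positivity), ← Real.rpow_mul hh.le]; ring_nf
  have h5 : h ^ (s * q - s) * h * h ^ (s - 1) = h ^ (s * q) := by
    rw [← Real.rpow_add_one hh.ne', ← Real.rpow_add hh]; ring_nf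
  calc _ = c ^ (q - 1) * b * (h ^ (s * q - s) * h) * (D ^ (-N) * D ^ (s - s * q)) * Δ := by
        rw [h4]; ring
    _ = c ^ (q - 1) * b * (h ^ (s * q - s) * h) * (D ^ (-e) * D ^ (s - 1)) * Δ := by rw [h1]
    _ ≤ c ^ (q - 1) * b * (h ^ (s * q - s) * h) * (2 ^ e * (d ^ e)⁻¹ * h ^ (s - 1)) * Δ := by
        gcongr
    _ = c ^ (q - 1) * b * 2 ^ e * (h ^ (s * q - s) * h * h ^ (s - 1)) * (Δ / d ^ e) := by ring
    _ = _ := by rw [h5]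

lemma poissonExt_sub_eq {n : ℕ} (hn : 2 ≤ n) {g : E n → ℝ} (hg : Integrable g (sphMeas n))
    {x : E n} (hx : ‖x‖ < 1) (c : ℝ) :
    poissonExt n g x - c = ∫ η, ((sphMeas n Set.univ).toReal)⁻¹ * poissonKer n x η * (g η - c)
      ∂(sphMeas n) := by
  have := isFiniteMeasure_sphMeas hn
  set A := (sphMeas n Set.univ).toReal with hA
  have hA0 : 0 < A := ENNReal.toReal_pos (sphMeas_univ_ne_zero hn) (measure_ne_top _ _)
  have hP := integrable_sphMeas hn (continuousOn_poissonKer hx)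
  have hPg : Integrable (fun η => poissonKer n x η * g η) (sphMeas n) := by
    refine hg.bdd_mul (c := (1 - ‖x‖ ^ 2) / (1 - ‖x‖) ^ n) hP.aestronglyMeasurable ?_
    filter_upwards [ae_sphMeas n] with η hη
    rw [Real.norm_of_nonneg (poissonKer_nonneg hx η), poissonKer]
    have h1 := one_sub_norm_le_norm_sub x hη
    have h2 : 0 < 1 - ‖x‖ := by linarith
    have h3 : 0 ≤ 1 - ‖x‖ ^ 2 := by nlinarith [norm_nonneg x]
    gcongr
  have h1 : ∀ η, A⁻¹ * poissonKer n x η * (g η - c) =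
      A⁻¹ * (poissonKer n x η * g η) - A⁻¹ * c * poissonKer n x η := fun η => by ring
  simp_rw [h1]
  rw [integral_sub (hPg.const_mul _) (hP.const_mul _), integral_const_mul (A⁻¹ * c),
    integral_poissonKer hn hx, ← hA, mul_right_comm, inv_mul_cancel₀ hA0.ne', one_mul, poissonExt]
  congr 1
  refine integral_congr_ae (Filter.Eventually.of_forall fun η => ?_)
  simp only [poissonKer]
  ring

lemma rpow_abs_poissonExt_sub_le {n : ℕ} (hn : 2 ≤ n) {q : ℝ} (hq : 1 ≤ q) {s : ℝ}
    (hs : s ∈ Set.Ioo (0 : ℝ) 1) :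
    ∃ K : ℝ, 0 ≤ K ∧ ∀ g : E n → ℝ, Measurable g → Integrable g (sphMeas n) →
      ∀ (ξ : E n) (r : ℝ), ‖ξ‖ = 1 → 0 < r → r < 1 →
      ENNReal.ofReal (|poissonExt n g (r • ξ) - g ξ| ^ q) ≤
        ENNReal.ofReal (K * (1 - r) ^ (s * q)) *
          ∫⁻ η, ENNReal.ofReal (|g ξ - g η| ^ q / ‖ξ - η‖ ^ ((n : ℝ) - 1 + s * q))
            ∂(sphMeas n) := by
  have := isFiniteMeasure_sphMeas hn
  obtain ⟨K, hK0, hK⟩ := lintegral_norm_sub_rpow_le hn hs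
  set A := (sphMeas n Set.univ).toReal with hA
  have hA0 : 0 < A := ENNReal.toReal_pos (sphMeas_univ_ne_zero hn) (measure_ne_top _ _)
  set b := 2 * A⁻¹ with hb
  have hb0 : 0 ≤ b := by positivity
  have hq0 : 0 < q := by linarith
  have hnr : (2 : ℝ) ≤ n := by exact_mod_cast hn
  refine ⟨(b * K) ^ (q - 1) * b * 2 ^ ((n : ℝ) - 1 + s * q), by positivity,
    fun g hgm hg ξ r hξ hr0 hr1 => ?_⟩
  have hxn : ‖r • ξ‖ = r := by rw [norm_smul, hξ, Real.norm_of_nonneg hr0.le, mul_one]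
  have hx1 : ‖r • ξ‖ < 1 := by linarith
  have hh : 0 < 1 - r := by linarith
  set D : E n → ℝ := fun η => ‖r • ξ - η‖ with hD
  have hDm : Measurable D := by fun_prop
  have hDh : ∀ η, ‖η‖ = 1 → 1 - r ≤ D η := fun η hη => by
    have := one_sub_norm_le_norm_sub (r • ξ) hη
    rwa [hxn] at this
  set w : E n → ℝ := fun η => A⁻¹ * poissonKer n (r • ξ) η with hw
  have hwm : Measurable w := by simp only [hw, poissonKer]; fun_prop
  have hw0 : ∀ η, 0 ≤ w η := fun η => mul_nonneg (by positivity) (poissonKer_nonneg hx1 η)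
  have hwpos : ∀ η, ‖η‖ = 1 → 0 < w η := fun η hη => by
    have h1 : 0 < ‖r • ξ - η‖ := hh.trans_le (hDh η hη)
    have h2 : 0 < 1 - ‖r • ξ‖ ^ 2 := by rw [hxn]; nlinarith
    simp only [hw, poissonKer]
    positivity
  have hwle : ∀ η, ‖η‖ = 1 → w η ≤ b * (1 - r) * D η ^ (-(n : ℝ)) := fun η hη => by
    have h1 : 0 < D η := hh.trans_le (hDh η hη)
    have h2 : 1 - r ^ 2 ≤ 2 * (1 - r) := by nlinarith
    rw [Real.rpow_neg h1.le, Real.rpow_natCast]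
    simp only [hw, poissonKer, hxn, hb, hD]
    rw [div_eq_mul_inv]
    calc A⁻¹ * ((1 - r ^ 2) * (‖r • ξ - η‖ ^ n)⁻¹)
        ≤ A⁻¹ * ((2 * (1 - r)) * (‖r • ξ - η‖ ^ n)⁻¹) := by gcongr
      _ = _ := by ring
  set F : E n → ℝ≥0∞ := fun η => ENNReal.ofReal (w η * D η ^ s) with hF
  set G : E n → ℝ≥0∞ := fun η => ENNReal.ofReal (w η * D η ^ (s - s * q) * |g ξ - g η| ^ q) with hG
  have hFm : Measurable F := by fun_prop
  have hGm : Measurable G := by fun_prop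
  have hFint : ∫⁻ η, F η ∂(sphMeas n) ≤ ENNReal.ofReal (b * K * (1 - r) ^ s) := by
    calc ∫⁻ η, F η ∂(sphMeas n)
        ≤ ∫⁻ η, ENNReal.ofReal (b * (1 - r)) * ENNReal.ofReal (‖r • ξ - η‖ ^ (s - n))
            ∂(sphMeas n) := by
          refine lintegral_mono_ae ?_
          filter_upwards [ae_sphMeas n] with η hη
          have h1 : 0 < D η := hh.trans_le (hDh η hη)
          rw [← ENNReal.ofReal_mul (by positivity)]
          refine ENNReal.ofReal_le_ofReal ?_
          calc w η * D η ^ s ≤ b * (1 - r) * D η ^ (-(n : ℝ)) * D η ^ s := by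
                gcongr; exact hwle η hη
            _ = b * (1 - r) * D η ^ (s - n) := by
                rw [mul_assoc, ← Real.rpow_add h1]; ring_nf
      _ = ENNReal.ofReal (b * (1 - r)) * ∫⁻ η, ENNReal.ofReal (‖r • ξ - η‖ ^ (s - n))
            ∂(sphMeas n) := lintegral_const_mul _ (by fun_prop)
      _ ≤ ENNReal.ofReal (b * (1 - r)) * ENNReal.ofReal (K * (1 - r) ^ (s - 1)) := by
          gcongr; exact hK ξ r hξ hr0 hr1
      _ = _ := by
          rw [← ENNReal.ofReal_mul (by positivity)]
          congr 1
          have : (1 - r) ^ s = (1 - r) ^ (s - 1) * (1 - r) := by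
            rw [← Real.rpow_add_one hh.ne']; ring_nf
          rw [this]; ring
  have hhold : ENNReal.ofReal |poissonExt n g (r • ξ) - g ξ| ≤
      (∫⁻ η, F η ∂(sphMeas n)) ^ (1 - 1 / q) * (∫⁻ η, G η ∂(sphMeas n)) ^ (1 / q) := by
    have hq1 : 1 / q ≤ 1 := by rw [div_le_one hq0]; exact hq
    refine le_trans ?_ (lintegral_mul_norm_pow_le hFm.aemeasurable hGm.aemeasurable
      (by linarith) (by positivity) (by ring))
    rw [poissonExt_sub_eq hn hg hx1 (g ξ), ← Real.norm_eq_abs, ofReal_norm]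
    refine (enorm_integral_le_lintegral_enorm _).trans (lintegral_mono_ae ?_)
    filter_upwards [ae_sphMeas n] with η hη
    have h1 : 0 < D η := hh.trans_le (hDh η hη)
    have h2 := hwpos η hη
    rw [← ofReal_norm, norm_mul, Real.norm_of_nonneg (hw0 η), Real.norm_eq_abs,
      abs_sub_comm (g η), ENNReal.ofReal_rpow_of_nonneg (by positivity) (by linarith),
      ENNReal.ofReal_rpow_of_nonneg (by positivity) (by positivity),
      ← ENNReal.ofReal_mul (by positivity)]
    refine le_of_eq (congrArg _ ?_)
    change w η * |g ξ - g η| = _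
    rw [Real.mul_rpow (x := w η) (y := D η ^ s) h2.le (by positivity),
      Real.mul_rpow (x := w η * D η ^ (s - s * q)) (by positivity) (by positivity),
      Real.mul_rpow (x := w η) (y := D η ^ (s - s * q)) h2.le (by positivity),
      ← Real.rpow_mul h1.le, ← Real.rpow_mul h1.le,
      ← Real.rpow_mul (abs_nonneg _), mul_one_div_cancel hq0.ne', Real.rpow_one]
    have e1 : w η ^ (1 - 1 / q) * w η ^ (1 / q) = w η := by
      rw [← Real.rpow_add h2]; simp
    have e2 : D η ^ (s * (1 - 1 / q)) * D η ^ ((s - s * q) * (1 / q)) = 1 := by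
      rw [← Real.rpow_add h1]
      have : s * (1 - 1 / q) + (s - s * q) * (1 / q) = 0 := by field_simp; ring
      rw [this, Real.rpow_zero]
    calc w η * |g ξ - g η| = (w η ^ (1 - 1 / q) * w η ^ (1 / q)) *
          (D η ^ (s * (1 - 1 / q)) * D η ^ ((s - s * q) * (1 / q))) * |g ξ - g η| := by
          rw [e1, e2]; ring
      _ = _ := by ring
  calc ENNReal.ofReal (|poissonExt n g (r • ξ) - g ξ| ^ q)
      = ENNReal.ofReal |poissonExt n g (r • ξ) - g ξ| ^ q :=
        (ENNReal.ofReal_rpow_of_nonneg (abs_nonneg _) hq0.le).symm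
    _ ≤ ((∫⁻ η, F η ∂(sphMeas n)) ^ (1 - 1 / q) * (∫⁻ η, G η ∂(sphMeas n)) ^ (1 / q)) ^ q := by
        gcongr
    _ = (∫⁻ η, F η ∂(sphMeas n)) ^ (q - 1) * ∫⁻ η, G η ∂(sphMeas n) := by
        rw [ENNReal.mul_rpow_of_nonneg _ _ hq0.le, ← ENNReal.rpow_mul, ← ENNReal.rpow_mul,
          one_div_mul_cancel hq0.ne', ENNReal.rpow_one]
        congr 2
        field_simp
    _ ≤ ENNReal.ofReal (b * K * (1 - r) ^ s) ^ (q - 1) * ∫⁻ η, G η ∂(sphMeas n) := by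
        gcongr
    _ = ∫⁻ η, ENNReal.ofReal ((b * K * (1 - r) ^ s) ^ (q - 1)) * G η ∂(sphMeas n) := by
        rw [ENNReal.ofReal_rpow_of_nonneg (by positivity) (by linarith),
          lintegral_const_mul _ hGm]
    _ ≤ ∫⁻ η, ENNReal.ofReal ((b * K) ^ (q - 1) * b * 2 ^ ((n : ℝ) - 1 + s * q) *
          (1 - r) ^ (s * q)) * ENNReal.ofReal (|g ξ - g η| ^ q / ‖ξ - η‖ ^ ((n : ℝ) - 1 + s * q))
            ∂(sphMeas n) := by
        refine lintegral_mono_ae ?_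
        filter_upwards [ae_sphMeas n] with η hη
        have h1 : 0 < D η := hh.trans_le (hDh η hη)
        rw [← ENNReal.ofReal_mul (by positivity), ← ENNReal.ofReal_mul (by positivity)]
        refine ENNReal.ofReal_le_ofReal ?_
        rcases eq_or_ne η ξ with rfl | hne
        · simp [hq0.ne']
        have hd : 0 < ‖ξ - η‖ := norm_pos_iff.2 (sub_ne_zero.2 hne.symm)
        have hd2 : ‖ξ - η‖ ≤ 2 * D η := by
          have h5 : ξ - η = (r • ξ - η) + (1 - r) • ξ := by module
          have h6 : ‖ξ - η‖ ≤ ‖r • ξ - η‖ + (1 - r) := by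
            rw [h5]
            refine (norm_add_le _ _).trans ?_
            rw [norm_smul, hξ, Real.norm_of_nonneg hh.le, mul_one]
          have := hDh η hη
          simp only [hD] at this ⊢
          linarith
        refine le_trans ?_ (holder_weight_bound hs (by linarith) hq hb0 (by positivity) hh
          (hDh η hη) hd hd2 (by positivity))
        gcongr
        exact hwle η hη
    _ = _ := by
        rw [lintegral_const_mul _ (by fun_prop)]

lemma one_sub_rpow_le {b p r : ℝ} (hb : 0 < b) (hp : 0 < p) (hr0 : 0 < r) (hr1 : r < 1) :
    (1 - r) ^ p ≤ (2 * p / b) ^ p * r ^ (-(b / 2)) := by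
  have h1 : 1 - r ≤ r ^ (-(b / (2 * p))) * (2 * p / b) := by
    have h2 := Real.log_le_sub_one_of_pos hr0
    have h3 := Real.log_le_rpow_div (x := r⁻¹) (ε := b / (2 * p)) (by positivity) (by positivity)
    rw [Real.log_inv, Real.inv_rpow hr0.le, ← Real.rpow_neg hr0.le, div_eq_mul_inv, inv_div] at h3
    linarith
  calc (1 - r) ^ p ≤ (r ^ (-(b / (2 * p))) * (2 * p / b)) ^ p :=
        Real.rpow_le_rpow (by linarith) h1 hp.le
    _ = _ := by
        rw [Real.mul_rpow (by positivity) (by positivity), ← Real.rpow_mul hr0.le, mul_comm]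
        congr 2
        field_simp

lemma lintegral_radial_weight_le {n : ℕ} (hn : 2 ≤ n) {p c a : ℝ} (hp : 0 < p) (hc : 0 ≤ c)
    (ha : 0 < a) :
    ∫⁻ r in Set.Ioo (0 : ℝ) 1, ENNReal.ofReal (r ^ (n - 1)) *
        ENNReal.ofReal (c * (1 - r) ^ p * (((n : ℝ) / a) * r ^ ((n : ℝ) / a - n))) ≤
      ENNReal.ofReal (c * (2 * (2 * p / n) ^ p) * a ^ p) := by
  have hn0 : (0 : ℝ) < n := by exact_mod_cast (by omega : 0 < n)
  set b : ℝ := (n : ℝ) / a with hb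
  have hb0 : 0 < b := by positivity
  calc _ ≤ ∫⁻ r in Set.Ioo (0 : ℝ) 1, ENNReal.ofReal (c * (2 * p / b) ^ p * b) *
        ENNReal.ofReal (r ^ (-(1 - b / 2))) := by
        refine setLIntegral_mono' measurableSet_Ioo fun r hr => ?_
        obtain ⟨hr0, hr1⟩ := hr
        rw [← ENNReal.ofReal_mul (by positivity), ← ENNReal.ofReal_mul (by positivity)]
        refine ENNReal.ofReal_le_ofReal ?_
        have h1 : r ^ (n - 1) * r ^ (b - n) = r ^ (b - 1) := by
          rw [← Real.rpow_natCast r (n - 1), ← Real.rpow_add hr0, Nat.cast_sub (by omega)]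
          congr 1; push_cast; ring
        have h2 : r ^ (-(b / 2)) * r ^ (b - 1) = r ^ (-(1 - b / 2)) := by
          rw [← Real.rpow_add hr0]; congr 1; ring
        calc r ^ (n - 1) * (c * (1 - r) ^ p * (b * r ^ (b - n)))
            = c * b * (1 - r) ^ p * (r ^ (n - 1) * r ^ (b - n)) := by ring
          _ ≤ c * b * ((2 * p / b) ^ p * r ^ (-(b / 2))) * (r ^ (n - 1) * r ^ (b - n)) := by
              gcongr
              exact one_sub_rpow_le hb0 hp hr0 hr1
          _ = c * (2 * p / b) ^ p * b * (r ^ (-(b / 2)) * r ^ (b - 1)) := by rw [h1]; ring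
          _ = _ := by rw [h2]
    _ = _ := by
        rw [lintegral_const_mul _ (by fun_prop), setLIntegral_Ioo_rpow one_pos (by linarith),
          ← ENNReal.ofReal_mul (by positivity), Real.one_rpow]
        congr 1
        have h3 : (2 * p / b) ^ p = (2 * p / n) ^ p * a ^ p := by
          rw [← Real.mul_rpow (by positivity) ha.le]
          congr 1
          rw [hb]; field_simp
        rw [h3]
        have h4 : 1 - (1 - b / 2) = b / 2 := by ring
        rw [h4]
        field_simp

lemma integrable_of_slobodeckijQ_ne_top {n : ℕ} (hn : 2 ≤ n) {q s : ℝ} (hq : 1 ≤ q) {g : E n → ℝ}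
    (hg : Measurable g) (h : slobodeckijQ n s q g ≠ ⊤) : Integrable g (sphMeas n) := by
  have := isFiniteMeasure_sphMeas hn
  have h1 : ∫⁻ ξ, ENNReal.ofReal (|g ξ| ^ q) ∂(sphMeas n) < ⊤ :=
    (le_self_add.trans_lt (lt_top_iff_ne_top.2 h))
  have h2 : Integrable (fun ξ => |g ξ| ^ q) (sphMeas n) := by
    refine ⟨(by fun_prop : Measurable fun ξ => |g ξ| ^ q).aestronglyMeasurable, ?_⟩
    rwa [hasFiniteIntegral_iff_ofReal (Filter.Eventually.of_forall fun ξ => by positivity)]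
  refine ((integrable_const (1 : ℝ)).add h2).mono' hg.aestronglyMeasurable
    (Filter.Eventually.of_forall fun ξ => ?_)
  change |g ξ| ≤ 1 + |g ξ| ^ q
  rcases le_total |g ξ| 1 with h3 | h3
  · have : 0 ≤ |g ξ| ^ q := by positivity
    linarith
  · have := Real.self_le_rpow_of_one_le h3 hq
    linarith

/-- quantitative comparison of Poisson and radial extensions.
For `n ≥ 2`, `1 ≤ q < ∞`, `0 < s < 1` and bounded measurable `α : ∂B → [0,∞)`, there is
`C > 0` (depending only on `n, q, s, ‖α‖_∞`) such that for every measurable `g` with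
finite Slobodeckij norm and every `a ∈ (0,1]`:
`(∫_B |P[g](x) - g(x/|x|)|^q μ_a dx)^{1/q} ≤ C a^s ‖g‖_{W^{s,q}(∂B)}`. -/
theorem statement_5 (n : ℕ) (hn : 2 ≤ n) (q : ℝ) (hq : 1 ≤ q) (s : ℝ) (hs : s ∈ Set.Ioo (0 : ℝ) 1)
    (α : E n → ℝ) (hα_meas : Measurable α) (hα_nonneg : ∀ x, 0 ≤ α x)
    (hα_bdd : ∃ M : ℝ, ∀ x, α x ≤ M) :
    ∃ C : ℝ, 0 < C ∧ ∀ g : E n → ℝ, Measurable g → slobodeckijQ n s q g ≠ ⊤ →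
      ∀ a ∈ Set.Ioc (0 : ℝ) 1,
        (∫⁻ x in Metric.ball (0 : E n) 1,
            ENNReal.ofReal (|poissonExt n g x - g (‖x‖⁻¹ • x)| ^ q) *
              ENNReal.ofReal (muW n α a x)) ^ (1 / q)
          ≤ ENNReal.ofReal (C * a ^ s) * (slobodeckijQ n s q g) ^ (1 / q) := by
  have := isFiniteMeasure_sphMeas hn
  obtain ⟨M, hM⟩ := hα_bdd
  have hM0 : 0 ≤ M := (hα_nonneg 0).trans (hM 0)
  obtain ⟨K, hK0, hK⟩ := setLIntegral_ball_le hn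
  obtain ⟨L, hL0, hL⟩ := rpow_abs_poissonExt_sub_le hn hq hs
  have hq0 : 0 < q := by linarith
  have hp : 0 < s * q := mul_pos hs.1 hq0
  set R : ℝ := 2 * (2 * (s * q) / n) ^ (s * q) with hR
  have hR0 : 0 ≤ R := by positivity
  set T : ℝ := K * (L * M * R) with hT
  have hT0 : 0 ≤ T := by positivity
  refine ⟨(T + 1) ^ (1 / q), by positivity, fun g hg hfin a ha => ?_⟩
  have ha0 : 0 < a := ha.1
  have hgi := integrable_of_slobodeckijQ_ne_top hn hq hg hfin
  set J : E n → ℝ≥0∞ := fun ξ => ∫⁻ η,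
    ENNReal.ofReal (|g ξ - g η| ^ q / ‖ξ - η‖ ^ ((n : ℝ) - 1 + s * q)) ∂(sphMeas n) with hJ
  have hJm : Measurable J := by
    refine Measurable.lintegral_prod_right' (f := fun p : E n × E n =>
      ENNReal.ofReal (|g p.1 - g p.2| ^ q / ‖p.1 - p.2‖ ^ ((n : ℝ) - 1 + s * q))) ?_
    fun_prop
  have hJQ : ∫⁻ ξ, J ξ ∂(sphMeas n) ≤ slobodeckijQ n s q g := le_add_self
  have hbound : ∫⁻ x in Metric.ball (0 : E n) 1,
      ENNReal.ofReal (|poissonExt n g x - g (‖x‖⁻¹ • x)| ^ q) * ENNReal.ofReal (muW n α a x) ≤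
      ENNReal.ofReal ((T + 1) * a ^ (s * q)) * slobodeckijQ n s q g := by
    have h1 := hK (fun x => ENNReal.ofReal (|poissonExt n g x - g (‖x‖⁻¹ • x)| ^ q) *
        ENNReal.ofReal (muW n α a x))
      (fun r => ENNReal.ofReal (L * M * (1 - r) ^ (s * q) *
        (((n : ℝ) / a) * r ^ ((n : ℝ) / a - n)))) J (by fun_prop) hJm ?_
    · refine h1.trans ?_
      calc _ ≤ ENNReal.ofReal K * (slobodeckijQ n s q g *
            ENNReal.ofReal (L * M * R * a ^ (s * q))) := by
            gcongr
            exact lintegral_radial_weight_le hn hp (by positivity) ha0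
        _ = ENNReal.ofReal (T * a ^ (s * q)) * slobodeckijQ n s q g := by
            rw [mul_comm (slobodeckijQ n s q g), ← mul_assoc, ← ENNReal.ofReal_mul hK0.le, hT]
            congr 2
            ring
        _ ≤ _ := by
            gcongr
            linarith
    · intro r hr0 hr1 ξ hξ
      have hn1 : ‖r • ξ‖ = r := by rw [norm_smul, hξ, Real.norm_of_nonneg hr0.le, mul_one]
      have hn2 : ‖r • ξ‖⁻¹ • r • ξ = ξ := by rw [hn1, inv_smul_smul₀ hr0.ne']
      have hh : 0 < 1 - r := by linarith
      simp only [muW, hn2]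
      rw [hn1]
      calc _ ≤ (ENNReal.ofReal (L * (1 - r) ^ (s * q)) * J ξ) *
            ENNReal.ofReal (M * (((n : ℝ) / a) * r ^ ((n : ℝ) / a - n))) := by
            gcongr
            · exact hL g hg hgi ξ r hξ hr0 hr1
            · exact hM ξ
        _ = _ := by
            rw [mul_right_comm, ← ENNReal.ofReal_mul (by positivity)]
            congr 2
            ring
  calc _ ≤ (ENNReal.ofReal ((T + 1) * a ^ (s * q)) * slobodeckijQ n s q g) ^ (1 / q) := by
        gcongr
    _ = _ := by
        rw [ENNReal.mul_rpow_of_nonneg _ _ (by positivity),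
          ENNReal.ofReal_rpow_of_nonneg (by positivity) (by positivity),
          Real.mul_rpow (by positivity) (by positivity), ← Real.rpow_mul ha0.le,
          mul_assoc s q, mul_one_div_cancel hq0.ne', mul_one]

end
end

section
/- Let n ≥ 2, let 1 < p < n, let 1 < q < p(n−1)/(n−p), and let α : ∂B → [0,∞) be bounded measurable. Then there exists a constant C > 0, depending only on n, p, q and ‖α‖_{L^∞(∂B)}, such that for every a ∈ (0,1] and every continuously differentiable function w : ℝⁿ → ℝ whose support is a compact subset of the open ball B: ( ∫_B |w(x)|^q μ_a(x) dx )^{1/q} ≤ C · a^{δ_{p,q}} · ( ∫_B |∇w(x)|^p dx )^{1/p}. -/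
open MeasureTheory Metric ENNReal

noncomputable section

/-- The exponent `δ_{p,q} = min{1 - 1/p, 1 - n/p + (n-1)/q}`. -/
def deltaPQ (n : ℕ) (p q : ℝ) : ℝ :=
  min (1 - 1 / p) (1 - (n : ℝ) / p + ((n : ℝ) - 1) / q)

theorem integral_fderiv_apply_self_mul_norm_rpow {F : Type*} [NormedAddCommGroup F]
    [NormedSpace ℝ F] [FiniteDimensional ℝ F] [MeasurableSpace F] [BorelSpace F]
    (μ : Measure F) [μ.IsAddHaarMeasure] {f : F → ℝ} (hf : ContDiff ℝ 1 f)
    (hs : HasCompactSupport f) {b : ℝ} (hb : 0 ≤ b) :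
    ∫ x, fderiv ℝ f x x * ‖x‖ ^ b ∂μ
      = -(Module.finrank ℝ F + b) * ∫ x, f x * ‖x‖ ^ b ∂μ := by
  have hcb : Continuous fun x : F ↦ ‖x‖ ^ b := continuous_norm.rpow_const fun _ ↦ Or.inr hb
  have hcd : Continuous (fderiv ℝ f) := hf.continuous_fderiv one_ne_zero
  obtain ⟨K, hK⟩ := hcd.bounded_above_of_compact_support (hs.fderiv ℝ)
  have hK0 : 0 ≤ K := (norm_nonneg _).trans (hK 0)
  obtain ⟨R, hR⟩ := hs.isBounded.subset_closedBall (0 : F)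
  have hzero : ∀ x : F, R < ‖x‖ → fderiv ℝ f x = 0 := fun x hx ↦ by
    have : x ∉ tsupport f := fun h ↦ by
      have := hR h
      rw [mem_closedBall_zero_iff] at this
      linarith
    exact image_eq_zero_of_notMem_tsupport fun h ↦ this (tsupport_fderiv_subset ℝ h)
  have key := hasDerivAt_integral_of_dominated_loc_of_deriv_le (μ := μ) (𝕜 := ℝ)
    (F := fun s x ↦ f (s • x) * ‖x‖ ^ b) (F' := fun s x ↦ fderiv ℝ f (s • x) x * ‖x‖ ^ b)
    (x₀ := 1) (s := ball 1 (1 / 2))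
    (bound := (closedBall (0 : F) (2 * R)).indicator fun x ↦ K * ‖x‖ * ‖x‖ ^ b)
    (ball_mem_nhds _ (by norm_num)) ?_ ?_ ?_ ?_ ?_ ?_
  · have h1 : (fun s : ℝ ↦ ∫ x, f (s • x) * ‖x‖ ^ b ∂μ) =ᶠ[nhds 1]
        fun s ↦ s ^ (-(Module.finrank ℝ F + b)) * ∫ x, f x * ‖x‖ ^ b ∂μ := by
      filter_upwards [lt_mem_nhds (zero_lt_one (α := ℝ))] with s hs0
      have h2 := Measure.integral_comp_smul_of_nonneg μ (fun x ↦ f x * ‖x‖ ^ b) s (hR := hs0.le)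
      have h3 : ∀ x : F, f (s • x) * ‖x‖ ^ b = s ^ (-b) * (f (s • x) * ‖s • x‖ ^ b) := fun x ↦ by
        rw [norm_smul, Real.mul_rpow (norm_nonneg _) (norm_nonneg _), Real.norm_of_nonneg hs0.le,
          Real.rpow_neg hs0.le]
        have := (Real.rpow_pos_of_pos hs0 b).ne'
        field_simp
      simp_rw [h3]
      rw [integral_const_mul, h2, neg_add, Real.rpow_add hs0, Real.rpow_neg hs0.le (_ : ℕ),
        Real.rpow_natCast, smul_eq_mul]
      ring
    have h4 : HasDerivAt (fun s : ℝ ↦ s ^ (-(Module.finrank ℝ F + b)) * ∫ x, f x * ‖x‖ ^ b ∂μ)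
        (-(Module.finrank ℝ F + b) * ∫ x, f x * ‖x‖ ^ b ∂μ) 1 := by
      simpa using (Real.hasDerivAt_rpow_const (x := 1) (p := -(Module.finrank ℝ F + b))
        (Or.inl one_ne_zero)).mul_const (∫ x, f x * ‖x‖ ^ b ∂μ)
    simpa using key.2.unique (h4.congr_of_eventuallyEq h1)
  · exact Filter.Eventually.of_forall fun s ↦
      ((hf.continuous.comp (continuous_const_smul s)).mul hcb).aestronglyMeasurable
  · simp only [one_smul]
    exact (hf.continuous.mul hcb).integrable_of_hasCompactSupport hs.mul_right
  · simp only [one_smul]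
    exact ((hcd.clm_apply continuous_id).mul hcb).aestronglyMeasurable
  · refine Filter.Eventually.of_forall fun x s hs' ↦ ?_
    have hs2 : 1 / 2 < s := by
      rw [mem_ball, Real.dist_eq, abs_lt] at hs'
      linarith
    by_cases hx : x ∈ closedBall (0 : F) (2 * R)
    · rw [Set.indicator_of_mem hx, norm_mul, Real.norm_of_nonneg (by positivity : 0 ≤ ‖x‖ ^ b)]
      gcongr
      exact (ContinuousLinearMap.le_opNorm _ _).trans (by gcongr; exact hK _)
    · rw [mem_closedBall_zero_iff, not_le] at hx
      rw [hzero]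
      · simpa using Set.indicator_nonneg (fun y _ ↦ by positivity) x
      · rw [norm_smul, Real.norm_of_nonneg (by linarith)]
        nlinarith [norm_nonneg x]
  · rw [integrable_indicator_iff measurableSet_closedBall]
    exact ((continuous_const.mul continuous_norm).mul hcb).continuousOn.integrableOn_compact
      (isCompact_closedBall _ _)
  · refine Filter.Eventually.of_forall fun x s _ ↦ ?_
    have h1 : HasDerivAt (fun s : ℝ ↦ s • x) x s := by
      simpa using (hasDerivAt_id s).smul_const x
    exact ((((hf.differentiable one_ne_zero) _).hasFDerivAt).comp_hasDerivAt s h1).mul_const _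

theorem setLIntegral_norm_rpow_ball {n : ℕ} (hn : 0 < n) {b : ℝ} (hb : 0 ≤ b) :
    ∫⁻ x in ball (0 : EuclideanSpace ℝ (Fin n)) 1, ENNReal.ofReal ((n + b) * ‖x‖ ^ b)
      = n * volume (ball (0 : EuclideanSpace ℝ (Fin n)) 1) := by
  have : Nonempty (Fin n) := ⟨⟨0, hn⟩⟩
  have hcont : Continuous fun x : EuclideanSpace ℝ (Fin n) ↦ (n + b) * ‖x‖ ^ b :=
    continuous_const.mul (continuous_norm.rpow_const fun _ ↦ Or.inr hb)
  have hn0 : (0 : ℝ) < n := by exact_mod_cast hn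
  rw [← ofReal_integral_eq_lintegral_ofReal
    ((hcont.continuousOn.integrableOn_compact (isCompact_closedBall _ _)).mono_set
      ball_subset_closedBall)
    (Filter.Eventually.of_forall fun x ↦ by positivity)]
  have h1 := integral_fun_norm_addHaar (volume : Measure (EuclideanSpace ℝ (Fin n)))
    ((Set.Iio (1 : ℝ)).indicator fun y ↦ (n + b) * y ^ b)
  have h2 : ∫ x in ball (0 : EuclideanSpace ℝ (Fin n)) 1, (n + b) * ‖x‖ ^ b
      = ∫ x : EuclideanSpace ℝ (Fin n),
        (Set.Iio (1 : ℝ)).indicator (fun y ↦ (n + b) * y ^ b) ‖x‖ := by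
    rw [← integral_indicator measurableSet_ball]
    congr 1 with x
    simp [Set.indicator]
  have h3 : ∫ y in Set.Ioi (0 : ℝ), y ^ (n - 1) • (Set.Iio (1 : ℝ)).indicator
      (fun y ↦ (n + b) * y ^ b) y = 1 := by
    have h4 : ∫ y in (0 : ℝ)..1, (n + b) * y ^ (n + b - 1) = 1 := by
      rw [intervalIntegral.integral_const_mul, integral_rpow (Or.inl (by linarith))]
      rw [Real.zero_rpow (by linarith), Real.one_rpow]
      rw [sub_add_cancel, sub_zero, mul_one_div_cancel (by linarith)]
    rw [intervalIntegral.integral_of_le zero_le_one, integral_Ioc_eq_integral_Ioo] at h4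
    refine Eq.trans ?_ h4
    rw [← integral_indicator measurableSet_Ioi, ← integral_indicator measurableSet_Ioo]
    congr 1 with y
    by_cases h0 : 0 < y <;> by_cases h1 : y < 1 <;> simp [h0, h1]
    rw [← Real.rpow_natCast, mul_left_comm, ← Real.rpow_add h0, Nat.cast_sub hn]
    congr 2; push_cast; ring
  rw [h2, h1, finrank_euclideanSpace_fin, h3]
  simp only [smul_eq_mul, mul_one, nsmul_eq_mul]
  rw [ENNReal.ofReal_mul (by positivity), ENNReal.ofReal_natCast, measureReal_def,
    ENNReal.ofReal_toReal measure_ball_lt_top.ne]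

theorem setLIntegral_abs_rpow_mul_norm_rpow_le {n : ℕ} {w : EuclideanSpace ℝ (Fin n) → ℝ}
    (hw : ContDiff ℝ 1 w) (hs : HasCompactSupport w) (hsub : tsupport w ⊆ ball 0 1)
    {b s : ℝ} (hb : 0 ≤ b) (h1s : 1 < s) :
    ∫⁻ x in ball (0 : EuclideanSpace ℝ (Fin n)) 1,
        ENNReal.ofReal (|w x| ^ s * ((n + b) * ‖x‖ ^ b))
      ≤ ENNReal.ofReal s * ∫⁻ x in ball (0 : EuclideanSpace ℝ (Fin n)) 1,
        ENNReal.ofReal (|w x| ^ (s - 1) * ‖fderiv ℝ w x‖ * ‖x‖ ^ (b + 1)) := by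
  have hcb : ∀ {c : ℝ}, 0 ≤ c → Continuous fun x : EuclideanSpace ℝ (Fin n) ↦ ‖x‖ ^ c :=
    fun hc ↦ continuous_norm.rpow_const fun _ ↦ Or.inr hc
  have hcw : ∀ {c : ℝ}, 0 ≤ c → Continuous fun x ↦ |w x| ^ c :=
    fun hc ↦ hw.continuous.abs.rpow_const fun _ ↦ Or.inr hc
  have hcd : Continuous (fderiv ℝ w) := hw.continuous_fderiv one_ne_zero
  set f : EuclideanSpace ℝ (Fin n) → ℝ := fun x ↦ ‖w x‖ ^ s with hf
  have hfc : ContDiff ℝ 1 f := hw.norm_rpow h1s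
  have hfs : HasCompactSupport f := hs.norm.comp_left (g := fun t : ℝ ↦ t ^ s)
    (Real.zero_rpow (by linarith))
  have hint1 : Integrable fun x ↦ |w x| ^ s * ((n + b) * ‖x‖ ^ b) :=
    ((hcw (by linarith)).mul (continuous_const.mul (hcb hb))).integrable_of_hasCompactSupport
      (HasCompactSupport.mul_right hfs)
  have hint2 : Integrable fun x ↦ |w x| ^ (s - 1) * ‖fderiv ℝ w x‖ * ‖x‖ ^ (b + 1) :=
    (((hcw (by linarith)).mul hcd.norm).mul
      (hcb (by linarith))).integrable_of_hasCompactSupport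
      (HasCompactSupport.mul_right (HasCompactSupport.mul_left (hs.fderiv ℝ).norm))
  have key := integral_fderiv_apply_self_mul_norm_rpow volume hfc hfs hb
  rw [finrank_euclideanSpace_fin] at key
  have hle : ∫ x, |w x| ^ s * ((n + b) * ‖x‖ ^ b)
      ≤ s * ∫ x, |w x| ^ (s - 1) * ‖fderiv ℝ w x‖ * ‖x‖ ^ (b + 1) := by
    have e1 : ∫ x, |w x| ^ s * ((n + b) * ‖x‖ ^ b) = -∫ x, fderiv ℝ f x x * ‖x‖ ^ b := by
      rw [key, neg_mul, neg_neg, ← integral_const_mul]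
      congr 1 with x
      simp only [hf, Real.norm_eq_abs]
      ring
    rw [e1, ← integral_const_mul]
    refine (neg_le_abs _).trans ((Real.norm_eq_abs _).symm.le.trans ?_)
    refine (norm_integral_le_integral_norm _).trans ?_
    refine integral_mono_of_nonneg (Filter.Eventually.of_forall fun x ↦ norm_nonneg _)
      (hint2.const_mul s) (Filter.Eventually.of_forall fun x ↦ ?_)
    have e2 := norm_fderiv_norm_rpow_le (hw.differentiable one_ne_zero) (x := x) h1s
    simp only [norm_mul]
    rw [Real.norm_of_nonneg (by positivity : 0 ≤ ‖x‖ ^ b), Real.rpow_add_one' (norm_nonneg _)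
      (by linarith)]
    calc ‖fderiv ℝ f x x‖ * ‖x‖ ^ b
        ≤ (s * ‖w x‖ ^ (s - 1) * ‖fderiv ℝ w x‖) * ‖x‖ * ‖x‖ ^ b := by
          gcongr
          exact (ContinuousLinearMap.le_opNorm _ _).trans (by gcongr)
      _ = _ := by rw [Real.norm_eq_abs]; ring
  have hout : ∀ x : EuclideanSpace ℝ (Fin n), x ∉ ball 0 1 → w x = 0 := fun x hx ↦
    image_eq_zero_of_notMem_tsupport fun h ↦ hx (hsub h)
  have hout' : ∀ x : EuclideanSpace ℝ (Fin n), x ∉ ball 0 1 → fderiv ℝ w x = 0 := fun x hx ↦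
    image_eq_zero_of_notMem_tsupport fun h ↦ hx (hsub (tsupport_fderiv_subset ℝ h))
  rw [← ofReal_integral_eq_lintegral_ofReal hint1.integrableOn
      (Filter.Eventually.of_forall fun x ↦ by positivity),
    ← ofReal_integral_eq_lintegral_ofReal hint2.integrableOn
      (Filter.Eventually.of_forall fun x ↦ by positivity), ← ENNReal.ofReal_mul (by linarith),
    setIntegral_eq_integral_of_forall_compl_eq_zero fun x hx ↦ by
      rw [hout x hx, abs_zero, Real.zero_rpow (by linarith), zero_mul],
    setIntegral_eq_integral_of_forall_compl_eq_zero fun x hx ↦ by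
      rw [hout' x hx, norm_zero, mul_zero, zero_mul]]
  exact ENNReal.ofReal_le_ofReal hle

theorem setLIntegral_abs_rpow_mul_norm_rpow_le_fderiv {n : ℕ}
    {w : EuclideanSpace ℝ (Fin n) → ℝ}
    (hw : ContDiff ℝ 1 w) (hs : HasCompactSupport w) (hsub : tsupport w ⊆ ball 0 1)
    {b p : ℝ} (hn : 0 < n) (hb : 0 ≤ b) (hp : 1 < p) :
    ∫⁻ x in ball (0 : EuclideanSpace ℝ (Fin n)) 1,
        ENNReal.ofReal (|w x| ^ p * ((n + b) * ‖x‖ ^ b))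
      ≤ ENNReal.ofReal p ^ p * (ENNReal.ofReal ((n + b) ^ (1 - p)) *
        ∫⁻ x in ball (0 : EuclideanSpace ℝ (Fin n)) 1, ENNReal.ofReal (‖fderiv ℝ w x‖ ^ p)) := by
  have hn0 : (0 : ℝ) < n := by exact_mod_cast hn
  have hnb : 0 < n + b := by linarith
  have hp0 : 0 < p := by linarith
  have hcb : Continuous fun x : EuclideanSpace ℝ (Fin n) ↦ ‖x‖ ^ b :=
    continuous_norm.rpow_const fun _ ↦ Or.inr hb
  have hcw : Continuous fun x ↦ |w x| ^ p :=
    hw.continuous.abs.rpow_const fun _ ↦ Or.inr hp0.le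
  have hcd : Continuous fun x ↦ ‖fderiv ℝ w x‖ ^ p :=
    (hw.continuous_fderiv one_ne_zero).norm.rpow_const fun _ ↦ Or.inr hp0.le
  have hcA : Continuous fun x ↦ |w x| ^ p * ((n + b) * ‖x‖ ^ b) :=
    hcw.mul (continuous_const.mul hcb)
  have hcD : Continuous fun x ↦ (n + b) ^ (1 - p) * ‖fderiv ℝ w x‖ ^ p :=
    continuous_const.mul hcd
  have hstep := setLIntegral_abs_rpow_mul_norm_rpow_le hw hs hsub hb hp
  have hfin : ∫⁻ x in ball (0 : EuclideanSpace ℝ (Fin n)) 1,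
        ENNReal.ofReal (|w x| ^ p * ((n + b) * ‖x‖ ^ b)) ≠ ∞ := by
    refine ne_of_lt (lt_of_le_of_lt (setLIntegral_le_lintegral _ _) ?_)
    refine Integrable.lintegral_lt_top (hcA.integrable_of_hasCompactSupport
      (HasCompactSupport.mul_right ?_))
    exact hs.comp_left (g := fun t : ℝ ↦ |t| ^ p) (by simp [Real.zero_rpow hp0.ne'])
  have hpt : ∀ x ∈ ball (0 : EuclideanSpace ℝ (Fin n)) 1,
      ENNReal.ofReal (|w x| ^ (p - 1) * ‖fderiv ℝ w x‖ * ‖x‖ ^ (b + 1))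
        ≤ ENNReal.ofReal (|w x| ^ p * ((n + b) * ‖x‖ ^ b)) ^ (1 - 1 / p) *
          ENNReal.ofReal ((n + b) ^ (1 - p) * ‖fderiv ℝ w x‖ ^ p) ^ (1 / p) := by
    intro x hx
    have hx1 : ‖x‖ ≤ 1 := (mem_ball_zero_iff.1 hx).le
    have hp1 : 0 < 1 - 1 / p := by
      rw [sub_pos, div_lt_one hp0]; exact hp
    rw [ENNReal.ofReal_rpow_of_nonneg (by positivity) hp1.le,
      ENNReal.ofReal_rpow_of_nonneg (by positivity) (by positivity),
      ← ENNReal.ofReal_mul (by positivity)]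
    refine ENNReal.ofReal_le_ofReal ?_
    rw [Real.mul_rpow (by positivity) (by positivity), Real.mul_rpow (by positivity) (by positivity),
      Real.mul_rpow (by positivity) (by positivity), ← Real.rpow_mul (by positivity),
      ← Real.rpow_mul (by positivity), ← Real.rpow_mul (by positivity),
      ← Real.rpow_mul (by positivity), mul_one_div_cancel hp0.ne', Real.rpow_one,
      show p * (1 - 1 / p) = p - 1 by field_simp]
    have e1 : (n + b) ^ (1 - 1 / p) * (n + b) ^ ((1 - p) * (1 / p)) = 1 := by
      rw [← Real.rpow_add hnb, show 1 - 1 / p + (1 - p) * (1 / p) = 0 by field_simp; ring,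
        Real.rpow_zero]
    have e2 : ‖x‖ ^ (b + 1) ≤ ‖x‖ ^ (b * (1 - 1 / p)) := by
      refine Real.rpow_le_rpow_of_exponent_ge' (norm_nonneg _) hx1 (by positivity) ?_
      have : 0 ≤ b * (1 / p) := by positivity
      linarith
    calc |w x| ^ (p - 1) * ‖fderiv ℝ w x‖ * ‖x‖ ^ (b + 1)
        ≤ |w x| ^ (p - 1) * ‖fderiv ℝ w x‖ * ‖x‖ ^ (b * (1 - 1 / p)) := by gcongr
      _ = |w x| ^ (p - 1) * ‖fderiv ℝ w x‖ * ‖x‖ ^ (b * (1 - 1 / p)) *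
          ((n + b) ^ (1 - 1 / p) * (n + b) ^ ((1 - p) * (1 / p))) := by rw [e1, mul_one]
      _ = _ := by ring
  have hhol := (setLIntegral_mono' measurableSet_ball hpt).trans
    (ENNReal.lintegral_mul_norm_pow_le
      (μ := volume.restrict (ball (0 : EuclideanSpace ℝ (Fin n)) 1))
      hcA.measurable.ennreal_ofReal.aemeasurable
      hcD.measurable.ennreal_ofReal.aemeasurable
      (by rw [sub_nonneg, div_le_one hp0]; exact hp.le) (by positivity) (by ring))
  have hB : ∫⁻ x in ball (0 : EuclideanSpace ℝ (Fin n)) 1,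
        ENNReal.ofReal ((n + b) ^ (1 - p) * ‖fderiv ℝ w x‖ ^ p)
      = ENNReal.ofReal ((n + b) ^ (1 - p)) *
        ∫⁻ x in ball (0 : EuclideanSpace ℝ (Fin n)) 1, ENNReal.ofReal (‖fderiv ℝ w x‖ ^ p) := by
    rw [← lintegral_const_mul _ hcd.measurable.ennreal_ofReal]
    congr 1 with x
    rw [ENNReal.ofReal_mul (by positivity)]
  rw [hB] at hhol
  have h := hstep.trans (mul_le_mul_right hhol _)
  generalize (∫⁻ x in ball (0 : EuclideanSpace ℝ (Fin n)) 1,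
        ENNReal.ofReal (|w x| ^ p * ((n + b) * ‖x‖ ^ b))) = A at h hfin ⊢
  generalize ENNReal.ofReal ((n + b) ^ (1 - p)) *
        ∫⁻ x in ball (0 : EuclideanSpace ℝ (Fin n)) 1, ENNReal.ofReal (‖fderiv ℝ w x‖ ^ p) = D at h ⊢
  rcases eq_or_ne A 0 with rfl | hA
  · exact zero_le
  have h2 : A ^ (1 / p) ≤ ENNReal.ofReal p * D ^ (1 / p) := by
    have h3 : A ^ (1 - 1 / p) * A ^ (1 / p) ≤ A ^ (1 - 1 / p) * (ENNReal.ofReal p * D ^ (1 / p)) := by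
      rw [← ENNReal.rpow_add _ _ hA hfin, sub_add_cancel, ENNReal.rpow_one, mul_left_comm]
      exact h
    exact (ENNReal.mul_le_mul_iff_right (ENNReal.rpow_pos (pos_iff_ne_zero.2 hA) hfin).ne'
      (ENNReal.rpow_ne_top_of_ne_zero hA hfin)).1 h3
  have h3 := ENNReal.rpow_le_rpow h2 hp0.le
  rwa [ENNReal.mul_rpow_of_nonneg _ _ hp0.le, ← ENNReal.rpow_mul, ← ENNReal.rpow_mul,
    one_div_mul_cancel hp0.ne', ENNReal.rpow_one, ENNReal.rpow_one] at h3

theorem exists_setLIntegral_abs_rpow_le_fderiv {n : ℕ} (hn : 0 < n) {p s : ℝ}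
    (hp : 1 ≤ p) (hs0 : 0 < s) (hps : s⁻¹ = p⁻¹ - (n : ℝ)⁻¹) :
    ∃ K : ℝ≥0∞, K ≠ ∞ ∧ ∀ w : EuclideanSpace ℝ (Fin n) → ℝ, ContDiff ℝ 1 w →
      HasCompactSupport w → tsupport w ⊆ ball 0 1 →
      ∫⁻ x in ball (0 : EuclideanSpace ℝ (Fin n)) 1, ENNReal.ofReal (|w x| ^ s)
        ≤ K * (∫⁻ x in ball (0 : EuclideanSpace ℝ (Fin n)) 1,
          ENNReal.ofReal (‖fderiv ℝ w x‖ ^ p)) ^ (s / p) := by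
  have hp0 : 0 < p := by linarith
  lift p to NNReal using hp0.le
  lift s to NNReal using hs0.le
  refine ⟨(SNormLESNormFDerivOfEqConst ℝ
    (volume : Measure (EuclideanSpace ℝ (Fin n))) p : ℝ≥0∞) ^ (s : ℝ),
    ENNReal.rpow_ne_top_of_nonneg hs0.le ENNReal.coe_ne_top, fun w hw hc hsub ↦ ?_⟩
  have h := eLpNorm_le_eLpNorm_fderiv_of_eq (volume : Measure (EuclideanSpace ℝ (Fin n))) hw hc
    (p := p) (p' := s) (by exact_mod_cast hp) (by simpa using hn) (by simpa using hps)
  rw [eLpNorm_nnreal_eq_lintegral (by exact_mod_cast hs0.ne'),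
    eLpNorm_nnreal_eq_lintegral (by exact_mod_cast hp0.ne')] at h
  have h2 := ENNReal.rpow_le_rpow h hs0.le
  rw [ENNReal.mul_rpow_of_nonneg _ _ hs0.le, ← ENNReal.rpow_mul, ← ENNReal.rpow_mul,
    one_div_mul_cancel hs0.ne', ENNReal.rpow_one, one_div_mul_eq_div] at h2
  have hout : ∀ x : EuclideanSpace ℝ (Fin n), x ∉ ball 0 1 → fderiv ℝ w x = 0 := fun x hx ↦
    image_eq_zero_of_notMem_tsupport fun h ↦ hx (hsub (tsupport_fderiv_subset ℝ h))
  have e1 : ∫⁻ x in ball (0 : EuclideanSpace ℝ (Fin n)) 1,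
      ENNReal.ofReal (‖fderiv ℝ w x‖ ^ (p : ℝ)) = ∫⁻ x, ‖fderiv ℝ w x‖ₑ ^ (p : ℝ) := by
    rw [← lintegral_indicator measurableSet_ball]
    congr 1 with x
    by_cases hx : x ∈ ball (0 : EuclideanSpace ℝ (Fin n)) 1
    · rw [Set.indicator_of_mem hx, ← ENNReal.ofReal_rpow_of_nonneg (norm_nonneg _) hp0.le,
        ofReal_norm]
    · rw [Set.indicator_of_notMem hx, ← ofReal_norm, hout x hx, norm_zero, ENNReal.ofReal_zero,
        ENNReal.zero_rpow_of_pos hp0]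
  rw [e1]
  refine (setLIntegral_le_lintegral _ _).trans (le_trans (le_of_eq ?_) h2)
  congr 1 with x
  rw [← ENNReal.ofReal_rpow_of_nonneg (abs_nonneg _) hs0.le, ← Real.norm_eq_abs,
    ofReal_norm]

theorem exists_setLIntegral_abs_rpow_mul_norm_rpow_le_fderiv_trace {n : ℕ} (hn : 0 < n) {p : ℝ}
    (hp : 1 < p) (hpn : p < n) :
    ∃ K : ℝ≥0∞, K ≠ ∞ ∧ ∀ b : ℝ, 0 ≤ b → ∀ w : EuclideanSpace ℝ (Fin n) → ℝ, ContDiff ℝ 1 w →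
      HasCompactSupport w → tsupport w ⊆ ball 0 1 →
      ∫⁻ x in ball (0 : EuclideanSpace ℝ (Fin n)) 1,
        ENNReal.ofReal (|w x| ^ (p * (n - 1) / (n - p)) * ((n + b) * ‖x‖ ^ b))
        ≤ K * (∫⁻ x in ball (0 : EuclideanSpace ℝ (Fin n)) 1,
          ENNReal.ofReal (‖fderiv ℝ w x‖ ^ p)) ^ (p * (n - 1) / (n - p) / p) := by
  have hp0 : 0 < p := by linarith
  have hn0 : (0 : ℝ) < n := by linarith
  have hnp : 0 < n - p := by linarith
  have hp1 : 0 < 1 - 1 / p := by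
    rw [sub_pos, div_lt_one hp0]; exact hp
  set s : ℝ := n * p / (n - p) with hs
  have hs0 : 0 < s := by positivity
  obtain ⟨K, hK, hKw⟩ := exists_setLIntegral_abs_rpow_le_fderiv hn hp.le hs0
    (by rw [hs]; field_simp)
  set r : ℝ := p * (n - 1) / (n - p) with hr
  have hrs : s * (1 - 1 / p) = r - 1 := by rw [hs, hr]; field_simp; ring
  have hr1 : 1 < r := by
    have := mul_pos hs0 hp1
    linarith
  refine ⟨ENNReal.ofReal r * K ^ (1 - 1 / p), ENNReal.mul_ne_top ENNReal.ofReal_ne_top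
    (ENNReal.rpow_ne_top_of_nonneg hp1.le hK), fun b hb w hw hc hsub ↦ ?_⟩
  refine (setLIntegral_abs_rpow_mul_norm_rpow_le hw hc hsub hb hr1).trans ?_
  rw [mul_assoc]
  refine mul_le_mul_right ?_ _
  have hcs : Continuous fun x ↦ |w x| ^ s :=
    hw.continuous.abs.rpow_const fun _ ↦ Or.inr hs0.le
  have hcd : Continuous fun x ↦ ‖fderiv ℝ w x‖ ^ p :=
    (hw.continuous_fderiv one_ne_zero).norm.rpow_const fun _ ↦ Or.inr hp0.le
  have hpt : ∀ x ∈ ball (0 : EuclideanSpace ℝ (Fin n)) 1,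
      ENNReal.ofReal (|w x| ^ (r - 1) * ‖fderiv ℝ w x‖ * ‖x‖ ^ (b + 1))
        ≤ ENNReal.ofReal (|w x| ^ s) ^ (1 - 1 / p) *
          ENNReal.ofReal (‖fderiv ℝ w x‖ ^ p) ^ (1 / p) := by
    intro x hx
    have hx1 : ‖x‖ ≤ 1 := (mem_ball_zero_iff.1 hx).le
    rw [ENNReal.ofReal_rpow_of_nonneg (by positivity) hp1.le,
      ENNReal.ofReal_rpow_of_nonneg (by positivity) (by positivity),
      ← ENNReal.ofReal_mul (by positivity), ← Real.rpow_mul (by positivity),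
      ← Real.rpow_mul (by positivity), mul_one_div_cancel hp0.ne', Real.rpow_one, hrs]
    exact ENNReal.ofReal_le_ofReal (mul_le_of_le_one_right (by positivity)
      (Real.rpow_le_one (norm_nonneg _) hx1 (by linarith)))
  refine (setLIntegral_mono' measurableSet_ball hpt).trans
    ((ENNReal.lintegral_mul_norm_pow_le
      (μ := volume.restrict (ball (0 : EuclideanSpace ℝ (Fin n)) 1))
      hcs.measurable.ennreal_ofReal.aemeasurable hcd.measurable.ennreal_ofReal.aemeasurable
      hp1.le (by positivity) (by ring)).trans ?_)
  have h := ENNReal.rpow_le_rpow (hKw w hw hc hsub) hp1.le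
  rw [ENNReal.mul_rpow_of_nonneg _ _ hp1.le, ← ENNReal.rpow_mul] at h
  refine (mul_le_mul_left h _).trans (le_of_eq ?_)
  rw [mul_assoc, ← ENNReal.rpow_add_of_nonneg _ _ (by positivity) (by positivity),
    div_mul_eq_mul_div, hrs, ← add_div, sub_add_cancel]

theorem setLIntegral_abs_rpow_mul_norm_rpow_interpolate {n : ℕ}
    {w : EuclideanSpace ℝ (Fin n) → ℝ} (hw : Continuous w) {b u v t : ℝ} (hb : 0 ≤ b)
    (hu : 0 ≤ u) (hv : 0 ≤ v) (ht0 : 0 ≤ t) (ht1 : t ≤ 1) :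
    ∫⁻ x in ball (0 : EuclideanSpace ℝ (Fin n)) 1,
        ENNReal.ofReal (|w x| ^ (u * t + v * (1 - t)) * ((n + b) * ‖x‖ ^ b))
      ≤ (∫⁻ x in ball (0 : EuclideanSpace ℝ (Fin n)) 1,
          ENNReal.ofReal (|w x| ^ u * ((n + b) * ‖x‖ ^ b))) ^ t *
        (∫⁻ x in ball (0 : EuclideanSpace ℝ (Fin n)) 1,
          ENNReal.ofReal (|w x| ^ v * ((n + b) * ‖x‖ ^ b))) ^ (1 - t) := by
  have hc : ∀ {c : ℝ}, 0 ≤ c → Continuous fun x ↦ |w x| ^ c * ((n + b) * ‖x‖ ^ b) := fun hc ↦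
    (hw.abs.rpow_const fun _ ↦ Or.inr hc).mul
      (continuous_const.mul (continuous_norm.rpow_const fun _ ↦ Or.inr hb))
  have ht1' : 0 ≤ 1 - t := by linarith
  refine le_trans (le_of_eq ?_) (ENNReal.lintegral_mul_norm_pow_le
    (μ := volume.restrict (ball (0 : EuclideanSpace ℝ (Fin n)) 1))
    (hc hu).measurable.ennreal_ofReal.aemeasurable
    (hc hv).measurable.ennreal_ofReal.aemeasurable ht0 ht1' (by ring))
  congr 1 with x
  set ρ : ℝ := (n + b) * ‖x‖ ^ b
  have hρ : 0 ≤ ρ := by positivity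
  rw [ENNReal.ofReal_rpow_of_nonneg (by positivity) ht0,
    ENNReal.ofReal_rpow_of_nonneg (by positivity) ht1', ← ENNReal.ofReal_mul (by positivity),
    Real.mul_rpow (by positivity) hρ, Real.mul_rpow (by positivity) hρ,
    ← Real.rpow_mul (abs_nonneg _), ← Real.rpow_mul (abs_nonneg _),
    Real.rpow_add_of_nonneg (abs_nonneg _) (by positivity) (by positivity)]
  have e : ρ ^ t * ρ ^ (1 - t) = ρ := by
    rw [← Real.rpow_add_of_nonneg hρ ht0 ht1', add_sub_cancel, Real.rpow_one]
  congr 1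
  calc _ = |w x| ^ (u * t) * |w x| ^ (v * (1 - t)) * (ρ ^ t * ρ ^ (1 - t)) := by rw [e]
    _ = _ := by ring

theorem setLIntegral_abs_rpow_mul_density_le_of_endpoint {n : ℕ} (hn : 0 < n)
    {w : EuclideanSpace ℝ (Fin n) → ℝ}
    (hw : ContDiff ℝ 1 w) (hs : HasCompactSupport w) (hsub : tsupport w ⊆ ball 0 1)
    {p v t a : ℝ} {K : ℝ≥0∞} (hp : 1 < p) (hv : 0 ≤ v) (ht0 : 0 ≤ t) (ht1 : t ≤ 1)
    (ha : a ∈ Set.Ioc (0 : ℝ) 1)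
    (hK : ∫⁻ x in ball (0 : EuclideanSpace ℝ (Fin n)) 1,
        ENNReal.ofReal (|w x| ^ v * ((n + (n / a - n)) * ‖x‖ ^ (n / a - n)))
      ≤ K * (∫⁻ x in ball (0 : EuclideanSpace ℝ (Fin n)) 1,
        ENNReal.ofReal (‖fderiv ℝ w x‖ ^ p)) ^ (v / p)) :
    ∫⁻ x in ball (0 : EuclideanSpace ℝ (Fin n)) 1,
        ENNReal.ofReal (|w x| ^ (p * t + v * (1 - t)) * (n / a * ‖x‖ ^ (n / a - n)))
      ≤ (ENNReal.ofReal p ^ p) ^ t * K ^ (1 - t) * ENNReal.ofReal (a ^ ((p - 1) * t)) *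
        (∫⁻ x in ball (0 : EuclideanSpace ℝ (Fin n)) 1,
          ENNReal.ofReal (‖fderiv ℝ w x‖ ^ p)) ^ ((p * t + v * (1 - t)) / p) := by
  obtain ⟨ha0, ha1⟩ := ha
  have hn0 : (0 : ℝ) < n := by exact_mod_cast hn
  have hn1 : (1 : ℝ) ≤ n := by exact_mod_cast hn
  have hp0 : 0 < p := by linarith
  have ht1' : 0 ≤ 1 - t := by linarith
  have hb : 0 ≤ n / a - n := by
    rw [sub_nonneg, le_div_iff₀ ha0]
    exact mul_le_of_le_one_right hn0.le ha1
  have hp' := setLIntegral_abs_rpow_mul_norm_rpow_le_fderiv hw hs hsub hn hb hp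
  have hi := setLIntegral_abs_rpow_mul_norm_rpow_interpolate hw.continuous hb hp0.le hv ht0 ht1
  have ha' : ENNReal.ofReal ((n + (n / a - n)) ^ (1 - p)) ≤ ENNReal.ofReal (a ^ (p - 1)) := by
    refine ENNReal.ofReal_le_ofReal ?_
    rw [add_sub_cancel]
    calc (n / a) ^ (1 - p) ≤ (1 / a) ^ (1 - p) :=
          Real.rpow_le_rpow_of_nonpos (by positivity) (by gcongr) (by linarith)
      _ = a ^ (p - 1) := by
          rw [one_div, Real.inv_rpow ha0.le, ← Real.rpow_neg ha0.le, neg_sub]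
  rw [add_sub_cancel] at hi hK hp' ha'
  generalize (∫⁻ x in ball (0 : EuclideanSpace ℝ (Fin n)) 1,
        ENNReal.ofReal (‖fderiv ℝ w x‖ ^ p)) = N at *
  have hp'' := hp'.trans (mul_le_mul_right (mul_le_mul_left ha' N) _)
  refine hi.trans ((mul_le_mul' (ENNReal.rpow_le_rpow hp'' ht0)
    (ENNReal.rpow_le_rpow hK ht1')).trans (le_of_eq ?_))
  rw [ENNReal.mul_rpow_of_nonneg _ _ ht0, ENNReal.mul_rpow_of_nonneg _ _ ht0,
    ENNReal.mul_rpow_of_nonneg _ _ ht1', ← ENNReal.rpow_mul N,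
    ENNReal.ofReal_rpow_of_nonneg (by positivity) ht0, ← Real.rpow_mul ha0.le,
    show (p * t + v * (1 - t)) / p = t + v / p * (1 - t) by field_simp,
    ENNReal.rpow_add_of_nonneg _ _ ht0 (by positivity)]
  ring

theorem exists_setLIntegral_abs_rpow_mul_density_le {n : ℕ} {p q : ℝ}
    (hp : 1 < p) (hpn : p < n) (hq : 1 < q) (hq' : q < p * (n - 1) / (n - p)) :
    ∃ K : ℝ≥0∞, K ≠ ∞ ∧ ∀ a ∈ Set.Ioc (0 : ℝ) 1, ∀ w : EuclideanSpace ℝ (Fin n) → ℝ,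
      ContDiff ℝ 1 w → HasCompactSupport w → tsupport w ⊆ ball 0 1 →
      ∫⁻ x in ball (0 : EuclideanSpace ℝ (Fin n)) 1,
        ENNReal.ofReal (|w x| ^ q * (n / a * ‖x‖ ^ (n / a - n)))
      ≤ K * ENNReal.ofReal (a ^ (deltaPQ n p q * q)) *
        (∫⁻ x in ball (0 : EuclideanSpace ℝ (Fin n)) 1,
          ENNReal.ofReal (‖fderiv ℝ w x‖ ^ p)) ^ (q / p) := by
  have hp0 : 0 < p := by linarith
  have hq0 : 0 < q := by linarith
  have hn0 : (0 : ℝ) < n := by linarith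
  have hn : 0 < n := by exact_mod_cast hn0
  have hb : ∀ a ∈ Set.Ioc (0 : ℝ) 1, 0 ≤ n / a - n := fun a ha ↦ by
    rw [sub_nonneg, le_div_iff₀ ha.1]
    exact mul_le_of_le_one_right hn0.le ha.2
  have hKp : ∀ t : ℝ, 0 ≤ t → (ENNReal.ofReal p ^ p) ^ t ≠ ∞ := fun t ht ↦
    ENNReal.rpow_ne_top_of_nonneg ht (ENNReal.rpow_ne_top_of_nonneg hp0.le ENNReal.ofReal_ne_top)
  have hdiff : 1 - n / p + (n - 1) / q - (1 - 1 / p) = (n - 1) * (1 / q - 1 / p) := by ring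
  rcases le_or_gt q p with hqp | hqp
  · have ht1 : q / p ≤ 1 := (div_le_one hp0).2 hqp
    have hδ : deltaPQ n p q = 1 - 1 / p := by
      refine min_eq_left ?_
      have : 0 ≤ (n - 1) * (1 / q - 1 / p) :=
        mul_nonneg (by linarith) (sub_nonneg.2 (one_div_le_one_div_of_le hq0 hqp))
      linarith
    have hexp : p * (q / p) + 0 * (1 - q / p) = q := by field_simp; ring
    have hδ' : deltaPQ n p q * q = (p - 1) * (q / p) := by rw [hδ]; field_simp
    set V : ℝ≥0∞ := n * volume (ball (0 : EuclideanSpace ℝ (Fin n)) 1) with hV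
    refine ⟨(ENNReal.ofReal p ^ p) ^ (q / p) * V ^ (1 - q / p),
      ENNReal.mul_ne_top (hKp _ (by positivity)) (ENNReal.rpow_ne_top_of_nonneg (by linarith)
        (ENNReal.mul_ne_top (ENNReal.natCast_ne_top n) measure_ball_lt_top.ne)),
      fun a ha w hw hs hsub ↦ ?_⟩
    have h := setLIntegral_abs_rpow_mul_density_le_of_endpoint hn hw hs hsub (K := V) hp le_rfl
      (by positivity) ht1 ha (by
        simp only [Real.rpow_zero, one_mul, zero_div, ENNReal.rpow_zero, mul_one]
        exact (setLIntegral_norm_rpow_ball hn (hb a ha)).le)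
    rwa [hexp, ← hδ'] at h
  · have hnp : 0 < n - p := by linarith
    obtain ⟨K, hK, hKw⟩ :=
      exists_setLIntegral_abs_rpow_mul_norm_rpow_le_fderiv_trace hn hp hpn
    have hv : 0 ≤ p * ((n : ℝ) - 1) / (n - p) := by linarith
    set t : ℝ := (p * (n - 1) - q * (n - p)) / (p * (p - 1)) with ht
    have hp1 : 0 < p - 1 := by linarith
    have ht0 : 0 ≤ t := by
      rw [lt_div_iff₀ hnp] at hq'
      exact div_nonneg (by linarith) (by positivity)
    have ht1 : t ≤ 1 := by
      rw [ht, div_le_one (by positivity)]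
      nlinarith
    have hδ : deltaPQ n p q = 1 - n / p + (n - 1) / q := by
      refine min_eq_right ?_
      have : (n - 1) * (1 / q - 1 / p) ≤ 0 :=
        mul_nonpos_of_nonneg_of_nonpos (by linarith)
          (sub_nonpos.2 (one_div_le_one_div_of_le hp0 hqp.le))
      linarith
    have hexp : p * t + p * (n - 1) / (n - p) * (1 - t) = q := by rw [ht]; field_simp; ring
    have hδ' : deltaPQ n p q * q = (p - 1) * t := by rw [hδ, ht]; field_simp; ring
    refine ⟨(ENNReal.ofReal p ^ p) ^ t * K ^ (1 - t), ENNReal.mul_ne_top (hKp _ ht0)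
      (ENNReal.rpow_ne_top_of_nonneg (by linarith) hK), fun a ha w hw hs hsub ↦ ?_⟩
    have h := setLIntegral_abs_rpow_mul_density_le_of_endpoint hn hw hs hsub (K := K) hp hv
      ht0 ht1 ha (hKw _ (hb a ha) w hw hs hsub)
    rwa [hexp, ← hδ'] at h

/-- boundary-layer estimate for zero-trace functions.
For `n ≥ 2`, `1 < p < n`, `1 < q < p(n-1)/(n-p)` and bounded measurable
`α : ∂B → [0,∞)`, there is `C > 0` such that for every `a ∈ (0,1]` and every `C¹`
function `w` with compact support contained in the open unit ball `B`:
`(∫_B |w|^q μ_a dx)^{1/q} ≤ C a^{δ_{p,q}} (∫_B |∇w|^p dx)^{1/p}`. -/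
theorem statement_6 (n : ℕ) (hn : 2 ≤ n) (p q : ℝ)
    (hp : 1 < p) (hpn : p < n) (hq : 1 < q) (hq' : q < p * ((n : ℝ) - 1) / ((n : ℝ) - p))
    (α : E n → ℝ) (hα_meas : Measurable α) (hα_nonneg : ∀ x, 0 ≤ α x)
    (hα_bdd : ∃ M : ℝ, ∀ x, α x ≤ M) :
    ∃ C : ℝ, 0 < C ∧ ∀ a ∈ Set.Ioc (0 : ℝ) 1, ∀ w : E n → ℝ,
      ContDiff ℝ 1 w → HasCompactSupport w → tsupport w ⊆ Metric.ball (0 : E n) 1 →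
      (∫⁻ x in Metric.ball (0 : E n) 1,
          ENNReal.ofReal (|w x| ^ q) * ENNReal.ofReal (muW n α a x)) ^ (1 / q)
        ≤ ENNReal.ofReal (C * a ^ deltaPQ n p q) *
            (∫⁻ x in Metric.ball (0 : E n) 1,
              ENNReal.ofReal (‖fderiv ℝ w x‖ ^ p)) ^ (1 / p) := by
  have hp0 : 0 < p := by linarith
  have hq0 : 0 < q := by linarith
  obtain ⟨M, hM⟩ := hα_bdd
  have hM0 : 0 ≤ M := (hα_nonneg 0).trans (hM 0)
  obtain ⟨K, hK, hKw⟩ := exists_setLIntegral_abs_rpow_mul_density_le hp hpn hq hq'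
  set D : ℝ≥0∞ := (ENNReal.ofReal M * K) ^ (1 / q) with hD
  have hDtop : D ≠ ∞ := ENNReal.rpow_ne_top_of_nonneg (by positivity)
    (ENNReal.mul_ne_top ENNReal.ofReal_ne_top hK)
  refine ⟨D.toReal + 1, by positivity, fun a ha w hw hs hsub ↦ ?_⟩
  have ha0 : 0 < a := ha.1
  have h1 : ∫⁻ x in Metric.ball (0 : E n) 1,
      ENNReal.ofReal (|w x| ^ q) * ENNReal.ofReal (muW n α a x)
      ≤ ENNReal.ofReal M * ∫⁻ x in Metric.ball (0 : E n) 1,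
        ENNReal.ofReal (|w x| ^ q * (n / a * ‖x‖ ^ (n / a - n))) := by
    rw [← lintegral_const_mul' _ _ ENNReal.ofReal_ne_top]
    refine lintegral_mono fun x ↦ ?_
    rw [← ENNReal.ofReal_mul (by positivity), ← ENNReal.ofReal_mul hM0]
    refine ENNReal.ofReal_le_ofReal ?_
    calc |w x| ^ q * muW n α a x ≤ |w x| ^ q * (M * (n / a * ‖x‖ ^ (n / a - n))) := by
          unfold muW
          gcongr
          exact hM _
      _ = _ := by ring
  have h2 := h1.trans (mul_le_mul_right (hKw a ha w hw hs hsub) _)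
  refine (ENNReal.rpow_le_rpow h2 (by positivity : 0 ≤ 1 / q)).trans ?_
  rw [← mul_assoc, ← mul_assoc, ENNReal.mul_rpow_of_nonneg _ _ (by positivity),
    ENNReal.mul_rpow_of_nonneg _ _ (by positivity), ← hD, ← ENNReal.rpow_mul,
    ENNReal.ofReal_rpow_of_nonneg (by positivity) (by positivity), ← Real.rpow_mul ha0.le,
    mul_assoc (deltaPQ n p q), mul_one_div_cancel hq0.ne', mul_one,
    show q / p * (1 / q) = 1 / p by field_simp, ENNReal.ofReal_mul (by positivity)]
  gcongr
  rw [ENNReal.le_ofReal_iff_toReal_le hDtop (by positivity)]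
  linarith

end
end

section
/- Let n ≥ 2, let 1 < p < n, let 1 < q < p(n−1)/(n−p), let α : ∂B → [0,∞) be bounded measurable, and let 0 < s < δ_{p,q}. Then there exists a constant C_s > 0, depending only on n, p, q, s and ‖α‖_{L^∞(∂B)}, such that for every a ∈ (0,1] and every continuously differentiable function u : ℝⁿ → ℝ: ( ∫_B |u(x) − u(x/|x|)|^q μ_a(x) dx )^{1/q} ≤ C_s · a^s · ( ∫_B |∇u(x)|^p dx )^{1/p}. -/
open MeasureTheory Metric ENNReal

noncomputable section

section

open scoped NNReal

variable {n : ℕ}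

/-- Polar coordinates for the Lebesgue integral on `ℝⁿ`. -/
lemma lintegral_polar (F : E n → ℝ≥0∞) (hn : n ≠ 0) (hF : Measurable F) :
    ∫⁻ x, F x = ∫⁻ ω : sphere (0 : E n) 1, (∫⁻ r in Set.Ioi (0 : ℝ),
      ENNReal.ofReal (r ^ (n - 1)) * F (r • (ω : E n))) ∂(volume : Measure (E n)).toSphere := by
  have : Nonempty (Fin n) := ⟨⟨0, Nat.pos_of_ne_zero hn⟩⟩
  have hdim : Module.finrank ℝ (E n) = n := by simp
  have hmp := (volume : Measure (E n)).measurePreserving_homeomorphUnitSphereProd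
  have hsymm : MeasurePreserving (homeomorphUnitSphereProd (E n)).symm _ _ :=
    hmp.symm (homeomorphUnitSphereProd (E n)).toMeasurableEquiv
  have hF' : Measurable fun y : sphere (0 : E n) 1 × Set.Ioi (0 : ℝ) =>
      F ((y.2 : ℝ) • (y.1 : E n)) := by fun_prop
  calc ∫⁻ x, F x
      = ∫⁻ x in ({0}ᶜ : Set (E n)), F x := by rw [restrict_compl_singleton]
    _ = ∫⁻ x : ({0}ᶜ : Set (E n)), F (x : E n) ∂(Measure.comap Subtype.val (volume : Measure (E n))) := by
        rw [lintegral_subtype_comap (measurableSet_singleton _).compl F]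
    _ = ∫⁻ y, F ((y.2 : ℝ) • (y.1 : E n)) ∂((volume : Measure (E n)).toSphere.prod
          (.volumeIoiPow (Module.finrank ℝ (E n) - 1))) := by
        rw [← hsymm.lintegral_comp_emb (Homeomorph.measurableEmbedding _)]
        rfl
    _ = ∫⁻ ω : sphere (0 : E n) 1, (∫⁻ r : Set.Ioi (0 : ℝ), F ((r : ℝ) • (ω : E n))
          ∂(.volumeIoiPow (Module.finrank ℝ (E n) - 1))) ∂(volume : Measure (E n)).toSphere := by
        rw [lintegral_prod _ hF'.aemeasurable]
    _ = _ := by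
        refine lintegral_congr fun ω => ?_
        rw [Measure.volumeIoiPow, lintegral_withDensity_eq_lintegral_mul _ (by fun_prop)
          (by fun_prop), hdim,
          ← lintegral_subtype_comap measurableSet_Ioi]
        rfl

/-- Polar coordinates on the unit ball. -/
lemma lintegral_ball_polar (F : E n → ℝ≥0∞) (hn : n ≠ 0) (hF : Measurable F) :
    ∫⁻ x in ball 0 1, F x = ∫⁻ ω : sphere (0 : E n) 1, (∫⁻ r in Set.Ioo (0 : ℝ) 1,
      ENNReal.ofReal (r ^ (n - 1)) * F (r • (ω : E n))) ∂(volume : Measure (E n)).toSphere := by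
  rw [← lintegral_indicator measurableSet_ball,
    lintegral_polar _ hn (hF.indicator measurableSet_ball)]
  refine lintegral_congr fun ω => ?_
  rw [← lintegral_indicator measurableSet_Ioi, ← lintegral_indicator measurableSet_Ioo]
  refine lintegral_congr fun r => ?_
  have hω : ‖(ω : E n)‖ = 1 := by simp
  by_cases h0 : 0 < r
  · by_cases h1 : r < 1 <;> simp [Set.indicator, h0, h1, norm_smul, hω, abs_of_pos h0]
  · simp [Set.indicator, h0]

/-- The increment of a `C¹` function along a segment is bounded by the integral of its gradient. -/
lemma enorm_sub_le_lintegral_segment {u : E n → ℝ} (hu : ContDiff ℝ 1 u) (x v : E n)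
    {a b : ℝ} (hab : a ≤ b) :
    ‖u (x + b • v) - u (x + a • v)‖ₑ ≤
      ‖v‖ₑ * ∫⁻ t in Set.Ioo a b, ‖fderiv ℝ u (x + t • v)‖ₑ := by
  have hc : ContDiff ℝ 1 fun t : ℝ => u (x + t • v) := by fun_prop
  refine (enorm_sub_le_lintegral_deriv_of_contDiffOn_Icc (f := fun t : ℝ => u (x + t • v))
    hc.contDiffOn hab).trans ?_
  rw [← restrict_Ioo_eq_restrict_Icc, ← lintegral_const_mul' _ _ enorm_ne_top]
  refine lintegral_mono fun t => ?_
  have h1 : HasDerivAt (fun t : ℝ => x + t • v) v t := by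
    simpa using ((hasDerivAt_id t).smul_const v).const_add x
  have h2 := ((hu.differentiable one_ne_zero) (x + t • v)).hasFDerivAt.comp_hasDerivAt t h1
  have h3 : deriv (fun t : ℝ => u (x + t • v)) t = fderiv ℝ u (x + t • v) v := h2.deriv
  rw [h3, mul_comm]
  exact ContinuousLinearMap.le_opENorm _ _

lemma lintegral_ball_weight_polar (F : E n → ℝ≥0∞) (hn : n ≠ 0) (hF : Measurable F) (N : ℝ) :
    ∫⁻ x in ball 0 1, ENNReal.ofReal (N * ‖x‖ ^ (N - n)) * F x =
      ∫⁻ ω : sphere (0 : E n) 1, (∫⁻ r in Set.Ioo (0 : ℝ) 1,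
        ENNReal.ofReal (N * r ^ (N - 1)) * F (r • (ω : E n)))
          ∂(volume : Measure (E n)).toSphere := by
  rw [lintegral_ball_polar _ hn (by fun_prop)]
  refine lintegral_congr fun ω => setLIntegral_congr_fun measurableSet_Ioo fun r hr => ?_
  have hω : ‖(ω : E n)‖ = 1 := by simp
  have h0 : 0 < r := hr.1
  have h1 : r ^ (n - 1) * (N * r ^ (N - n)) = N * r ^ (N - 1) := by
    rw [← Real.rpow_natCast, mul_left_comm, ← Real.rpow_add h0,
      Nat.cast_pred (Nat.pos_of_ne_zero hn)]
    ring_nf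
  rw [← mul_assoc, ← ENNReal.ofReal_mul (by positivity), norm_smul, hω, mul_one,
    Real.norm_of_nonneg h0.le, h1]

lemma lintegral_Ioo_mul_rpow {c κ : ℝ} (hc : 0 ≤ c) (hκ : 0 < κ) :
    ∫⁻ r in Set.Ioo (0 : ℝ) 1, ENNReal.ofReal (c * r ^ (κ - 1)) = ENNReal.ofReal (c / κ) := by
  have hint : IntegrableOn (fun r : ℝ => c * r ^ (κ - 1)) (Set.Ioo 0 1) :=
    ((intervalIntegral.integrableOn_Ioo_rpow_iff one_pos).2 (by linarith)).const_mul c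
  rw [← ofReal_integral_eq_lintegral_ofReal hint]
  · rw [← integral_Ioc_eq_integral_Ioo, ← intervalIntegral.integral_of_le zero_le_one,
      intervalIntegral.integral_const_mul, integral_rpow (Or.inl (by linarith))]
    simp [hκ.ne', div_eq_mul_inv]
  · filter_upwards [self_mem_ae_restrict measurableSet_Ioo] with r hr
    exact mul_nonneg hc (Real.rpow_nonneg hr.1.le _)

/-- Negative powers above `-n` of the distance are uniformly integrable on the unit ball. -/
lemma exists_lintegral_ball_rpow_le {γ : ℝ} (hn : n ≠ 0) (hγ : γ < n) :
    ∃ C : ℝ≥0∞, C ≠ ⊤ ∧ ∀ z : E n, ‖z‖ ≤ 1 → ∫⁻ x in ball 0 1, ‖x - z‖ₑ ^ (-γ) ≤ C := by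
  have : Nonempty (Fin n) := ⟨⟨0, Nat.pos_of_ne_zero hn⟩⟩
  refine ⟨∫⁻ y in ball (0 : E n) 2, ‖y‖ₑ ^ (-γ), ?_, fun z hz => ?_⟩
  · have h : IntegrableOn (fun x : E n => ‖x‖ ^ (-γ)) (ball 0 2) := by
      rw [integrableOn_fun_norm_addHaar volume (f := fun r : ℝ => r ^ (-γ))]
      have h2 : IntegrableOn (fun y : ℝ => y ^ ((n : ℝ) - 1 - γ)) (Set.Ioo 0 2) :=
        (intervalIntegral.integrableOn_Ioo_rpow_iff two_pos).2 (by linarith)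
      refine h2.congr_fun (fun y hy => ?_) measurableSet_Ioo
      simp only [finrank_euclideanSpace, Fintype.card_fin, smul_eq_mul]
      rw [← Real.rpow_natCast, ← Real.rpow_add hy.1, Nat.cast_pred (Nat.pos_of_ne_zero hn)]
      ring_nf
    have h3 := h.2
    rw [HasFiniteIntegral] at h3
    refine (lt_of_le_of_lt (le_of_eq ?_) h3).ne
    refine lintegral_congr_ae ?_
    have h0 : ∀ᵐ x ∂(volume.restrict (ball (0 : E n) 2)), x ≠ 0 :=
      ae_restrict_of_ae (Measure.ae_ne volume 0)
    filter_upwards [h0] with x hx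
    have hx' : 0 < ‖x‖ := norm_pos_iff.2 hx
    rw [Real.enorm_of_nonneg (by positivity), ← ENNReal.ofReal_rpow_of_pos hx', ofReal_norm]
  · rw [← lintegral_indicator measurableSet_ball, ← lintegral_indicator measurableSet_ball,
      ← lintegral_sub_right_eq_self (fun y : E n => (ball (0 : E n) 2).indicator
        (fun y => ‖y‖ₑ ^ (-γ)) y) z]
    refine lintegral_mono fun x => ?_
    by_cases hx : x ∈ ball (0 : E n) 1
    · have : x - z ∈ ball (0 : E n) 2 := by
        rw [mem_ball_zero_iff] at hx ⊢
        linarith [norm_sub_le x z]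
      simp [Set.indicator, hx, this]
    · simp [Set.indicator, hx]

lemma enorm_rpow_le_lintegral_ray {β : ℝ} (hβ : 0 ≤ β) {ω z : E n} (hω : ‖ω‖ = 1) (hn : n ≠ 0) :
    ‖ω - z‖ₑ ^ (-β) ≤ 1 + ENNReal.ofReal (2 ^ (β + 1 + n)) * ∫⁻ r in Set.Ioo (0 : ℝ) 1,
      ENNReal.ofReal (r ^ (n - 1)) * ‖r • ω - z‖ₑ ^ (-(β + 1)) := by
  set I := ∫⁻ r in Set.Ioo (0 : ℝ) 1,
      ENNReal.ofReal (r ^ (n - 1)) * ‖r • ω - z‖ₑ ^ (-(β + 1)) with hI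
  rcases le_or_gt 1 ‖ω - z‖ with h | h
  · refine le_trans ?_ le_self_add
    rw [ENNReal.rpow_neg, ENNReal.inv_le_one, ← ofReal_norm]
    simpa using ENNReal.rpow_le_rpow (ENNReal.one_le_ofReal.2 h) hβ
  refine le_trans ?_ le_add_self
  have key : ∀ d : ℝ, ‖ω - z‖ < d → d < 1 →
      ENNReal.ofReal d ^ (-β) ≤ ENNReal.ofReal (2 ^ (β + 1 + n)) * I := by
    intro d hd hd1
    have hd0 : 0 < d := (norm_nonneg _).trans_lt hd
    have h1 : ∫⁻ r in Set.Ioo (1 - d / 2) 1,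
        ENNReal.ofReal ((1 / 2) ^ (n - 1)) * ENNReal.ofReal (2 * d) ^ (-(β + 1)) ≤ I := by
      refine le_trans ?_ (lintegral_mono_set (Set.Ioo_subset_Ioo_left (by linarith :
        (0 : ℝ) ≤ 1 - d / 2)))
      refine setLIntegral_mono' measurableSet_Ioo fun r hr => ?_
      have hr2 : 1 / 2 ≤ r := by linarith [hr.1]
      gcongr ENNReal.ofReal ?_ * ?_
      · gcongr
      · rw [ENNReal.rpow_neg, ENNReal.rpow_neg, ENNReal.inv_le_inv, ← ofReal_norm]
        gcongr
        have : r • ω - z = (ω - z) - (1 - r) • ω := by module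
        rw [this]
        refine (norm_sub_le _ _).trans ?_
        rw [norm_smul, hω, Real.norm_of_nonneg (by linarith [hr.2])]
        linarith [hr.1]
    refine le_trans ?_ (mul_le_mul_right h1 _)
    rw [lintegral_const, Measure.restrict_apply_univ, Real.volume_Ioo,
      ENNReal.ofReal_rpow_of_pos hd0, ENNReal.ofReal_rpow_of_pos (by positivity),
      ← ENNReal.ofReal_mul (by positivity), ← ENNReal.ofReal_mul (by positivity),
      ← ENNReal.ofReal_mul (by positivity)]
    refine ENNReal.ofReal_le_ofReal (le_of_eq ?_)
    have e1 : (2 : ℝ) ^ (β + 1 + n) = 2 ^ (β + 1) * (2 ^ (n - 1) * 2) := by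
      rw [Real.rpow_add two_pos, Real.rpow_natCast, pow_sub_one_mul hn]
    have e2 : d ^ (-(β + 1)) * d = d ^ (-β) := by
      rw [← Real.rpow_add_one hd0.ne']; ring_nf
    have e3 : (2 : ℝ) ^ (β + 1) * 2 ^ (-(β + 1)) = 1 := by
      rw [← Real.rpow_add two_pos]; simp
    have e4 : (1 / 2 : ℝ) ^ (n - 1) * 2 ^ (n - 1) = 1 := by
      rw [← mul_pow]; norm_num
    rw [e1, Real.mul_rpow two_pos.le hd0.le, ← e2]
    calc d ^ (-(β + 1)) * d = ((2 : ℝ) ^ (β + 1) * 2 ^ (-(β + 1))) *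
          ((1 / 2 : ℝ) ^ (n - 1) * 2 ^ (n - 1)) * (d ^ (-(β + 1)) * d) := by rw [e3, e4]; ring
      _ = _ := by ring
  have ht : Filter.Tendsto (fun d : ℝ => ENNReal.ofReal d ^ (-β))
      (nhdsWithin ‖ω - z‖ (Set.Ioi ‖ω - z‖)) (nhds (ENNReal.ofReal ‖ω - z‖ ^ (-β))) :=
    ((ENNReal.continuous_rpow_const.comp ENNReal.continuous_ofReal).tendsto _).mono_left
      nhdsWithin_le_nhds
  rw [← ofReal_norm]
  refine le_of_tendsto ht ?_
  filter_upwards [Ioo_mem_nhdsGT h] with d hd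
  exact key d hd.1 hd.2

/-- Negative powers above `-(n-1)` of the distance are uniformly integrable on the sphere. -/
lemma exists_lintegral_sphere_rpow_le {β : ℝ} (hn : n ≠ 0) (hβ0 : 0 ≤ β) (hβ : β < n - 1) :
    ∃ C : ℝ≥0∞, C ≠ ⊤ ∧ ∀ z : E n, ‖z‖ ≤ 1 →
      ∫⁻ ω : sphere (0 : E n) 1, ‖(ω : E n) - z‖ₑ ^ (-β) ∂(volume : Measure (E n)).toSphere ≤ C := by
  obtain ⟨C, hC, h⟩ := exists_lintegral_ball_rpow_le (n := n) (γ := β + 1) hn (by linarith)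
  refine ⟨(volume : Measure (E n)).toSphere Set.univ + ENNReal.ofReal (2 ^ (β + 1 + n)) * C,
    by finiteness, fun z hz => ?_⟩
  refine (lintegral_mono fun ω : sphere (0 : E n) 1 =>
    enorm_rpow_le_lintegral_ray (z := z) hβ0 (by simp) hn).trans ?_
  rw [lintegral_add_left measurable_const, lintegral_const, one_mul,
    lintegral_const_mul' _ _ ENNReal.ofReal_ne_top]
  gcongr
  rw [← lintegral_ball_polar (fun x => ‖x - z‖ₑ ^ (-(β + 1))) hn (by fun_prop)]
  exact h z hz

lemma half_mul_norm_sub_normalize_le {ω : E n} (hω : ‖ω‖ = 1) {r : ℝ} (hr : 0 < r) (z : E n) :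
    r / 2 * ‖ω - ‖z‖⁻¹ • z‖ ≤ ‖r • ω - z‖ := by
  have h1 : ‖z - (r * ‖z‖⁻¹) • z‖ ≤ ‖r • ω - z‖ := by
    rcases eq_or_ne z 0 with rfl | hz
    · simp
    have hz' : ‖z‖ ≠ 0 := norm_ne_zero_iff.2 hz
    have : z - (r * ‖z‖⁻¹) • z = (1 - r * ‖z‖⁻¹) • z := by module
    rw [this, norm_smul]
    calc ‖1 - r * ‖z‖⁻¹‖ * ‖z‖ = |(1 - r * ‖z‖⁻¹) * ‖z‖| := by
          rw [abs_mul, abs_norm]; rfl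
      _ = |‖r • ω‖ - ‖z‖| := by
          rw [norm_smul, hω, Real.norm_of_nonneg hr.le, abs_sub_comm]
          congr 1; field_simp
      _ ≤ _ := abs_norm_sub_norm_le _ _
  have h2 : r • (ω - ‖z‖⁻¹ • z) = (r • ω - z) + (z - (r * ‖z‖⁻¹) • z) := by module
  have h3 : r * ‖ω - ‖z‖⁻¹ • z‖ = ‖r • (ω - ‖z‖⁻¹ • z)‖ := by
    rw [norm_smul, Real.norm_of_nonneg hr.le]
  have h4 := norm_add_le (r • ω - z) (z - (r * ‖z‖⁻¹) • z)
  rw [← h2, ← h3] at h4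
  linarith

/-- Potential of the concentrating weight, uniform in the concentration parameter `N = n / a`. -/
lemma exists_lintegral_weight_rpow_le {β : ℝ} (hn : n ≠ 0) (hβ0 : 0 ≤ β) (hβ : β < n - 1) :
    ∃ C : ℝ≥0∞, C ≠ ⊤ ∧ ∀ N : ℝ, (n : ℝ) ≤ N → ∀ z : E n, ‖z‖ ≤ 1 →
      ∫⁻ x in ball 0 1, ENNReal.ofReal (N * ‖x‖ ^ (N - n)) *
        (‖x - z‖ₑ ^ (-β) + ‖‖x‖⁻¹ • x - z‖ₑ ^ (-β)) ≤ C := by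
  obtain ⟨C, hC, h⟩ := exists_lintegral_sphere_rpow_le (n := n) hn hβ0 hβ
  refine ⟨ENNReal.ofReal (2 ^ β * n) * C + C, by finiteness, fun N hN z hz => ?_⟩
  have hn0 : (1 : ℝ) ≤ n := by exact_mod_cast Nat.pos_of_ne_zero hn
  have hN0 : 0 < N := by linarith
  rw [lintegral_ball_weight_polar _ hn (by fun_prop) _]
  set ζ := ‖z‖⁻¹ • z with hζ
  have hζ1 : ‖ζ‖ ≤ 1 := by
    rw [hζ, norm_smul, norm_inv, norm_norm]
    exact inv_mul_le_one
  have hray : ∀ ω : sphere (0 : E n) 1, (∫⁻ r in Set.Ioo (0 : ℝ) 1,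
      ENNReal.ofReal (N * r ^ (N - 1)) * (‖r • (ω : E n) - z‖ₑ ^ (-β) +
        ‖‖r • (ω : E n)‖⁻¹ • (r • (ω : E n)) - z‖ₑ ^ (-β))) ≤
      ENNReal.ofReal (2 ^ β * n) * ‖(ω : E n) - ζ‖ₑ ^ (-β) + ‖(ω : E n) - z‖ₑ ^ (-β) := by
    intro ω
    have hω : ‖(ω : E n)‖ = 1 := by simp
    calc _ ≤ ∫⁻ r in Set.Ioo (0 : ℝ) 1,
          (ENNReal.ofReal (2 ^ β * N * r ^ ((N - β) - 1)) * ‖(ω : E n) - ζ‖ₑ ^ (-β) +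
          ENNReal.ofReal (N * r ^ (N - 1)) * ‖(ω : E n) - z‖ₑ ^ (-β)) := by
          refine setLIntegral_mono' measurableSet_Ioo fun r hr => ?_
          have h0 : 0 < r := hr.1
          have e : ‖r • (ω : E n)‖⁻¹ • (r • (ω : E n)) = ω := by
            rw [norm_smul, hω, mul_one, Real.norm_of_nonneg h0.le, smul_smul,
              inv_mul_cancel₀ h0.ne', one_smul]
          rw [e, mul_add]
          gcongr ?_ + _
          have h5 : ‖r • (ω : E n) - z‖ₑ ^ (-β) ≤
              ENNReal.ofReal ((r / 2) ^ (-β)) * ‖(ω : E n) - ζ‖ₑ ^ (-β) := by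
            rw [← ENNReal.ofReal_rpow_of_pos (by positivity), ENNReal.rpow_neg, ENNReal.rpow_neg,
              ENNReal.rpow_neg, ← ENNReal.mul_inv, ← ENNReal.mul_rpow_of_nonneg _ _ hβ0,
              ENNReal.inv_le_inv, ← ofReal_norm, ← ofReal_norm,
              ← ENNReal.ofReal_mul (by positivity)]
            · gcongr
              exact half_mul_norm_sub_normalize_le hω h0 z
            · right; finiteness
            · left; finiteness
          refine (mul_le_mul_right h5 _).trans (le_of_eq ?_)
          rw [← mul_assoc, ← ENNReal.ofReal_mul (by positivity)]
          congr 2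
          rw [Real.div_rpow h0.le two_pos.le, Real.rpow_neg two_pos.le, div_inv_eq_mul,
            show N - β - 1 = (N - 1) + -β by ring, Real.rpow_add h0]
          ring
      _ ≤ _ := by
          rw [lintegral_add_left (by fun_prop), lintegral_mul_const _ (by fun_prop),
            lintegral_mul_const _ (by fun_prop), lintegral_Ioo_mul_rpow (by positivity)
            (by linarith), lintegral_Ioo_mul_rpow (by positivity) (by linarith),
            div_self hN0.ne', ENNReal.ofReal_one, one_mul]
          gcongr
          rw [mul_div_assoc]
          gcongr
          rw [div_le_iff₀ (by linarith)]
          nlinarith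
  refine (lintegral_mono hray).trans ?_
  rw [lintegral_add_left (by fun_prop), lintegral_const_mul _ (by fun_prop)]
  gcongr
  · exact h ζ hζ1
  · exact h z hz

lemma exists_lintegral_beta_le {p : ℝ} (hp : 1 < p) :
    ∃ C : ℝ≥0∞, C ≠ ⊤ ∧ ∀ N : ℝ, (n : ℝ) ≤ N → 0 < N →
      ∫⁻ r in Set.Ioo (0 : ℝ) 1, ENNReal.ofReal (N * r ^ (N - n) * (1 - r) ^ (p - 1)) ≤
        C * ENNReal.ofReal (N ^ (1 - p)) := by
  have hp0 : 0 < p := by linarith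
  refine ⟨ENNReal.ofReal (Real.exp n * Real.Gamma p), ENNReal.ofReal_ne_top,
    fun N hN hN0 => ?_⟩
  have hval := Real.integral_rpow_mul_exp_neg_mul_Ioi hp0 hN0
  have hint : IntegrableOn (fun t : ℝ => t ^ (p - 1) * Real.exp (-(N * t))) (Set.Ioi 0) := by
    refine not_imp_comm.1 integral_undef ?_
    rw [hval]
    have := Real.Gamma_pos_of_pos hp0
    positivity
  calc ∫⁻ r in Set.Ioo (0 : ℝ) 1, ENNReal.ofReal (N * r ^ (N - n) * (1 - r) ^ (p - 1))
      ≤ ∫⁻ r in Set.Ioo (0 : ℝ) 1, ENNReal.ofReal (N * Real.exp n *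
          ((1 - r) ^ (p - 1) * Real.exp (-(N * (1 - r))))) := by
        refine setLIntegral_mono' measurableSet_Ioo fun r hr => ENNReal.ofReal_le_ofReal ?_
        have h1 : 0 ≤ 1 - r := by linarith [hr.2]
        have h2 : r ^ (N - n) ≤ Real.exp n * Real.exp (-(N * (1 - r))) := by
          calc r ^ (N - n) ≤ Real.exp (r - 1) ^ (N - n) := by
                refine Real.rpow_le_rpow hr.1.le ?_ (by linarith)
                linarith [Real.add_one_le_exp (r - 1)]
            _ = Real.exp ((r - 1) * (N - n)) := by rw [Real.exp_mul]
            _ ≤ Real.exp (n + -(N * (1 - r))) := by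
                refine Real.exp_le_exp.2 ?_
                have : (0 : ℝ) ≤ n * r := mul_nonneg (Nat.cast_nonneg n) hr.1.le
                linarith
            _ = _ := Real.exp_add _ _
        have h3 : 0 ≤ (1 - r) ^ (p - 1) := Real.rpow_nonneg h1 _
        calc _ ≤ N * (Real.exp n * Real.exp (-(N * (1 - r)))) * (1 - r) ^ (p - 1) := by gcongr
          _ = _ := by ring
    _ = ∫⁻ r, (Set.Ioo (0 : ℝ) 1).indicator (fun t => ENNReal.ofReal (N * Real.exp n *
          (t ^ (p - 1) * Real.exp (-(N * t))))) (1 - r) := by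
        rw [← lintegral_indicator measurableSet_Ioo]
        refine lintegral_congr fun r => ?_
        have : r ∈ Set.Ioo (0 : ℝ) 1 ↔ 1 - r ∈ Set.Ioo (0 : ℝ) 1 := by
          constructor <;> rintro ⟨h1, h2⟩ <;> constructor <;> linarith
        by_cases h : r ∈ Set.Ioo (0 : ℝ) 1
        · rw [Set.indicator_of_mem h, Set.indicator_of_mem (this.1 h)]
        · rw [Set.indicator_of_notMem h, Set.indicator_of_notMem (mt this.2 h)]
    _ = ∫⁻ t in Set.Ioo (0 : ℝ) 1, ENNReal.ofReal (N * Real.exp n *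
          (t ^ (p - 1) * Real.exp (-(N * t)))) := by
        rw [lintegral_sub_left_eq_self, lintegral_indicator measurableSet_Ioo]
    _ ≤ ∫⁻ t in Set.Ioi (0 : ℝ), ENNReal.ofReal (N * Real.exp n *
          (t ^ (p - 1) * Real.exp (-(N * t)))) := lintegral_mono_set fun t ht => ht.1
    _ = ENNReal.ofReal (N * Real.exp n * ((1 / N) ^ p * Real.Gamma p)) := by
        rw [← ofReal_integral_eq_lintegral_ofReal (hint.const_mul _), integral_const_mul, hval]
        filter_upwards [self_mem_ae_restrict measurableSet_Ioi] with t ht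
        have : 0 ≤ t ^ (p - 1) := Real.rpow_nonneg (le_of_lt ht) _
        positivity
    _ = _ := by
        rw [← ENNReal.ofReal_mul (by have := Real.Gamma_pos_of_pos hp0; positivity)]
        congr 1
        rw [one_div, Real.inv_rpow hN0.le, Real.rpow_sub hN0, Real.rpow_one]
        ring

lemma rpow_lintegral_le {α : Type*} [MeasurableSpace α] {μ : Measure α} {p : ℝ} (hp : 1 ≤ p)
    {f : α → ℝ≥0∞} (hf : Measurable f) :
    (∫⁻ x, f x ∂μ) ^ p ≤ μ Set.univ ^ (p - 1) * ∫⁻ x, f x ^ p ∂μ := by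
  have hp0 : 0 < p := by linarith
  have h := ENNReal.lintegral_mul_norm_pow_le (μ := μ) (f := fun x => f x ^ p) (g := 1)
    (hf.pow_const p).aemeasurable aemeasurable_one (p := 1 / p) (q := 1 - 1 / p)
    (by positivity) (by rw [sub_nonneg, div_le_one hp0]; exact hp) (by ring)
  simp only [Pi.one_apply, ENNReal.one_rpow, mul_one, lintegral_one, ← ENNReal.rpow_mul,
    mul_one_div_cancel hp0.ne', ENNReal.rpow_one] at h
  refine (ENNReal.rpow_le_rpow h hp0.le).trans (le_of_eq ?_)
  rw [ENNReal.mul_rpow_of_nonneg _ _ hp0.le, ← ENNReal.rpow_mul, ← ENNReal.rpow_mul,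
    one_div_mul_cancel hp0.ne', ENNReal.rpow_one, mul_comm, sub_mul, one_mul,
    one_div_mul_cancel hp0.ne']

/-- The radial estimate along a single ray. -/
lemma lintegral_ray_sub_le {u : E n → ℝ} (hu : ContDiff ℝ 1 u) {p : ℝ} (hp : 1 < p) {ω : E n}
    (hω : ‖ω‖ = 1) (hn : n ≠ 0) {N : ℝ} (hN0 : 0 < N) :
    ∫⁻ r in Set.Ioo (0 : ℝ) 1, ENNReal.ofReal (N * r ^ (N - 1)) * ‖u (r • ω) - u ω‖ₑ ^ p ≤
      (∫⁻ r in Set.Ioo (0 : ℝ) 1, ENNReal.ofReal (N * r ^ (N - n) * (1 - r) ^ (p - 1))) *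
        ∫⁻ t in Set.Ioo (0 : ℝ) 1, ENNReal.ofReal (t ^ (n - 1)) * ‖fderiv ℝ u (t • ω)‖ₑ ^ p := by
  have hfd : Continuous (fderiv ℝ u) := hu.continuous_fderiv one_ne_zero
  set A := ∫⁻ t in Set.Ioo (0 : ℝ) 1,
    ENNReal.ofReal (t ^ (n - 1)) * ‖fderiv ℝ u (t • ω)‖ₑ ^ p with hA
  rw [← lintegral_mul_const _ (by fun_prop)]
  refine setLIntegral_mono' measurableSet_Ioo fun r hr => ?_
  have h0 : 0 < r := hr.1
  have h1 : 0 ≤ 1 - r := by linarith [hr.2]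
  have hseg : ‖u (r • ω) - u ω‖ₑ ≤ ∫⁻ t in Set.Ioo r 1, ‖fderiv ℝ u (t • ω)‖ₑ := by
    have := enorm_sub_le_lintegral_segment hu 0 ω hr.2.le
    have e : ‖ω‖ₑ = 1 := by rw [← ofReal_norm, hω, ENNReal.ofReal_one]
    simp only [zero_add, one_smul, e, one_mul] at this
    rwa [← edist_eq_enorm_sub, edist_comm, edist_eq_enorm_sub]
  have hpow : ‖u (r • ω) - u ω‖ₑ ^ p ≤
      ENNReal.ofReal ((1 - r) ^ (p - 1)) * (ENNReal.ofReal (r ^ (1 - n : ℝ)) * A) := by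
    refine (ENNReal.rpow_le_rpow hseg (by linarith)).trans ?_
    refine (rpow_lintegral_le hp.le (by fun_prop)).trans ?_
    rw [Measure.restrict_apply_univ, Real.volume_Ioo, ENNReal.ofReal_rpow_of_nonneg h1
      (by linarith)]
    gcongr
    rw [hA, ← lintegral_const_mul' _ _ ENNReal.ofReal_ne_top]
    refine le_trans ?_ (lintegral_mono_set (Set.Ioo_subset_Ioo_left h0.le))
    refine setLIntegral_mono' measurableSet_Ioo fun t ht => ?_
    rw [← mul_assoc, ← ENNReal.ofReal_mul (by positivity)]
    refine le_mul_of_one_le_left' (ENNReal.one_le_ofReal.2 ?_)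
    calc (1 : ℝ) = r ^ (1 - n : ℝ) * r ^ (n - 1) := by
          rw [← Real.rpow_natCast, ← Real.rpow_add h0, Nat.cast_pred (Nat.pos_of_ne_zero hn)]
          simp
      _ ≤ _ := by
          have := ht.1.le
          gcongr
  refine (mul_le_mul_right hpow _).trans (le_of_eq ?_)
  rw [← mul_assoc, ← mul_assoc, ← ENNReal.ofReal_mul (by positivity),
    ← ENNReal.ofReal_mul (by positivity)]
  congr 2
  rw [show N - n = (N - 1) + (1 - n) by ring, Real.rpow_add h0]
  ring

lemma measurable_radial_deviation {u : E n → ℝ} (hu : Measurable u) :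
    Measurable fun x : E n => ‖u x - u (‖x‖⁻¹ • x)‖ₑ := by
  have h : Measurable fun x : E n => u (‖x‖⁻¹ • x) := hu.comp (by fun_prop)
  exact (hu.sub h).enorm

/-- The `Lᵖ` estimate with the full power of the concentration parameter `N = n / a`. -/
lemma exists_lintegral_weight_sub_rpow_le {p : ℝ} (hp : 1 < p) (hn : n ≠ 0) :
    ∃ C : ℝ≥0∞, C ≠ ⊤ ∧ ∀ N : ℝ, (n : ℝ) ≤ N → ∀ u : E n → ℝ, ContDiff ℝ 1 u →
      ∫⁻ x in ball 0 1, ENNReal.ofReal (N * ‖x‖ ^ (N - n)) * ‖u x - u (‖x‖⁻¹ • x)‖ₑ ^ p ≤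
        C * ENNReal.ofReal (N ^ (1 - p)) * ∫⁻ x in ball 0 1, ‖fderiv ℝ u x‖ₑ ^ p := by
  obtain ⟨C, hC, h⟩ := exists_lintegral_beta_le (n := n) hp
  refine ⟨C, hC, fun N hN u hu => ?_⟩
  have hn0 : (1 : ℝ) ≤ n := by exact_mod_cast Nat.pos_of_ne_zero hn
  have hN0 : 0 < N := by linarith
  have hfd : Continuous (fderiv ℝ u) := hu.continuous_fderiv one_ne_zero
  rw [lintegral_ball_weight_polar _ hn
    ((measurable_radial_deviation hu.continuous.measurable).pow_const p) _, lintegral_ball_polar _ hn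
    (by fun_prop), ← lintegral_const_mul' _ _ (by finiteness)]
  refine lintegral_mono fun ω => ?_
  have hω : ‖(ω : E n)‖ = 1 := by simp
  refine le_trans (le_of_eq ?_) ((lintegral_ray_sub_le hu hp hω hn hN0).trans ?_)
  · refine setLIntegral_congr_fun measurableSet_Ioo fun r hr => ?_
    have h0 : 0 < r := hr.1
    have e : ‖r • (ω : E n)‖⁻¹ • (r • (ω : E n)) = ω := by
      rw [norm_smul, hω, mul_one, Real.norm_of_nonneg h0.le, smul_smul,
        inv_mul_cancel₀ h0.ne', one_smul]
    simp only [e]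
  · gcongr
    exact h N hN hN0

lemma lintegral_comp_homothety (G : E n → ℝ≥0∞) (hG : Measurable G) (x : E n) {t : ℝ}
    (ht : 0 < t) :
    ∫⁻ y, G (x + t • (y - x)) = ENNReal.ofReal (t ^ (-n : ℝ)) * ∫⁻ z, G z := by
  calc ∫⁻ y, G (x + t • (y - x)) = ∫⁻ y, G (x + t • y) :=
        lintegral_sub_right_eq_self (fun y => G (x + t • y)) x
    _ = ∫⁻ z, G (x + z) ∂(Measure.map (t • ·) volume) := by
        rw [lintegral_map (by fun_prop) (measurable_const_smul t)]
    _ = _ := by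
        rw [Measure.map_addHaar_smul _ ht.ne', lintegral_smul_measure,
          lintegral_add_left_eq_self, smul_eq_mul, Real.rpow_neg ht.le, Real.rpow_natCast,
          abs_of_pos (by positivity)]
        simp

lemma lintegral_rpow_neg_le (hn : 2 ≤ n) (x z : E n) :
    ∫⁻ t in Set.Ioi (0 : ℝ), {t : ℝ | ‖z - x‖ ≤ 2 * t}.indicator
        (fun t => ENNReal.ofReal (t ^ (-n : ℝ))) t ≤
      ENNReal.ofReal (2 ^ n) * ‖x - z‖ₑ ^ (-(n - 1 : ℝ)) := by
  have hn' : (2 : ℝ) ≤ n := by exact_mod_cast hn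
  rcases eq_or_ne x z with rfl | hxz
  · rw [sub_self, enorm_zero, ENNReal.zero_rpow_of_neg (by linarith), ENNReal.mul_top (by simp)]
    exact le_top
  have hd : 0 < ‖x - z‖ := norm_pos_iff.2 (sub_ne_zero.2 hxz)
  have hc : 0 < ‖x - z‖ / 2 := by positivity
  calc _ = ∫⁻ t in Set.Ioi (0 : ℝ), (Set.Ici (‖x - z‖ / 2)).indicator
        (fun t => ENNReal.ofReal (t ^ (-n : ℝ))) t := by
        congr 1 with t
        congr 1
        ext t
        rw [Set.mem_ofPred_eq, Set.mem_Ici, norm_sub_rev z x, div_le_iff₀' two_pos]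
    _ ≤ ∫⁻ t in Set.Ici (‖x - z‖ / 2), ENNReal.ofReal (t ^ (-n : ℝ)) := by
        rw [← lintegral_indicator measurableSet_Ici]
        exact setLIntegral_le_lintegral _ _
    _ = ENNReal.ofReal (-(‖x - z‖ / 2) ^ (-n + 1 : ℝ) / (-n + 1)) := by
        rw [setLIntegral_congr Ioi_ae_eq_Ici.symm, ← integral_Ioi_rpow_of_lt (by linarith) hc,
          ofReal_integral_eq_lintegral_ofReal (integrableOn_Ioi_rpow_of_lt (by linarith) hc)]
        filter_upwards [self_mem_ae_restrict measurableSet_Ioi] with t ht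
        exact Real.rpow_nonneg (hc.trans ht).le _
    _ ≤ _ := by
        rw [← ofReal_norm, ENNReal.ofReal_rpow_of_pos hd, ← ENNReal.ofReal_mul (by positivity)]
        refine ENNReal.ofReal_le_ofReal ?_
        rw [neg_div, ← div_neg, show -(-n + 1 : ℝ) = n - 1 by ring,
          show (-n + 1 : ℝ) = -(n - 1 : ℝ) by ring, Real.div_rpow hd.le two_pos.le,
          Real.rpow_neg two_pos.le, div_inv_eq_mul, mul_comm]
        refine (div_le_self (by positivity) (by linarith)).trans ?_
        gcongr
        rw [← Real.rpow_natCast]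
        exact Real.rpow_le_rpow_of_exponent_le one_le_two (by linarith)

/-- A `C¹` function is controlled by the Riesz potential of its gradient on the unit ball. -/
lemma lintegral_sub_le_potential {u : E n → ℝ} (hu : ContDiff ℝ 1 u) (hn : 2 ≤ n) {x : E n}
    (hx : ‖x‖ ≤ 1) :
    ∫⁻ y in ball 0 1, ‖u y - u x‖ₑ ≤ ENNReal.ofReal (2 * 2 ^ n) *
      ∫⁻ z in ball 0 1, ‖fderiv ℝ u z‖ₑ * ‖x - z‖ₑ ^ (-(n - 1 : ℝ)) := by
  have hfd : Continuous (fderiv ℝ u) := hu.continuous_fderiv one_ne_zero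
  set f : E n → ℝ≥0∞ := (ball 0 1).indicator fun z => ‖fderiv ℝ u z‖ₑ with hf
  have hfm : Measurable f := Measurable.indicator (by fun_prop) measurableSet_ball
  let S : Set (E n × ℝ) := {w | ‖w.1 - x‖ ≤ 2 * w.2}
  have hS : MeasurableSet S := by
    apply IsClosed.measurableSet
    exact isClosed_le (by fun_prop) (by fun_prop)
  let G : E n × ℝ → ℝ≥0∞ := S.indicator fun w => f w.1
  have hG : Measurable G := Measurable.indicator (by fun_prop) hS
  calc ∫⁻ y in ball 0 1, ‖u y - u x‖ₑ
      ≤ ∫⁻ y in ball 0 1, 2 * ∫⁻ t in Set.Ioo (0 : ℝ) 1, G (x + t • (y - x), t) := by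
        refine setLIntegral_mono' measurableSet_ball fun y hy => ?_
        rw [mem_ball_zero_iff] at hy
        have h1 := enorm_sub_le_lintegral_segment hu x (y - x) zero_le_one
        have hyx : ‖y - x‖ ≤ 2 := (norm_sub_le _ _).trans (by linarith)
        rw [one_smul, zero_smul, add_zero, add_sub_cancel] at h1
        refine h1.trans ?_
        gcongr ?_ * ?_
        · rw [← ofReal_norm]
          simpa using ENNReal.ofReal_le_ofReal hyx
        · refine setLIntegral_mono' measurableSet_Ioo fun t ht => ?_
          have hS' : (x + t • (y - x), t) ∈ S := by
            change ‖x + t • (y - x) - x‖ ≤ 2 * t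
            rw [add_sub_cancel_left, norm_smul, Real.norm_of_nonneg ht.1.le, mul_comm]
            exact mul_le_mul_of_nonneg_right hyx ht.1.le
          have hb : x + t • (y - x) ∈ ball (0 : E n) 1 := by
            rw [mem_ball_zero_iff, show x + t • (y - x) = (1 - t) • x + t • y by module]
            refine (norm_add_le _ _).trans_lt ?_
            rw [norm_smul, norm_smul, Real.norm_of_nonneg ht.1.le,
              Real.norm_of_nonneg (by linarith [ht.2])]
            nlinarith [ht.1, ht.2]
          simp only [G]
          rw [Set.indicator_of_mem hS', hf, Set.indicator_of_mem hb]
    _ ≤ ∫⁻ y, 2 * ∫⁻ t in Set.Ioo (0 : ℝ) 1, G (x + t • (y - x), t) :=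
        setLIntegral_le_lintegral _ _
    _ = 2 * ∫⁻ t in Set.Ioo (0 : ℝ) 1, ∫⁻ y, G (x + t • (y - x), t) := by
        rw [lintegral_const_mul' _ _ (by finiteness), lintegral_lintegral_swap]
        apply Measurable.aemeasurable
        change Measurable fun w : E n × ℝ => G (x + w.2 • (w.1 - x), w.2)
        fun_prop
    _ = 2 * ∫⁻ t in Set.Ioo (0 : ℝ) 1, ∫⁻ z, ENNReal.ofReal (t ^ (-n : ℝ)) * G (z, t) := by
        congr 1
        refine setLIntegral_congr_fun measurableSet_Ioo fun t ht => ?_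
        rw [lintegral_comp_homothety (fun z => G (z, t)) (by fun_prop) x ht.1,
          lintegral_const_mul' _ _ (by finiteness)]
    _ ≤ 2 * ∫⁻ t in Set.Ioi (0 : ℝ), ∫⁻ z, ENNReal.ofReal (t ^ (-n : ℝ)) * G (z, t) := by
        gcongr
        exact Set.Ioo_subset_Ioi_self
    _ = 2 * ∫⁻ z, ∫⁻ t in Set.Ioi (0 : ℝ), ENNReal.ofReal (t ^ (-n : ℝ)) * G (z, t) := by
        rw [lintegral_lintegral_swap]
        apply Measurable.aemeasurable
        change Measurable fun w : ℝ × E n => ENNReal.ofReal (w.1 ^ (-n : ℝ)) * G (w.2, w.1)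
        fun_prop
    _ ≤ 2 * ∫⁻ z, f z * (ENNReal.ofReal (2 ^ n) * ‖x - z‖ₑ ^ (-(n - 1 : ℝ))) := by
        gcongr with z
        have hset : MeasurableSet {t : ℝ | ‖z - x‖ ≤ 2 * t} :=
          (isClosed_le (by fun_prop) (by fun_prop)).measurableSet
        refine le_trans (le_of_eq ?_) (mul_le_mul_right (lintegral_rpow_neg_le hn x z) _)
        rw [← lintegral_const_mul _ (Measurable.indicator (by fun_prop) hset)]
        refine lintegral_congr fun t => ?_
        by_cases ht : ‖z - x‖ ≤ 2 * t
        · have h1 : (z, t) ∈ S := ht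
          simp only [G]
          rw [Set.indicator_of_mem h1, Set.indicator_of_mem (by exact ht), mul_comm]
        · have h1 : (z, t) ∉ S := ht
          simp only [G]
          rw [Set.indicator_of_notMem h1, Set.indicator_of_notMem (by exact ht), mul_zero,
            mul_zero]
    _ = _ := by
        rw [ENNReal.ofReal_mul two_pos.le, ENNReal.ofReal_ofNat, mul_assoc]
        congr 1
        rw [← lintegral_const_mul' _ _ (by finiteness), ← lintegral_indicator measurableSet_ball]
        refine lintegral_congr fun z => ?_
        by_cases hz : z ∈ ball (0 : E n) 1
        · rw [hf, Set.indicator_of_mem hz, Set.indicator_of_mem hz]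
          ring
        · rw [hf, Set.indicator_of_notMem hz, Set.indicator_of_notMem hz, zero_mul]

lemma lintegral_mul_le_three {α : Type*} [MeasurableSpace α] {μ : Measure α}
    {f K : α → ℝ≥0∞} (hf : Measurable f) (hK : Measurable K) {p q b c : ℝ} (hp : 1 ≤ p)
    (hpq : p ≤ q) (hb : 0 ≤ b) (hc : 0 ≤ c) (hbc : b / q + c * (1 - 1 / p) = 1) :
    ∫⁻ x, f x * K x ∂μ ≤ (∫⁻ x, f x ^ p * K x ^ b ∂μ) ^ (1 / q) *
      ((∫⁻ x, f x ^ p ∂μ) ^ (1 / p - 1 / q) * (∫⁻ x, K x ^ c ∂μ) ^ (1 - 1 / p)) := by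
  have hp0 : 0 < p := by linarith
  have hq0 : 0 < q := by linarith
  have h1 : 0 ≤ 1 / p - 1 / q := sub_nonneg.2 (one_div_le_one_div_of_le hp0 hpq)
  have h2 : 0 ≤ 1 - 1 / p := by rw [sub_nonneg, div_le_one hp0]; exact hp
  have h := ENNReal.lintegral_prod_norm_pow_le (μ := μ) Finset.univ
    (f := ![fun x => f x ^ p * K x ^ b, fun x => f x ^ p, fun x => K x ^ c])
    (p := ![1 / q, 1 / p - 1 / q, 1 - 1 / p])
    (by
      intro i _
      fin_cases i
      · exact ((hf.pow_const p).mul (hK.pow_const b)).aemeasurable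
      · exact (hf.pow_const p).aemeasurable
      · exact (hK.pow_const c).aemeasurable)
    (by simp [Fin.sum_univ_three])
    (by
      intro i _
      fin_cases i
      · exact one_div_nonneg.2 hq0.le
      · exact h1
      · exact h2)
  simp only [Fin.prod_univ_three, Matrix.cons_val_zero, Matrix.cons_val_one,
    Matrix.cons_val] at h
  rw [mul_assoc] at h
  refine le_trans (le_of_eq (lintegral_congr fun x => ?_)) h
  have hq1 : 0 ≤ 1 / q := one_div_nonneg.2 hq0.le
  rw [ENNReal.mul_rpow_of_nonneg _ _ hq1, ← ENNReal.rpow_mul, ← ENNReal.rpow_mul,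
    ← ENNReal.rpow_mul, ← ENNReal.rpow_mul]
  calc f x * K x = f x ^ (p * (1 / q) + p * (1 / p - 1 / q)) *
        K x ^ (b * (1 / q) + c * (1 - 1 / p)) := by
        rw [show p * (1 / q) + p * (1 / p - 1 / q) = 1 by field_simp; ring, mul_one_div, hbc,
          ENNReal.rpow_one, ENNReal.rpow_one]
    _ = _ := by
        rw [ENNReal.rpow_add_of_nonneg _ _ (by positivity) (by positivity),
          ENNReal.rpow_add_of_nonneg _ _ (by positivity) (by positivity)]
        ring

lemma norm_normalize_le_one (x : E n) : ‖‖x‖⁻¹ • x‖ ≤ 1 := by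
  rw [norm_smul, norm_inv, norm_norm]
  exact inv_mul_le_one

/-- The pointwise bound of a deviation from the mean by a subcritical potential. -/
lemma exists_lintegral_sub_le_rpow {p q : ℝ} (hp : 1 < p) (hpq : p ≤ q) (hn : 2 ≤ n)
    (hcrit : ((n : ℝ) - 1) * (1 - 1 / q) < n * (1 - 1 / p)) :
    ∃ β : ℝ, 0 ≤ β ∧ β < n - 1 ∧ ∃ C : ℝ≥0∞, C ≠ ⊤ ∧ ∀ u : E n → ℝ, ContDiff ℝ 1 u →
      ∀ x : E n, ‖x‖ ≤ 1 → ∫⁻ y in ball 0 1, ‖u y - u x‖ₑ ≤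
        C * (∫⁻ z in ball 0 1, ‖fderiv ℝ u z‖ₑ ^ p) ^ (1 / p - 1 / q) *
          (∫⁻ z in ball 0 1, ‖fderiv ℝ u z‖ₑ ^ p * ‖x - z‖ₑ ^ (-β)) ^ (1 / q) := by
  have hn' : (2 : ℝ) ≤ n := by exact_mod_cast hn
  have hn0 : n ≠ 0 := by omega
  have hp0 : 0 < p := by linarith
  have hq0 : 0 < q := by linarith
  have hp1 : 0 < 1 - 1 / p := by rw [sub_pos, div_lt_one hp0]; exact hp
  obtain ⟨b, hb1, hb2⟩ : ∃ b : ℝ, max 0 (q * (1 - n * (1 - 1 / p) / (n - 1))) < b ∧ b < 1 := by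
    refine exists_between (max_lt one_pos ?_)
    have : 1 - 1 / q < n * (1 - 1 / p) / (n - 1) := by
      rw [lt_div_iff₀ (by linarith), mul_comm]; exact hcrit
    calc q * (1 - n * (1 - 1 / p) / (n - 1)) < q * (1 / q) := by gcongr; linarith
      _ = 1 := mul_one_div_cancel hq0.ne'
  have hb0 : 0 < b := (le_max_left _ _).trans_lt hb1
  have hb3 : 1 - n * (1 - 1 / p) / (n - 1) < b / q := by
    rw [lt_div_iff₀ hq0, mul_comm]; exact (le_max_right _ _).trans_lt hb1
  have hbq : b / q ≤ 1 := by rw [div_le_one hq0]; linarith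
  set c := (1 - b / q) / (1 - 1 / p) with hc
  have hc0 : 0 ≤ c := div_nonneg (by linarith) hp1.le
  have hcn : (n - 1) * c < n := by
    rw [hc, mul_div_assoc', div_lt_iff₀ hp1]
    have : 1 - b / q < n * (1 - 1 / p) / (n - 1) := by linarith
    rwa [lt_div_iff₀ (by linarith), mul_comm] at this
  obtain ⟨D, hD, hDz⟩ := exists_lintegral_ball_rpow_le (n := n) hn0 hcn
  refine ⟨(n - 1) * b, by nlinarith, by nlinarith, ENNReal.ofReal (2 * 2 ^ n) * D ^ (1 - 1 / p),
    by have := hp1.le; finiteness, fun u hu x hx => ?_⟩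
  have hfd : Continuous (fderiv ℝ u) := hu.continuous_fderiv one_ne_zero
  refine (lintegral_sub_le_potential hu hn hx).trans ?_
  rw [mul_assoc, mul_assoc]
  gcongr
  refine (lintegral_mul_le_three (b := b) (c := c) (p := p) (q := q) (by fun_prop)
    (by fun_prop) hp.le hpq hb0.le hc0 (by rw [hc, div_mul_cancel₀ _ hp1.ne']; ring)).trans ?_
  simp only [← ENNReal.rpow_mul, neg_mul]
  rw [mul_comm, mul_comm (_ ^ (1 / p - 1 / q)), mul_assoc]
  gcongr
  have h := hDz x hx
  simpa only [← edist_eq_enorm_sub, edist_comm] using h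

/-- The uniform estimate in the subcritical trace range. -/
lemma exists_lintegral_weight_sub_rpow_le_of_subcritical {p q : ℝ} (hp : 1 < p) (hpq : p ≤ q)
    (hn : 2 ≤ n) (hcrit : ((n : ℝ) - 1) * (1 - 1 / q) < n * (1 - 1 / p)) :
    ∃ C : ℝ≥0∞, C ≠ ⊤ ∧ ∀ N : ℝ, (n : ℝ) ≤ N → ∀ u : E n → ℝ, ContDiff ℝ 1 u →
      ∫⁻ x in ball 0 1, ENNReal.ofReal (N * ‖x‖ ^ (N - n)) * ‖u x - u (‖x‖⁻¹ • x)‖ₑ ^ q ≤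
        C * (∫⁻ x in ball 0 1, ‖fderiv ℝ u x‖ₑ ^ p) ^ (q / p) := by
  have hp0 : 0 < p := by linarith
  have hq0 : 0 < q := by linarith
  have hn0 : n ≠ 0 := by omega
  obtain ⟨β, hβ0, hβ, C, hC, hP⟩ := exists_lintegral_sub_le_rpow hp hpq hn hcrit
  obtain ⟨D, hD, hDz⟩ := exists_lintegral_weight_rpow_le hn0 hβ0 hβ
  set V := volume (ball (0 : E n) 1) with hV
  have hV0 : V ≠ 0 := (measure_ball_pos volume 0 one_pos).ne'
  have hVt : V ≠ ⊤ := measure_ball_lt_top.ne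
  have hVi : V⁻¹ ≠ ⊤ := ENNReal.inv_ne_top.2 hV0
  refine ⟨V⁻¹ ^ q * C ^ q * 2 ^ (q - 1) * D, ?_, fun N hN u hu => ?_⟩
  · have h1 : 0 ≤ q - 1 := by linarith
    have h2 := hq0.le
    finiteness
  have hfd : Continuous (fderiv ℝ u) := hu.continuous_fderiv one_ne_zero
  set F := ∫⁻ x in ball 0 1, ‖fderiv ℝ u x‖ₑ ^ p with hF
  let J : E n → ℝ≥0∞ := fun x => ∫⁻ z in ball 0 1, ‖fderiv ℝ u z‖ₑ ^ p * ‖x - z‖ₑ ^ (-β)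
  have hpt : ∀ x ∈ ball (0 : E n) 1, ‖u x - u (‖x‖⁻¹ • x)‖ₑ ^ q ≤
      V⁻¹ ^ q * C ^ q * 2 ^ (q - 1) * F ^ (q / p - 1) * (J x + J (‖x‖⁻¹ • x)) := by
    intro x hx
    have hx1 : ‖x‖ ≤ 1 := (mem_ball_zero_iff.1 hx).le
    have hum : Measurable u := hu.continuous.measurable
    have h1 : V * ‖u x - u (‖x‖⁻¹ • x)‖ₑ ≤
        C * F ^ (1 / p - 1 / q) * (J x ^ (1 / q) + J (‖x‖⁻¹ • x) ^ (1 / q)) := by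
      calc V * ‖u x - u (‖x‖⁻¹ • x)‖ₑ
          = ∫⁻ y in ball (0 : E n) 1, ‖u x - u (‖x‖⁻¹ • x)‖ₑ := by
            rw [setLIntegral_const, mul_comm]
        _ ≤ ∫⁻ y in ball (0 : E n) 1, (‖u y - u x‖ₑ + ‖u y - u (‖x‖⁻¹ • x)‖ₑ) := by
            refine lintegral_mono fun y => ?_
            simp only [← edist_eq_enorm_sub]
            rw [edist_comm (u y) (u x)]
            exact edist_triangle _ _ _
        _ = (∫⁻ y in ball (0 : E n) 1, ‖u y - u x‖ₑ) +
              ∫⁻ y in ball (0 : E n) 1, ‖u y - u (‖x‖⁻¹ • x)‖ₑ :=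
            lintegral_add_left (hum.sub_const _).enorm _
        _ ≤ _ := by
            rw [mul_add]
            exact add_le_add (hP u hu x hx1) (hP u hu _ (norm_normalize_le_one x))
    calc ‖u x - u (‖x‖⁻¹ • x)‖ₑ ^ q
        = V⁻¹ ^ q * (V * ‖u x - u (‖x‖⁻¹ • x)‖ₑ) ^ q := by
          rw [← ENNReal.mul_rpow_of_nonneg _ _ hq0.le, ← mul_assoc,
            ENNReal.inv_mul_cancel hV0 hVt, one_mul]
      _ ≤ V⁻¹ ^ q * (C * F ^ (1 / p - 1 / q) *
            (J x ^ (1 / q) + J (‖x‖⁻¹ • x) ^ (1 / q))) ^ q := by gcongr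
      _ = V⁻¹ ^ q * (C ^ q * F ^ (q / p - 1) *
            (J x ^ (1 / q) + J (‖x‖⁻¹ • x) ^ (1 / q)) ^ q) := by
          rw [ENNReal.mul_rpow_of_nonneg _ _ hq0.le, ENNReal.mul_rpow_of_nonneg _ _ hq0.le,
            ← ENNReal.rpow_mul]
          congr 4
          field_simp
      _ ≤ V⁻¹ ^ q * (C ^ q * F ^ (q / p - 1) *
            (2 ^ (q - 1) * (J x + J (‖x‖⁻¹ • x)))) := by
          gcongr
          refine (ENNReal.rpow_add_le_mul_rpow_add_rpow _ _ (by linarith)).trans (le_of_eq ?_)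
          rw [← ENNReal.rpow_mul, ← ENNReal.rpow_mul, one_div_mul_cancel hq0.ne',
            ENNReal.rpow_one, ENNReal.rpow_one]
      _ = _ := by ring
  have hJ : ∫⁻ x in ball 0 1, ENNReal.ofReal (N * ‖x‖ ^ (N - n)) *
      (J x + J (‖x‖⁻¹ • x)) ≤ D * F := by
    calc _ = ∫⁻ x in ball (0 : E n) 1, ∫⁻ z in ball (0 : E n) 1, ‖fderiv ℝ u z‖ₑ ^ p *
          (ENNReal.ofReal (N * ‖x‖ ^ (N - n)) *
            (‖x - z‖ₑ ^ (-β) + ‖‖x‖⁻¹ • x - z‖ₑ ^ (-β))) := by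
          refine lintegral_congr fun x => ?_
          rw [← lintegral_add_left (by fun_prop), ← lintegral_const_mul' _ _ (by finiteness)]
          refine lintegral_congr fun z => ?_
          ring
      _ = ∫⁻ z in ball (0 : E n) 1, ‖fderiv ℝ u z‖ₑ ^ p * ∫⁻ x in ball (0 : E n) 1,
          (ENNReal.ofReal (N * ‖x‖ ^ (N - n)) *
            (‖x - z‖ₑ ^ (-β) + ‖‖x‖⁻¹ • x - z‖ₑ ^ (-β))) := by
          rw [lintegral_lintegral_swap (by fun_prop)]
          refine lintegral_congr fun z => ?_
          rw [lintegral_const_mul _ (by fun_prop)]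
      _ ≤ ∫⁻ z in ball (0 : E n) 1, ‖fderiv ℝ u z‖ₑ ^ p * D := by
          refine setLIntegral_mono' measurableSet_ball fun z hz => ?_
          gcongr
          exact hDz N hN z (mem_ball_zero_iff.1 hz).le
      _ = _ := by rw [lintegral_mul_const' _ _ hD, mul_comm]
  calc _ ≤ ∫⁻ x in ball (0 : E n) 1, V⁻¹ ^ q * C ^ q * 2 ^ (q - 1) * F ^ (q / p - 1) *
        (ENNReal.ofReal (N * ‖x‖ ^ (N - n)) * (J x + J (‖x‖⁻¹ • x))) := by
        refine setLIntegral_mono' measurableSet_ball fun x hx => ?_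
        refine (mul_le_mul_right (hpt x hx) _).trans (le_of_eq ?_)
        ring
    _ = V⁻¹ ^ q * C ^ q * 2 ^ (q - 1) * F ^ (q / p - 1) *
        ∫⁻ x in ball (0 : E n) 1, (ENNReal.ofReal (N * ‖x‖ ^ (N - n)) *
          (J x + J (‖x‖⁻¹ • x))) := by
        have hJm : Measurable J := by
          apply Measurable.lintegral_prod_right'
            (f := fun w : E n × E n => ‖fderiv ℝ u w.2‖ₑ ^ p * ‖w.1 - w.2‖ₑ ^ (-β))
          fun_prop
        rw [lintegral_const_mul]
        exact Measurable.mul (by fun_prop) (hJm.add (hJm.comp (by fun_prop)))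
    _ ≤ V⁻¹ ^ q * C ^ q * 2 ^ (q - 1) * F ^ (q / p - 1) * (D * F) := by gcongr
    _ = V⁻¹ ^ q * C ^ q * 2 ^ (q - 1) * D * (F ^ (q / p - 1) * F ^ (1 : ℝ)) := by
        rw [ENNReal.rpow_one]; ring
    _ = _ := by
        rw [← ENNReal.rpow_add_of_nonneg _ _ _ zero_le_one, sub_add_cancel]
        rw [sub_nonneg, le_div_iff₀ hp0]
        linarith

lemma lintegral_mul_rpow_interpolate {α : Type*} [MeasurableSpace α] {μ : Measure α}
    {w g : α → ℝ≥0∞} (hw : Measurable w) (hg : Measurable g) {p₀ p₁ θ : ℝ} (hp₀ : 0 ≤ p₀)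
    (hp₁ : 0 ≤ p₁) (hθ0 : 0 ≤ θ) (hθ1 : θ ≤ 1) :
    ∫⁻ x, w x * g x ^ (p₀ * θ + p₁ * (1 - θ)) ∂μ ≤
      (∫⁻ x, w x * g x ^ p₀ ∂μ) ^ θ * (∫⁻ x, w x * g x ^ p₁ ∂μ) ^ (1 - θ) := by
  have hθ2 : 0 ≤ 1 - θ := by linarith
  refine le_trans (le_of_eq (lintegral_congr fun x => ?_))
    (ENNReal.lintegral_mul_norm_pow_le (hw.mul (hg.pow_const p₀)).aemeasurable
      (hw.mul (hg.pow_const p₁)).aemeasurable hθ0 hθ2 (by ring))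
  rw [Pi.mul_apply, Pi.mul_apply, ENNReal.mul_rpow_of_nonneg _ _ hθ0,
    ENNReal.mul_rpow_of_nonneg _ _ hθ2, ← ENNReal.rpow_mul, ← ENNReal.rpow_mul,
    ENNReal.rpow_add_of_nonneg _ _ (by positivity) (by positivity), mul_mul_mul_comm,
    ← ENNReal.rpow_add_of_nonneg _ _ hθ0 hθ2, add_sub_cancel, ENNReal.rpow_one]

lemma lintegral_weight (hn : n ≠ 0) {N : ℝ} (hN : 0 < N) :
    ∫⁻ x in ball (0 : E n) 1, ENNReal.ofReal (N * ‖x‖ ^ (N - n)) =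
      (volume : Measure (E n)).toSphere Set.univ := by
  have h := lintegral_ball_weight_polar (n := n) (fun _ => 1) hn measurable_const N
  simp only [mul_one] at h
  rw [h, lintegral_Ioo_mul_rpow hN.le hN, div_self hN.ne', ENNReal.ofReal_one, lintegral_one]

/-- The quantitative radial trace estimate without angular weight, for `q ≤ p`. -/
lemma exists_lintegral_weight_sub_le_of_le {p q s : ℝ} (hp : 1 < p) (hq : 0 < q) (hqp : q ≤ p)
    (hn : n ≠ 0) (hs : s ≤ 1 - 1 / p) :
    ∃ C : ℝ≥0∞, C ≠ ⊤ ∧ ∀ N : ℝ, (n : ℝ) ≤ N → ∀ u : E n → ℝ, ContDiff ℝ 1 u →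
      ∫⁻ x in ball 0 1, ENNReal.ofReal (N * ‖x‖ ^ (N - n)) * ‖u x - u (‖x‖⁻¹ • x)‖ₑ ^ q ≤
        C * ENNReal.ofReal (N ^ (-s * q)) *
          (∫⁻ x in ball 0 1, ‖fderiv ℝ u x‖ₑ ^ p) ^ (q / p) := by
  have hp0 : 0 < p := by linarith
  obtain ⟨C, hC, h⟩ := exists_lintegral_weight_sub_rpow_le hp hn
  have hqp' : q / p ≤ 1 := (div_le_one hp0).2 hqp
  have hqp0 : 0 ≤ q / p := by positivity
  have hqp1 : 0 ≤ 1 - q / p := by linarith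
  refine ⟨C ^ (q / p) * (volume : Measure (E n)).toSphere Set.univ ^ (1 - q / p), by finiteness,
    fun N hN u hu => ?_⟩
  have hN1 : (1 : ℝ) ≤ N := le_trans (by exact_mod_cast Nat.pos_of_ne_zero hn) hN
  have hN0 : 0 < N := by linarith
  have hint := lintegral_mul_rpow_interpolate (μ := volume.restrict (ball (0 : E n) 1))
    (w := fun x => ENNReal.ofReal (N * ‖x‖ ^ (N - n))) (by fun_prop)
    (measurable_radial_deviation hu.continuous.measurable) hp0.le le_rfl hqp0 hqp'
  simp only [mul_div_cancel₀ q hp0.ne', zero_mul, add_zero, ENNReal.rpow_zero, mul_one,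
    lintegral_weight hn hN0] at hint
  refine hint.trans ?_
  calc _ ≤ (C * ENNReal.ofReal (N ^ (1 - p)) * ∫⁻ x in ball 0 1, ‖fderiv ℝ u x‖ₑ ^ p) ^ (q / p) *
        (volume : Measure (E n)).toSphere Set.univ ^ (1 - q / p) := by
        gcongr
        exact h N hN u hu
    _ = C ^ (q / p) * (volume : Measure (E n)).toSphere Set.univ ^ (1 - q / p) *
        ENNReal.ofReal (N ^ ((1 - p) * (q / p))) *
          (∫⁻ x in ball 0 1, ‖fderiv ℝ u x‖ₑ ^ p) ^ (q / p) := by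
        rw [ENNReal.mul_rpow_of_nonneg _ _ hqp0, ENNReal.mul_rpow_of_nonneg _ _ hqp0,
          ENNReal.ofReal_rpow_of_nonneg (by positivity) hqp0, ← Real.rpow_mul hN0.le]
        ring
    _ ≤ _ := by
        have e : (1 - p) * (q / p) = -(1 - 1 / p) * q := by field_simp; ring
        rw [e]
        gcongr

/-- The quantitative radial trace estimate without angular weight, for `p < q`. -/
lemma exists_lintegral_weight_sub_le_of_lt {p q s : ℝ} (hp : 1 < p) (hpn : p < n) (hpq : p < q)
    (hn : 2 ≤ n) (hs0 : 0 < s) (hs : s < 1 - n / p + (n - 1) / q) :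
    ∃ C : ℝ≥0∞, C ≠ ⊤ ∧ ∀ N : ℝ, (n : ℝ) ≤ N → ∀ u : E n → ℝ, ContDiff ℝ 1 u →
      ∫⁻ x in ball 0 1, ENNReal.ofReal (N * ‖x‖ ^ (N - n)) * ‖u x - u (‖x‖⁻¹ • x)‖ₑ ^ q ≤
        C * ENNReal.ofReal (N ^ (-s * q)) *
          (∫⁻ x in ball 0 1, ‖fderiv ℝ u x‖ₑ ^ p) ^ (q / p) := by
  have hp0 : 0 < p := by linarith
  have hq0 : 0 < q := by linarith
  have hp1 : 0 < p - 1 := by linarith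
  have hn0 : n ≠ 0 := by omega
  -- `θ` is the interpolation parameter, `q₁` the auxiliary subcritical exponent.
  set θ := s * q / (p - 1) with hθ
  have hθ0 : 0 < θ := by positivity
  have hθ1 : θ < 1 := by
    rw [hθ, div_lt_one hp1]
    have h1 : (n - p) / q ≤ (n - p) / p := by
      have : 0 ≤ n - p := by linarith
      gcongr
    have h2 : 1 - n / p + (n - 1) / q = (p - 1) / q + ((n - p) / q - (n - p) / p) := by
      field_simp; ring
    rw [← lt_div_iff₀ hq0]
    linarith
  have hθ2 : 0 < 1 - θ := by linarith
  set q₁ := (q - p * θ) / (1 - θ) with hq₁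
  have hqq₁ : q ≤ q₁ := by
    rw [hq₁, le_div_iff₀ hθ2]
    nlinarith
  have hq₁0 : 0 < q₁ := by linarith
  have hsum : p * θ + q₁ * (1 - θ) = q := by
    rw [hq₁, div_mul_cancel₀ _ hθ2.ne']; ring
  have hqpθ : 0 < q - p * θ := by nlinarith
  have hcrit : ((n : ℝ) - 1) * (1 - 1 / q₁) < n * (1 - 1 / p) := by
    have e1 : 1 / q₁ = (1 - θ) / (q - p * θ) := by rw [hq₁, one_div_div]
    have e2 : n * (1 - 1 / p) - ((n : ℝ) - 1) * (1 - 1 / q₁) =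
        q / (q - p * θ) * (1 - n / p + (n - 1) / q - s) := by
      rw [e1]
      have e3 : s = θ * (p - 1) / q := by rw [hθ]; field_simp
      rw [e3]
      field_simp
      ring
    have : 0 < q / (q - p * θ) * (1 - n / p + (n - 1) / q - s) := by
      have : 0 < 1 - n / p + (n - 1) / q - s := by linarith
      positivity
    linarith
  obtain ⟨C₀, hC₀, h₀⟩ := exists_lintegral_weight_sub_rpow_le hp hn0
  obtain ⟨C₁, hC₁, h₁⟩ := exists_lintegral_weight_sub_rpow_le_of_subcritical hp
    (hpq.le.trans hqq₁) hn hcrit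
  refine ⟨C₀ ^ θ * C₁ ^ (1 - θ), by have := hθ0.le; have := hθ2.le; finiteness,
    fun N hN u hu => ?_⟩
  have hN0 : 0 < N := lt_of_lt_of_le (by linarith) hN
  have hint := lintegral_mul_rpow_interpolate (μ := volume.restrict (ball (0 : E n) 1))
    (w := fun x => ENNReal.ofReal (N * ‖x‖ ^ (N - n))) (by fun_prop)
    (measurable_radial_deviation hu.continuous.measurable) hp0.le hq₁0.le hθ0.le hθ1.le
  rw [hsum] at hint
  refine hint.trans ?_
  set F := ∫⁻ x in ball 0 1, ‖fderiv ℝ u x‖ₑ ^ p with hF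
  calc _ ≤ (C₀ * ENNReal.ofReal (N ^ (1 - p)) * F) ^ θ * (C₁ * F ^ (q₁ / p)) ^ (1 - θ) := by
        gcongr
        · exact h₀ N hN u hu
        · exact h₁ N hN u hu
    _ = C₀ ^ θ * C₁ ^ (1 - θ) * ENNReal.ofReal (N ^ ((1 - p) * θ)) *
          (F ^ θ * F ^ (q₁ / p * (1 - θ))) := by
        rw [ENNReal.mul_rpow_of_nonneg _ _ hθ0.le, ENNReal.mul_rpow_of_nonneg _ _ hθ0.le,
          ENNReal.mul_rpow_of_nonneg _ _ hθ2.le, ← ENNReal.rpow_mul,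
          ENNReal.ofReal_rpow_of_nonneg (by positivity) hθ0.le, ← Real.rpow_mul hN0.le]
        ring
    _ = _ := by
        rw [← ENNReal.rpow_add_of_nonneg _ _ hθ0.le (by positivity)]
        congr 2
        · congr 2
          rw [hθ]; field_simp; ring
        · rw [← hsum]; field_simp

end

/-- quantitative approximation by the radial trace extension on the ball.
For `n ≥ 2`, `1 < p < n`, `1 < q < p(n-1)/(n-p)`, bounded measurable `α : ∂B → [0,∞)` and
`0 < s < δ_{p,q}`, there is `C_s > 0` such that for every `a ∈ (0,1]` and every `C¹`
function `u : ℝⁿ → ℝ`: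
`(∫_B |u(x) - u(x/|x|)|^q μ_a dx)^{1/q} ≤ C_s a^s (∫_B |∇u|^p dx)^{1/p}`. -/
theorem statement_7 (n : ℕ) (hn : 2 ≤ n) (p q : ℝ)
    (hp : 1 < p) (hpn : p < n) (hq : 1 < q) (hq' : q < p * ((n : ℝ) - 1) / ((n : ℝ) - p))
    (α : E n → ℝ) (hα_meas : Measurable α) (hα_nonneg : ∀ x, 0 ≤ α x)
    (hα_bdd : ∃ M : ℝ, ∀ x, α x ≤ M)
    (s : ℝ) (hs : 0 < s) (hs' : s < deltaPQ n p q) :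
    ∃ C : ℝ, 0 < C ∧ ∀ a ∈ Set.Ioc (0 : ℝ) 1, ∀ u : E n → ℝ, ContDiff ℝ 1 u →
      (∫⁻ x in Metric.ball (0 : E n) 1,
          ENNReal.ofReal (|u x - u (‖x‖⁻¹ • x)| ^ q) * ENNReal.ofReal (muW n α a x)) ^ (1 / q)
        ≤ ENNReal.ofReal (C * a ^ s) *
            (∫⁻ x in Metric.ball (0 : E n) 1,
              ENNReal.ofReal (‖fderiv ℝ u x‖ ^ p)) ^ (1 / p) := by
  obtain ⟨M, hM⟩ := hα_bdd
  have hM0 : 0 ≤ M := (hα_nonneg 0).trans (hM 0)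
  have hp0 : 0 < p := by linarith
  have hq0 : 0 < q := by linarith
  have hn0 : n ≠ 0 := by omega
  have hn1 : (1 : ℝ) ≤ n := by exact_mod_cast Nat.pos_of_ne_zero hn0
  have hmain : ∃ C : ℝ≥0∞, C ≠ ⊤ ∧ ∀ N : ℝ, (n : ℝ) ≤ N → ∀ u : E n → ℝ, ContDiff ℝ 1 u →
      ∫⁻ x in ball 0 1, ENNReal.ofReal (N * ‖x‖ ^ (N - n)) * ‖u x - u (‖x‖⁻¹ • x)‖ₑ ^ q ≤
        C * ENNReal.ofReal (N ^ (-s * q)) *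
          (∫⁻ x in ball 0 1, ‖fderiv ℝ u x‖ₑ ^ p) ^ (q / p) := by
    rcases le_or_gt q p with hqp | hpq
    · exact exists_lintegral_weight_sub_le_of_le hp hq0 hqp hn0 (hs'.le.trans (min_le_left _ _))
    · exact exists_lintegral_weight_sub_le_of_lt hp hpn hpq hn hs
        (hs'.trans_le (min_le_right _ _))
  obtain ⟨C, hC, h⟩ := hmain
  set K := (ENNReal.ofReal M * C) ^ (1 / q) with hK
  have hKt : K ≠ ⊤ := by have := (one_div_pos.2 hq0).le; finiteness
  refine ⟨K.toReal + 1, by positivity, fun a ha u hu => ?_⟩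
  have ha0 : 0 < a := ha.1
  have hN : (n : ℝ) ≤ n / a := le_div_self (by positivity) ha0 ha.2
  have hF : ∫⁻ x in ball 0 1, ENNReal.ofReal (‖fderiv ℝ u x‖ ^ p) =
      ∫⁻ x in ball 0 1, ‖fderiv ℝ u x‖ₑ ^ p := by
    refine lintegral_congr fun x => ?_
    rw [← ENNReal.ofReal_rpow_of_nonneg (norm_nonneg _) hp0.le, ofReal_norm]
  rw [hF]
  set F := ∫⁻ x in ball 0 1, ‖fderiv ℝ u x‖ₑ ^ p
  have hL : ∫⁻ x in ball (0 : E n) 1,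
      ENNReal.ofReal (|u x - u (‖x‖⁻¹ • x)| ^ q) * ENNReal.ofReal (muW n α a x) ≤
      ENNReal.ofReal M * ∫⁻ x in ball 0 1, ENNReal.ofReal ((n / a) * ‖x‖ ^ (n / a - n : ℝ)) *
        ‖u x - u (‖x‖⁻¹ • x)‖ₑ ^ q := by
    rw [← lintegral_const_mul' _ _ ENNReal.ofReal_ne_top]
    refine lintegral_mono fun x => ?_
    rw [← ENNReal.ofReal_rpow_of_nonneg (abs_nonneg _) hq0.le, ← Real.enorm_eq_ofReal_abs, mul_comm,
      ← mul_assoc, ← ENNReal.ofReal_mul hM0, muW]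
    gcongr
    exact hM _
  have hNs : ((n : ℝ) / a) ^ (-s) ≤ a ^ s := by
    rw [Real.rpow_neg (by positivity), ← Real.inv_rpow (by positivity), inv_div]
    gcongr
    exact div_le_self ha0.le hn1
  calc _ ≤ (ENNReal.ofReal M * (C * ENNReal.ofReal ((n / a : ℝ) ^ (-s * q)) *
        F ^ (q / p))) ^ (1 / q) := by
        refine ENNReal.rpow_le_rpow (hL.trans ?_) (by positivity)
        gcongr
        exact h _ hN u hu
    _ = K * ENNReal.ofReal ((n / a : ℝ) ^ (-s)) * F ^ (1 / p) := by
        have hq1 : 0 ≤ 1 / q := by positivity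
        rw [← mul_assoc, ← mul_assoc, ENNReal.mul_rpow_of_nonneg _ _ hq1,
          ENNReal.mul_rpow_of_nonneg _ _ hq1, ← hK, ← ENNReal.rpow_mul,
          ENNReal.ofReal_rpow_of_nonneg (by positivity) hq1, ← Real.rpow_mul (by positivity)]
        congr 2
        · congr 2
          field_simp
        · field_simp
    _ ≤ ENNReal.ofReal (K.toReal + 1) * ENNReal.ofReal (a ^ s) * F ^ (1 / p) := by
        gcongr
        rw [← ENNReal.ofReal_toReal hKt]
        refine ENNReal.ofReal_le_ofReal ?_
        rw [ENNReal.toReal_ofReal ENNReal.toReal_nonneg]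
        linarith
    _ = _ := by rw [← ENNReal.ofReal_mul (by positivity)]

end
end
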